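/- Under the standing assumptions with a local driver, the quasi-variational inequality min{ v(t,x) − Mv(t,x), −∂_t v(t,x) − Lv(t,x) − f(t,x, v(t,x), σ^⊤(t,x)∇_x v(t,x)) } = 0 on [0,T) × ℝ^n with terminal condition v(T,x) = ψ(x) admits a viscosity solution v ∈ Π^g_c, and this solution is the unique viscosity solution in Π^g. -/

import Mathlib

open Set Filter Matrix Topology

noncomputable section

/-- The state space `ℝ^n` with the Euclidean norm. -/
abbrev En (n : ℕ) : Type := EuclideanSpace ℝ (Fin n)

/-- The space `ℝ^d` (values of `σᵀ∇v`). -/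
abbrev Ed (d : ℕ) : Type := EuclideanSpace ℝ (Fin d)

/-- Frobenius norm of a matrix. -/
noncomputable def frob {n d : ℕ} (M : Matrix (Fin n) (Fin d) ℝ) : ℝ :=
  Real.sqrt (∑ i, ∑ j, (M i j) ^ 2)

/-- The intervention operator `Mv(t,x) = sup_b { v(t,Γ(t,x,b)) - ℓ(t,x,b) }`. -/
noncomputable def Mop {n : ℕ} {U : Type} [Nonempty U]
    (Γ : ℝ → En n → U → En n) (ℓ : ℝ → En n → U → ℝ)
    (v : ℝ → En n → ℝ) (t : ℝ) (x : En n) : ℝ :=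
  ⨆ b : U, (v t (Γ t x b) - ℓ t x b)

/-- The (parabolic) domain `[0,T] × ℝ^n`. -/
def Strip (n : ℕ) (T : ℝ) : Set (ℝ × En n) := Icc 0 T ×ˢ (univ : Set (En n))

/-- First-order partial derivative `∂g/∂x_i`. -/
noncomputable def pd {n : ℕ} (g : En n → ℝ) (x : En n) (i : Fin n) : ℝ :=
  fderiv ℝ g x (EuclideanSpace.single i 1)

/-- Second-order partial derivative `∂²g/∂x_i∂x_j`. -/
noncomputable def pd2 {n : ℕ} (g : En n → ℝ) (x : En n) (i j : Fin n) : ℝ :=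
  fderiv ℝ (fun y => fderiv ℝ g y (EuclideanSpace.single j 1)) x (EuclideanSpace.single i 1)

/-- The generator `Lφ = Σ_j a_j ∂φ/∂x_j + (1/2) Σ_{i,j} (σσᵀ)_{ij} ∂²φ/∂x_i∂x_j`. -/
noncomputable def genL {n d : ℕ} (a : ℝ → En n → En n)
    (σm : ℝ → En n → Matrix (Fin n) (Fin d) ℝ)
    (φ : ℝ → En n → ℝ) (t : ℝ) (x : En n) : ℝ :=
  (∑ j, a t x j * pd (φ t) x j)
    + (1/2) * ∑ i, ∑ j, (σm t x * (σm t x)ᵀ) i j * pd2 (φ t) x i j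

/-- `σ(t,x)ᵀ ∇_x φ(t,x) ∈ ℝ^d`. -/
noncomputable def sigGrad {n d : ℕ} (σm : ℝ → En n → Matrix (Fin n) (Fin d) ℝ)
    (φ : ℝ → En n → ℝ) (t : ℝ) (x : En n) : Ed d :=
  (WithLp.equiv 2 (Fin d → ℝ)).symm (fun k => ∑ i, σm t x i k * pd (φ t) x i)

/-- Test functions: `C¹` in `t` and `C²` in `x` (jointly `C²`). -/
def IsTest {n : ℕ} (φ : ℝ → En n → ℝ) : Prop :=
  ContDiff ℝ 2 (fun p : ℝ × En n => φ p.1 p.2)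

/-- Time derivative `∂φ/∂t`. -/
noncomputable def ptd {n : ℕ} (φ : ℝ → En n → ℝ) (t : ℝ) (x : En n) : ℝ :=
  deriv (fun s => φ s x) t

/-- Polynomial growth in `x`, uniformly for `t ∈ [0,T]` (the class `Π^g`). -/
def PolyGrowth {n : ℕ} (T : ℝ) (φ : ℝ → En n → ℝ) : Prop :=
  ∃ C > (0:ℝ), ∃ ρ > (0:ℝ), ∀ t ∈ Icc (0:ℝ) T, ∀ x : En n, |φ t x| ≤ C * (1 + ‖x‖ ^ ρ)

/-- The class `Π^g_c`: jointly continuous functions of polynomial growth. -/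
def PGc {n : ℕ} (T : ℝ) (φ : ℝ → En n → ℝ) : Prop :=
  PolyGrowth T φ ∧ ContinuousOn (fun p : ℝ × En n => φ p.1 p.2) (Strip n T)

/-- Locally bounded on `[0,T] × ℝ^n`. -/
def LocBdd {n : ℕ} (T : ℝ) (g : ℝ → En n → ℝ) : Prop :=
  ∀ p ∈ Strip n T, ∃ s ∈ 𝓝 p, ∃ C : ℝ, ∀ q ∈ s ∩ Strip n T, |g q.1 q.2| ≤ C

/-- Viscosity supersolution (local driver `f(t,x,y,z)`). -/
def IsSuper {n d : ℕ} {U : Type} [Nonempty U] (T : ℝ)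
    (Γ : ℝ → En n → U → En n) (ℓ : ℝ → En n → U → ℝ)
    (a : ℝ → En n → En n) (σm : ℝ → En n → Matrix (Fin n) (Fin d) ℝ)
    (f : ℝ → En n → ℝ → Ed d → ℝ) (ψ : En n → ℝ)
    (v : ℝ → En n → ℝ) : Prop :=
  LowerSemicontinuousOn (fun p : ℝ × En n => v p.1 p.2) (Strip n T) ∧
  (∀ x : En n, ψ x ≤ v T x) ∧
  ∀ t ∈ Ico (0:ℝ) T, ∀ x : En n, ∀ φ : ℝ → En n → ℝ, IsTest φ →
    φ t x = v t x →
    IsLocalMaxOn (fun p : ℝ × En n => φ p.1 p.2 - v p.1 p.2) (Strip n T) (t, x) →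
    0 ≤ min (v t x - Mop Γ ℓ v t x)
        (-(ptd φ t x) - genL a σm φ t x - f t x (v t x) (sigGrad σm φ t x))

/-- Viscosity subsolution (local driver `f(t,x,y,z)`). -/
def IsSub {n d : ℕ} {U : Type} [Nonempty U] (T : ℝ)
    (Γ : ℝ → En n → U → En n) (ℓ : ℝ → En n → U → ℝ)
    (a : ℝ → En n → En n) (σm : ℝ → En n → Matrix (Fin n) (Fin d) ℝ)
    (f : ℝ → En n → ℝ → Ed d → ℝ) (ψ : En n → ℝ)
    (u : ℝ → En n → ℝ) : Prop :=
  UpperSemicontinuousOn (fun p : ℝ × En n => u p.1 p.2) (Strip n T) ∧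
  (∀ x : En n, u T x ≤ ψ x) ∧
  ∀ t ∈ Ico (0:ℝ) T, ∀ x : En n, ∀ φ : ℝ → En n → ℝ, IsTest φ →
    φ t x = u t x →
    IsLocalMinOn (fun p : ℝ × En n => φ p.1 p.2 - u p.1 p.2) (Strip n T) (t, x) →
    min (u t x - Mop Γ ℓ u t x)
        (-(ptd φ t x) - genL a σm φ t x - f t x (u t x) (sigGrad σm φ t x)) ≤ 0

/-- Viscosity supersolution (non-local driver `f(t,x,g,z)`, `g ∈ C(ℝ^n,ℝ)`). -/
def IsSuperNL {n d : ℕ} {U : Type} [Nonempty U] (T : ℝ)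
    (Γ : ℝ → En n → U → En n) (ℓ : ℝ → En n → U → ℝ)
    (a : ℝ → En n → En n) (σm : ℝ → En n → Matrix (Fin n) (Fin d) ℝ)
    (f : ℝ → En n → (En n → ℝ) → Ed d → ℝ) (ψ : En n → ℝ)
    (v : ℝ → En n → ℝ) : Prop :=
  LowerSemicontinuousOn (fun p : ℝ × En n => v p.1 p.2) (Strip n T) ∧
  (∀ x : En n, ψ x ≤ v T x) ∧
  ∀ t ∈ Ico (0:ℝ) T, ∀ x : En n, ∀ φ : ℝ → En n → ℝ, IsTest φ →
    φ t x = v t x →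
    IsLocalMaxOn (fun p : ℝ × En n => φ p.1 p.2 - v p.1 p.2) (Strip n T) (t, x) →
    0 ≤ min (v t x - Mop Γ ℓ v t x)
        (-(ptd φ t x) - genL a σm φ t x - f t x (v t) (sigGrad σm φ t x))

/-- Viscosity subsolution (non-local driver `f(t,x,g,z)`). -/
def IsSubNL {n d : ℕ} {U : Type} [Nonempty U] (T : ℝ)
    (Γ : ℝ → En n → U → En n) (ℓ : ℝ → En n → U → ℝ)
    (a : ℝ → En n → En n) (σm : ℝ → En n → Matrix (Fin n) (Fin d) ℝ)
    (f : ℝ → En n → (En n → ℝ) → Ed d → ℝ) (ψ : En n → ℝ)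
    (u : ℝ → En n → ℝ) : Prop :=
  UpperSemicontinuousOn (fun p : ℝ × En n => u p.1 p.2) (Strip n T) ∧
  (∀ x : En n, u T x ≤ ψ x) ∧
  ∀ t ∈ Ico (0:ℝ) T, ∀ x : En n, ∀ φ : ℝ → En n → ℝ, IsTest φ →
    φ t x = u t x →
    IsLocalMinOn (fun p : ℝ × En n => φ p.1 p.2 - u p.1 p.2) (Strip n T) (t, x) →
    min (u t x - Mop Γ ℓ u t x)
        (-(ptd φ t x) - genL a σm φ t x - f t x (u t) (sigGrad σm φ t x)) ≤ 0

section ConvexAnalysis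

open MeasureTheory

theorem measure_image_null_of_lipschitzOnWith {E : Type*} [NormedAddCommGroup E] [NormedSpace ℝ E]
    [FiniteDimensional ℝ E] [MeasurableSpace E] [BorelSpace E] (μ : Measure E) [μ.IsAddHaarMeasure]
    {C : NNReal} {f : E → E} {s : Set E} (hf : LipschitzOnWith C f s) (hs : μ s = 0) :
    μ (f '' s) = 0 := by
  have h1 : (μH[Module.finrank ℝ E] : Measure E) s = 0 :=
    Measure.absolutelyContinuous_isAddHaarMeasure _ μ hs
  have h2 := hf.hausdorffMeasure_image_le (d := (Module.finrank ℝ E : ℝ)) (by positivity)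
  rw [h1, mul_zero] at h2
  exact Measure.absolutelyContinuous_isAddHaarMeasure μ
    (μH[Module.finrank ℝ E] : Measure E) (le_antisymm h2 bot_le)

variable {H : Type*} [NormedAddCommGroup H] [InnerProductSpace ℝ H]

/-- `q` is a (global) subgradient of `G` at `x`. -/
def IsSubgrad (G : H → ℝ) (x q : H) : Prop := ∀ z, G x + inner ℝ q (z - x) ≤ G z

theorem IsSubgrad.monotone {G : H → ℝ} {x₁ x₂ q₁ q₂ : H} (h₁ : IsSubgrad G x₁ q₁)
    (h₂ : IsSubgrad G x₂ q₂) : 0 ≤ inner ℝ (q₁ - q₂) (x₁ - x₂) := by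
  have a := h₁ x₂
  have b := h₂ x₁
  have e : inner ℝ q₁ (x₂ - x₁) = - inner ℝ q₁ (x₁ - x₂) := by
    rw [← inner_neg_right, neg_sub]
  rw [inner_sub_left]
  linarith

theorem IsSubgrad.firmly_nonexpansive {G : H → ℝ} {x₁ x₂ y₁ y₂ : H}
    (h₁ : IsSubgrad G x₁ (y₁ - x₁)) (h₂ : IsSubgrad G x₂ (y₂ - x₂)) :
    ‖x₁ - x₂‖ ^ 2 ≤ inner ℝ (y₁ - y₂) (x₁ - x₂) := by
  have := h₁.monotone h₂
  have e : y₁ - x₁ - (y₂ - x₂) = (y₁ - y₂) - (x₁ - x₂) := by abel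
  rw [e, inner_sub_left, real_inner_self_eq_norm_sq] at this
  linarith

theorem IsSubgrad.norm_sub_le {G : H → ℝ} {x₁ x₂ y₁ y₂ : H}
    (h₁ : IsSubgrad G x₁ (y₁ - x₁)) (h₂ : IsSubgrad G x₂ (y₂ - x₂)) :
    ‖x₁ - x₂‖ ≤ ‖y₁ - y₂‖ := by
  have h := h₁.firmly_nonexpansive h₂
  have h' := real_inner_le_norm (y₁ - y₂) (x₁ - x₂)
  rcases (norm_nonneg (x₁ - x₂)).eq_or_lt with h0 | h0
  · rw [← h0]; positivity
  · nlinarith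

theorem convex_combination_le {G : H → ℝ} (hG : ∀ x, ∃ q, IsSubgrad G x q) (x z : H) (t : ℝ)
    (ht : 0 ≤ t) (ht1 : t ≤ 1) : G (x + t • (z - x)) ≤ (1 - t) * G x + t * G z := by
  obtain ⟨q, hq⟩ := hG (x + t • (z - x))
  have h1 := hq x
  have h2 := hq z
  have e1 : x - (x + t • (z - x)) = (-t) • (z - x) := by module
  have e2 : z - (x + t • (z - x)) = (1 - t) • (z - x) := by module
  rw [e1, inner_smul_right] at h1
  rw [e2, inner_smul_right] at h2
  nlinarith

theorem exists_resolvent [FiniteDimensional ℝ H] {G : H → ℝ} (hG : ∀ x, ∃ q, IsSubgrad G x q)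
    (hc : Continuous G) (y : H) : ∃ x, IsSubgrad G x (y - x) := by
  have hcont : Continuous fun x => G x + 1 / 2 * ‖x - y‖ ^ 2 := by fun_prop
  obtain ⟨q0, hq0⟩ := hG 0
  have hco : Tendsto (fun x => G x + 1 / 2 * ‖x - y‖ ^ 2) (cocompact H) atTop := by
    have h1 : Tendsto (fun x : H => ‖x‖ + (G 0 - 1 / 2 * (1 + ‖q0‖) ^ 2 - (1 + ‖q0‖) * ‖y‖))
        (cocompact H) atTop := tendsto_atTop_add_const_right _ _ (tendsto_norm_cocompact_atTop)
    refine tendsto_atTop_mono (fun x => ?_) h1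
    have h2 := hq0 x
    rw [sub_zero] at h2
    have h3 : -(‖q0‖ * ‖x‖) ≤ inner ℝ q0 x := by
      have := abs_real_inner_le_norm q0 x
      exact neg_le_of_abs_le this
    have h4 : (‖x‖ - ‖y‖) ^ 2 ≤ ‖x - y‖ ^ 2 := by
      apply sq_le_sq'
      · have := norm_sub_norm_le y x
        rw [norm_sub_rev] at this
        linarith
      · exact norm_sub_norm_le x y
    nlinarith [sq_nonneg (‖x‖ - ‖y‖ - (1 + ‖q0‖))]
  obtain ⟨x, hx⟩ := hcont.exists_forall_le hco
  refine ⟨x, fun z => ?_⟩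
  have key : ∀ t : ℝ, 0 < t → t ≤ 1 →
      G x + inner ℝ (y - x) (z - x) ≤ G z + t * (1 / 2 * ‖z - x‖ ^ 2) := by
    intro t ht ht1
    have h1 := hx (x + t • (z - x))
    have h2 := convex_combination_le hG x z t ht.le ht1
    have e : x + t • (z - x) - y = (x - y) + t • (z - x) := by abel
    rw [e, norm_add_sq_real, norm_smul, inner_smul_right, Real.norm_eq_abs, abs_of_pos ht] at h1
    have e2 : inner ℝ (y - x) (z - x) = - inner ℝ (x - y) (z - x) := by
      rw [← inner_neg_left, neg_sub]
    rw [e2]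
    have : t * (G x + - inner ℝ (x - y) (z - x)) ≤ t * (G z + t * (1 / 2 * ‖z - x‖ ^ 2)) := by
      nlinarith
    exact le_of_mul_le_mul_left this ht
  have hl : Tendsto (fun t : ℝ => G z + t * (1 / 2 * ‖z - x‖ ^ 2)) (𝓝[>] 0) (𝓝 (G z)) := by
    have : Tendsto (fun t : ℝ => G z + t * (1 / 2 * ‖z - x‖ ^ 2)) (𝓝 0)
        (𝓝 (G z + 0 * (1 / 2 * ‖z - x‖ ^ 2))) := by
      apply Continuous.tendsto
      fun_prop
    rw [zero_mul, add_zero] at this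
    exact this.mono_left nhdsWithin_le_nhds
  refine ge_of_tendsto hl ?_
  filter_upwards [Ioc_mem_nhdsGT (zero_lt_one' ℝ)] with t ht
  exact key t ht.1 ht.2

theorem abs_sub_le_of_quadratic_increments {φ : ℝ → ℝ} {e C : ℝ}
    (h : ∀ s s', 0 ≤ s → s ≤ s' → s' ≤ 1 → |φ s' - φ s| ≤ e * (s' - s) + C * (s' - s) ^ 2) :
    |φ 1 - φ 0| ≤ e := by
  have key : ∀ N : ℕ, |φ 1 - φ 0| ≤ e + C * (1 / ((N : ℝ) + 1)) := by
    intro N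
    have hN : (0 : ℝ) < (N : ℝ) + 1 := by positivity
    have h1 : ∑ i ∈ Finset.range (N + 1), (φ (((i + 1 : ℕ) : ℝ) / (N + 1)) - φ ((i : ℝ) / (N + 1)))
        = φ 1 - φ 0 := by
      rw [Finset.sum_range_sub (fun i : ℕ => φ ((i : ℝ) / (N + 1)))]
      simp only [Nat.cast_add, Nat.cast_one, Nat.cast_zero, zero_div]
      rw [div_self hN.ne']
    rw [← h1]
    refine (Finset.abs_sum_le_sum_abs _ _).trans ?_
    have h2 : ∀ i ∈ Finset.range (N + 1),
        |φ (((i + 1 : ℕ) : ℝ) / (N + 1)) - φ ((i : ℝ) / (N + 1))|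
          ≤ e * (1 / (N + 1)) + C * (1 / (N + 1)) ^ 2 := by
      intro i hi
      have hi' : (i : ℝ) + 1 ≤ N + 1 := by
        have := Finset.mem_range.1 hi
        exact_mod_cast this
      have hd : ((i + 1 : ℕ) : ℝ) / (N + 1) - (i : ℝ) / (N + 1) = 1 / (N + 1) := by
        push_cast; ring
      have := h ((i : ℝ) / (N + 1)) (((i + 1 : ℕ) : ℝ) / (N + 1)) (by positivity)
        (by have : (0 : ℝ) < 1 / (N + 1) := by positivity
            linarith) (by rw [div_le_one hN]; push_cast; exact hi')
      rwa [hd] at this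
    refine (Finset.sum_le_sum h2).trans (le_of_eq ?_)
    simp only [Finset.sum_const, Finset.card_range, nsmul_eq_mul]
    push_cast
    field_simp
  have hl : Tendsto (fun N : ℕ => e + C * (1 / ((N : ℝ) + 1))) atTop (𝓝 (e + C * 0)) :=
    (tendsto_one_div_add_atTop_nhds_zero_nat.const_mul C).const_add e
  rw [mul_zero, add_zero] at hl
  exact ge_of_tendsto' hl key

/-- `G` has the second-order expansion with gradient `q` and Hessian `X` at `x`. -/
def HasSecondOrderExpansion (G : H → ℝ) (x q : H) (X : H →L[ℝ] H) : Prop :=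
  ∀ ε > (0 : ℝ), ∀ᶠ h in 𝓝 (0 : H),
    |G (x + h) - G x - inner ℝ q h - 1 / 2 * inner ℝ (X h) h| ≤ ε * ‖h‖ ^ 2

theorem hasSecondOrderExpansion_of_subgrad {G : H → ℝ} (hG : ∀ x, ∃ q, IsSubgrad G x q)
    {x q : H} {X : H →L[ℝ] H}
    (hX : ∀ ε > (0 : ℝ), ∃ ρ > (0 : ℝ), ∀ h : H, ‖h‖ < ρ → ∀ q', IsSubgrad G (x + h) q' →
      ‖q' - q - X h‖ ≤ ε * ‖h‖) :
    HasSecondOrderExpansion G x q X := by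
  intro ε hε
  obtain ⟨ρ, hρ, hX⟩ := hX ε hε
  filter_upwards [Metric.ball_mem_nhds (0 : H) hρ] with h hh
  rw [mem_ball_zero_iff] at hh
  choose m hm using hG
  set φ : ℝ → ℝ := fun s => G (x + s • h) - s * inner ℝ q h - s ^ 2 / 2 * inner ℝ (X h) h with hφ
  have hms : ∀ s : ℝ, 0 ≤ s → s ≤ 1 →
      |inner ℝ (m (x + s • h)) h - inner ℝ q h - s * inner ℝ (X h) h| ≤ ε * ‖h‖ ^ 2 := by
    intro s hs hs1
    have hn : ‖s • h‖ ≤ ‖h‖ := by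
      rw [norm_smul, Real.norm_eq_abs, abs_of_nonneg hs]
      nlinarith [norm_nonneg h]
    have h1 := hX (s • h) (lt_of_le_of_lt hn hh) _ (hm _)
    have e : inner ℝ (m (x + s • h)) h - inner ℝ q h - s * inner ℝ (X h) h
        = inner ℝ (m (x + s • h) - q - X (s • h)) h := by
      rw [inner_sub_left, inner_sub_left, map_smul, inner_smul_left]; simp
    rw [e]
    refine (abs_real_inner_le_norm _ _).trans ?_
    calc _ ≤ ε * ‖h‖ * ‖h‖ := by gcongr; exact h1.trans (by gcongr)
      _ = _ := by ring
  have hinc : ∀ s s', 0 ≤ s → s ≤ s' → s' ≤ 1 →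
      |φ s' - φ s| ≤ (ε * ‖h‖ ^ 2) * (s' - s) + (|inner ℝ (X h) h|) * (s' - s) ^ 2 := by
    intro s s' hs hss hs'
    have a := hm (x + s • h) (x + s' • h)
    have b := hm (x + s' • h) (x + s • h)
    have ea : x + s' • h - (x + s • h) = (s' - s) • h := by module
    have eb : x + s • h - (x + s' • h) = -((s' - s) • h) := by module
    rw [ea, inner_smul_right] at a
    rw [eb, inner_neg_right, inner_smul_right] at b
    have c := abs_le.1 (hms s hs (hss.trans hs'))
    have d := abs_le.1 (hms s' (hs.trans hss) hs')
    have hd : 0 ≤ s' - s := by linarith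
    have c1 := mul_le_mul_of_nonneg_left c.1 hd
    have d1 := mul_le_mul_of_nonneg_left d.2 hd
    have f1 := le_abs_self (inner ℝ (X h) h)
    have f2 := neg_abs_le (inner ℝ (X h) h)
    have f1' := mul_le_mul_of_nonneg_left f1 (sq_nonneg (s' - s))
    have f2' := mul_le_mul_of_nonneg_left f2 (sq_nonneg (s' - s))
    have f3 : 0 ≤ (s' - s) ^ 2 * |inner ℝ (X h) h| := by positivity
    simp only [hφ]
    rw [abs_le]
    constructor <;> nlinarith
  have := abs_sub_le_of_quadratic_increments hinc
  simp only [hφ] at this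
  rw [one_smul, zero_smul, add_zero] at this
  convert this using 2
  ring

theorem alexandrov [FiniteDimensional ℝ H] [MeasurableSpace H] [BorelSpace H] (μ : Measure H)
    [μ.IsAddHaarMeasure] {G : H → ℝ} (hG : ∀ x, ∃ q, IsSubgrad G x q) (hc : Continuous G) :
    ∀ᵐ x ∂μ, ∃ q X, IsSubgrad G x q ∧ HasSecondOrderExpansion G x q X := by
  choose J hJ using fun y => exists_resolvent hG hc y
  have hLip : LipschitzWith 1 J := by
    refine LipschitzWith.of_dist_le_mul fun y₁ y₂ => ?_
    rw [dist_eq_norm, dist_eq_norm, NNReal.coe_one, one_mul]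
    exact (hJ y₁).norm_sub_le (hJ y₂)
  have huniq : ∀ x q, IsSubgrad G x q → J (x + q) = x := by
    intro x q hq
    have h1 : IsSubgrad G x (x + q - x) := by rwa [add_sub_cancel_left]
    have := (hJ (x + q)).norm_sub_le h1
    rw [sub_self, norm_zero] at this
    exact sub_eq_zero.1 (norm_le_zero_iff.1 this)
  set D : Set H := {y | DifferentiableAt ℝ J y} with hD
  have hDnull : μ Dᶜ = 0 := hLip.ae_differentiableAt
  set C : Set H := {y | DifferentiableAt ℝ J y ∧ (fderiv ℝ J y).det = 0} with hC
  have h1 : μ (J '' Dᶜ) = 0 :=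
    measure_image_null_of_lipschitzOnWith μ (hLip.lipschitzOnWith (s := Dᶜ)) hDnull
  have h2 : μ (J '' C) = 0 :=
    addHaar_image_eq_zero_of_det_fderivWithin_eq_zero μ
      (fun x hx => hx.1.hasFDerivAt.hasFDerivWithinAt) (fun x hx => hx.2)
  have h3 : ∀ᵐ x ∂μ, x ∉ J '' Dᶜ := measure_eq_zero_iff_ae_notMem.1 h1
  have h4 : ∀ᵐ x ∂μ, x ∉ J '' C := measure_eq_zero_iff_ae_notMem.1 h2
  filter_upwards [h3, h4] with x hx3 hx4
  obtain ⟨q, hq⟩ := hG x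
  have hJy := huniq x q hq
  set y := x + q with hy
  have hdiff : DifferentiableAt ℝ J y := by
    by_contra hcon
    exact hx3 ⟨y, hcon, hJy⟩
  have hdet : (fderiv ℝ J y).det ≠ 0 := fun h0 => hx4 ⟨y, ⟨hdiff, h0⟩, hJy⟩
  set A : H ≃L[ℝ] H := (fderiv ℝ J y).toContinuousLinearEquivOfDetNeZero hdet with hA
  have hAder : HasFDerivAt J (A : H →L[ℝ] H) y := by
    have := hdiff.hasFDerivAt
    rwa [hA, ContinuousLinearMap.coe_toContinuousLinearEquivOfDetNeZero]
  refine ⟨q, (A.symm : H →L[ℝ] H) - ContinuousLinearMap.id ℝ H, hq, ?_⟩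
  refine hasSecondOrderExpansion_of_subgrad hG ?_
  intro ε hε
  -- constants
  set B : ℝ := ‖(A.symm : H →L[ℝ] H)‖ + 1 with hB
  have hBpos : 0 < B := by positivity
  have hBinv : ∀ w, ‖A.symm w‖ ≤ B * ‖w‖ := fun w =>
    ((A.symm : H →L[ℝ] H).le_opNorm w).trans (by nlinarith [norm_nonneg w])
  set c : ℝ := min (1 / (2 * B)) (ε / (2 * B ^ 2)) with hcdef
  have hcpos : 0 < c := by positivity
  have hc1 : c ≤ 1 / (2 * B) := min_le_left _ _
  have hc2 : c ≤ ε / (2 * B ^ 2) := min_le_right _ _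
  have hlo := hAder.isLittleO.def hcpos
  rw [Metric.eventually_nhds_iff] at hlo
  obtain ⟨ρ0, hρ0, hlo⟩ := hlo
  have hexp : ∀ w, ‖w‖ < ρ0 → ‖J (y + w) - x - A w‖ ≤ c * ‖w‖ := by
    intro w hw
    have := @hlo (y + w) (by rw [dist_eq_norm, add_sub_cancel_left]; exact hw)
    rwa [add_sub_cancel_left, hJy] at this
  have hlow : ∀ w, ‖w‖ < ρ0 → ‖w‖ ≤ 2 * B * ‖J (y + w) - x‖ := by
    intro w hw
    have e1 := hexp w hw
    have e2 := hBinv (A w)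
    rw [A.symm_apply_apply] at e2
    have e3 : ‖A w‖ ≤ ‖J (y + w) - x‖ + c * ‖w‖ := by
      have := norm_sub_le (J (y + w) - x) (J (y + w) - x - A w)
      rw [sub_sub_cancel] at this
      linarith
    have e4 : B * c ≤ 1 / 2 := by
      calc B * c ≤ B * (1 / (2 * B)) := by gcongr
        _ = 1 / 2 := by field_simp
    nlinarith [norm_nonneg w, norm_nonneg (A w)]
  -- radius
  set r1 : ℝ := ρ0 / 2 with hr1
  have hr1pos : 0 < r1 := by positivity
  refine ⟨r1 / (4 * B ^ 2), by positivity, fun h hh q' hq' => ?_⟩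
  have hJz := huniq _ _ hq'
  set w : H := x + h + q' - y with hw
  have hyw : y + w = x + h + q' := by rw [hw]; abel
  have hJw : J (y + w) = x + h := by rw [hyw]; exact hJz
  have hwsmall : ‖w‖ < ρ0 := by
    by_contra hcon
    push Not at hcon
    have hwpos : 0 < ‖w‖ := hρ0.trans_le hcon
    -- the point at distance `r1` on the segment towards `w`
    set s : ℝ := r1 / ‖w‖ with hs
    have hspos : 0 < s := by positivity
    have hsw : ‖s • w‖ = r1 := by
      rw [norm_smul, Real.norm_eq_abs, abs_of_pos hspos, hs]; field_simp
    have hs1 : s < 1 := by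
      rw [hs, div_lt_one hwpos]; linarith
    have a1 := hlow (s • w) (by rw [hsw]; linarith)
    rw [hsw] at a1
    -- monotonicity
    have m1 := (hJ (y + s • w)).firmly_nonexpansive (hJ y)
    have m2 := (hJ (y + w)).firmly_nonexpansive (hJ (y + s • w))
    rw [hJy, add_sub_cancel_left, inner_smul_left] at m1
    have e1 : y + w - (y + s • w) = (1 - s) • w := by module
    rw [e1, inner_smul_left] at m2
    simp only [conj_trivial] at m1 m2
    have m3 : 0 ≤ inner ℝ w (J (y + w) - J (y + s • w)) := by
      have : 0 ≤ (1 - s) * inner ℝ w (J (y + w) - J (y + s • w)) := le_trans (sq_nonneg _) m2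
      by_contra hneg
      push Not at hneg
      nlinarith
    have e2 : inner ℝ w (J (y + w) - x)
        = inner ℝ w (J (y + w) - J (y + s • w)) + inner ℝ w (J (y + s • w) - x) := by
      rw [← inner_add_right]; congr 1; abel
    have m4 : ‖J (y + s • w) - x‖ ^ 2 ≤ s * inner ℝ w (J (y + w) - x) := by
      rw [e2]; nlinarith
    rw [hJw, add_sub_cancel_left] at m4
    have m5 : inner ℝ w h ≤ ‖w‖ * ‖h‖ := real_inner_le_norm w h
    have m6 : s * (‖w‖ * ‖h‖) = r1 * ‖h‖ := by rw [hs]; field_simp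
    have m7 : ‖J (y + s • w) - x‖ ^ 2 ≤ r1 * ‖h‖ := by
      rw [← m6]; exact m4.trans (by gcongr)
    have m8 : r1 ^ 2 ≤ 4 * B ^ 2 * ‖J (y + s • w) - x‖ ^ 2 := by
      have := pow_le_pow_left₀ hr1pos.le a1 2
      nlinarith
    have m9 : r1 ^ 2 ≤ 4 * B ^ 2 * (r1 * ‖h‖) := m8.trans (by gcongr)
    rw [lt_div_iff₀ (by positivity)] at hh
    nlinarith
  have a1 := hlow w hwsmall
  have a2 := hexp w hwsmall
  rw [hJw, add_sub_cancel_left] at a1 a2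
  have e : q' - q - ((A.symm : H →L[ℝ] H) - ContinuousLinearMap.id ℝ H) h
      = - A.symm (h - A w) := by
    simp only [_root_.sub_apply, ContinuousLinearEquiv.coe_coe,
      ContinuousLinearMap.id_apply, map_sub, A.symm_apply_apply]
    rw [hw, hy]
    abel
  rw [e, norm_neg]
  calc ‖A.symm (h - A w)‖ ≤ B * ‖h - A w‖ := hBinv _
    _ ≤ B * (c * ‖w‖) := by gcongr
    _ ≤ B * (ε / (2 * B ^ 2) * (2 * B * ‖h‖)) := by gcongr
    _ = ε * ‖h‖ := by field_simp

end ConvexAnalysis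

section TheoremOnSums

open MeasureTheory

variable {H : Type*} [NormedAddCommGroup H] [InnerProductSpace ℝ H]

theorem eq_zero_of_forall_inner_le_sq {w : H} {Λ : ℝ} (hΛ : 0 < Λ)
    (h : ∀ v, inner ℝ w v ≤ Λ * ‖v‖ ^ 2) : w = 0 := by
  have := h ((1 / (2 * Λ)) • w)
  rw [inner_smul_right, real_inner_self_eq_norm_sq, norm_smul, mul_pow, Real.norm_eq_abs, sq_abs]
    at this
  have e : Λ * ((1 / (2 * Λ)) ^ 2 * ‖w‖ ^ 2) = 1 / 2 * (1 / (2 * Λ) * ‖w‖ ^ 2) := by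
    field_simp
  rw [e] at this
  have h2 : 1 / (2 * Λ) * ‖w‖ ^ 2 ≤ 0 := by linarith
  have h3 : ‖w‖ ^ 2 ≤ 0 := by
    by_contra hcon
    push Not at hcon
    have : 0 < 1 / (2 * Λ) * ‖w‖ ^ 2 := by positivity
    linarith
  have : ‖w‖ = 0 := by nlinarith [norm_nonneg w]
  exact norm_eq_zero.1 this

theorem norm_sub_le_of_contact {W : H → ℝ} {Λ : ℝ} (hΛ : 0 < Λ)
    (hsc : ∀ ζ, ∃ l, ∀ z, W ζ + inner ℝ l (z - ζ) - Λ * ‖z - ζ‖ ^ 2 ≤ W z) {p₁ p₂ ζ₁ ζ₂ : H}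
    (h₁ : ∀ z, W z ≤ W ζ₁ + inner ℝ p₁ (z - ζ₁)) (h₂ : ∀ z, W z ≤ W ζ₂ + inner ℝ p₂ (z - ζ₂)) :
    ‖p₁ - p₂‖ ≤ 4 * Λ * ‖ζ₁ - ζ₂‖ := by
  obtain ⟨l, hl⟩ := hsc ζ₁
  have hlp : l = p₁ := by
    rw [← sub_eq_zero]
    refine eq_zero_of_forall_inner_le_sq hΛ fun v => ?_
    have a := hl (ζ₁ + v)
    have b := h₁ (ζ₁ + v)
    rw [add_sub_cancel_left] at a b
    rw [inner_sub_left]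
    linarith
  subst hlp
  set s : ℝ := 1 / (4 * Λ) with hs
  have a := hl (ζ₂ + s • (l - p₂))
  have b := h₂ (ζ₂ + s • (l - p₂))
  have c := h₁ ζ₂
  rw [add_sub_cancel_left] at b
  have e : ζ₂ + s • (l - p₂) - ζ₁ = (ζ₂ - ζ₁) + s • (l - p₂) := by abel
  rw [e, inner_add_right] at a
  have d : inner ℝ l (s • (l - p₂)) - inner ℝ p₂ (s • (l - p₂)) = s * ‖l - p₂‖ ^ 2 := by
    rw [← inner_sub_left, inner_smul_right, real_inner_self_eq_norm_sq]
  have f : ‖(ζ₂ - ζ₁) + s • (l - p₂)‖ ≤ ‖ζ₁ - ζ₂‖ + s * ‖l - p₂‖ := by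
    refine (norm_add_le _ _).trans ?_
    rw [norm_sub_rev, norm_smul, Real.norm_eq_abs, abs_of_pos (by positivity : 0 < s)]
  have f2 := pow_le_pow_left₀ (norm_nonneg _) f 2
  have g : s * ‖l - p₂‖ ^ 2 ≤ Λ * (‖ζ₁ - ζ₂‖ + s * ‖l - p₂‖) ^ 2 := by
    have := mul_le_mul_of_nonneg_left f2 hΛ.le
    linarith
  set N := ‖l - p₂‖
  set D := ‖ζ₁ - ζ₂‖
  have hN : 0 ≤ N := norm_nonneg _
  have hD : 0 ≤ D := norm_nonneg _
  have hs4 : 4 * Λ * s = 1 := by rw [hs]; field_simp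
  have hspos : 0 < s := by positivity
  have g2 : N ^ 2 ≤ (2 * Λ * D + N / 2) ^ 2 := by
    have h1 : (2 * Λ * D + N / 2) ^ 2 = 4 * Λ * (Λ * (D + s * N) ^ 2) := by
      have : N / 2 = 2 * Λ * (s * N) := by
        have : 2 * Λ * (s * N) = (4 * Λ * s) * N / 2 := by ring
        rw [this, hs4]; ring
      rw [this]; ring
    have h2 : N ^ 2 = 4 * Λ * (s * N ^ 2) := by
      have : 4 * Λ * (s * N ^ 2) = (4 * Λ * s) * N ^ 2 := by ring
      rw [this, hs4, one_mul]
    rw [h1, h2]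
    gcongr
  have := abs_le_of_sq_le_sq g2 (by positivity)
  rw [abs_of_nonneg hN] at this
  linarith

theorem jensen_perturbation [FiniteDimensional ℝ H] [MeasurableSpace H] [BorelSpace H]
    (μ : Measure H) [μ.IsAddHaarMeasure] {W : H → ℝ} {Λ : ℝ} (hΛ : 0 < Λ)
    (hsc : ∀ ζ, ∃ l, ∀ z, W ζ + inner ℝ l (z - ζ) - Λ * ‖z - ζ‖ ^ 2 ≤ W z)
    (hmax : ∀ p, ∃ ζ, ∀ z, W z ≤ W ζ + inner ℝ p (z - ζ)) {Z : Set H} (hZ : μ Z = 0) {r : ℝ}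
    (hr : 0 < r) :
    ∃ p ζ, ‖p‖ ≤ r ∧ ζ ∉ Z ∧ ∀ z, W z ≤ W ζ + inner ℝ p (z - ζ) := by
  by_contra hcon
  push Not at hcon
  choose ζ hζ using hmax
  have hsub : ζ '' Metric.closedBall 0 r ⊆ Z := by
    rintro _ ⟨p, hp, rfl⟩
    by_contra hn
    obtain ⟨z, hz⟩ := hcon p (ζ p) (mem_closedBall_zero_iff.1 hp) hn
    exact absurd (hζ p z) (not_le.2 hz)
  have hinj : InjOn ζ (Metric.closedBall 0 r) := by
    intro p _ p' _ h
    have := norm_sub_le_of_contact hΛ hsc (hζ p) (hζ p')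
    rw [h, sub_self, norm_zero, mul_zero] at this
    exact sub_eq_zero.1 (norm_le_zero_iff.1 this)
  set g := Function.invFunOn ζ (Metric.closedBall 0 r) with hg
  have hgl : ∀ p ∈ Metric.closedBall (0 : H) r, g (ζ p) = p := fun p hp =>
    hinj.leftInvOn_invFunOn hp
  have hLip : LipschitzOnWith (4 * Λ).toNNReal g (ζ '' Metric.closedBall 0 r) := by
    refine LipschitzOnWith.of_dist_le_mul ?_
    rintro _ ⟨p, hp, rfl⟩ _ ⟨p', hp', rfl⟩
    rw [hgl p hp, hgl p' hp', dist_eq_norm, dist_eq_norm, Real.coe_toNNReal _ (by positivity)]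
    exact norm_sub_le_of_contact hΛ hsc (hζ p) (hζ p')
  have h0 := measure_image_null_of_lipschitzOnWith μ hLip (measure_mono_null hsub hZ)
  have himg : g '' (ζ '' Metric.closedBall 0 r) = Metric.closedBall 0 r := by
    rw [image_image]
    ext p
    constructor
    · rintro ⟨p', hp', rfl⟩
      show g (ζ p') ∈ _
      rwa [hgl p' hp']
    · intro hp
      exact ⟨p, hp, hgl p hp⟩
  rw [himg] at h0
  exact (Metric.measure_closedBall_pos μ (0 : H) hr).ne' h0

/-- A sup-convolution `S` of `g` over `K`, together with a selection `m` of maximizers. -/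
structure IsSupConv (K : Set H) (g : H → ℝ) (ε : ℝ) (S : H → ℝ) (m : H → H) : Prop where
  mem : ∀ ξ, m ξ ∈ K
  eq : ∀ ξ, S ξ = g (m ξ) - ‖m ξ - ξ‖ ^ 2 / (2 * ε)
  le : ∀ ξ, ∀ x ∈ K, g x - ‖x - ξ‖ ^ 2 / (2 * ε) ≤ S ξ

theorem exists_isSupConv {K : Set H} (hK : IsCompact K) (hne : K.Nonempty) {g : H → ℝ}
    (hg : UpperSemicontinuousOn g K) {ε : ℝ} :
    ∃ S m, IsSupConv K g ε S m := by
  have h : ∀ ξ, ∃ x ∈ K, IsMaxOn (fun x => g x + -(‖x - ξ‖ ^ 2 / (2 * ε))) K x := by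
    intro ξ
    refine UpperSemicontinuousOn.exists_isMaxOn hne hK (hg.add ?_)
    refine ContinuousOn.upperSemicontinuousOn (Continuous.continuousOn ?_)
    fun_prop
  choose m hm hmax using h
  refine ⟨fun ξ => g (m ξ) - ‖m ξ - ξ‖ ^ 2 / (2 * ε), m, hm, fun ξ => rfl, fun ξ x hx => ?_⟩
  have := hmax ξ hx
  simp only [mem_ofPred_eq] at this
  linarith

namespace IsSupConv

variable {K : Set H} {g : H → ℝ} {ε : ℝ} {S : H → ℝ} {m : H → H}

theorem isSubgrad (h : IsSupConv K g ε S m) (hε : 0 < ε) (ξ : H) :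
    IsSubgrad (fun ξ => S ξ + ‖ξ‖ ^ 2 / (2 * ε)) ξ ((1 / ε) • m ξ) := by
  intro z
  have h1 := h.le z (m ξ) (h.mem ξ)
  have h2 := h.eq ξ
  rw [norm_sub_sq_real] at h1 h2
  rw [inner_smul_left, inner_sub_right]
  simp only [conj_trivial]
  rw [h2]
  have e1 : (‖m ξ‖ ^ 2 - 2 * inner ℝ (m ξ) z + ‖z‖ ^ 2) / (2 * ε)
      = ‖m ξ‖ ^ 2 / (2 * ε) - 1 / ε * inner ℝ (m ξ) z + ‖z‖ ^ 2 / (2 * ε) := by field_simp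
  have e2 : (‖m ξ‖ ^ 2 - 2 * inner ℝ (m ξ) ξ + ‖ξ‖ ^ 2) / (2 * ε)
      = ‖m ξ‖ ^ 2 / (2 * ε) - 1 / ε * inner ℝ (m ξ) ξ + ‖ξ‖ ^ 2 / (2 * ε) := by field_simp
  rw [e1] at h1
  rw [e2]
  linarith

theorem continuous_add_sq (h : IsSupConv K g ε S m) (hK : IsCompact K) (hε : 0 < ε) :
    Continuous (fun ξ => S ξ + ‖ξ‖ ^ 2 / (2 * ε)) := by
  obtain ⟨R, hR⟩ := hK.isBounded.exists_norm_le
  have hR0 : 0 ≤ R := (norm_nonneg _).trans (hR _ (h.mem 0))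
  have key : ∀ ξ z, (S ξ + ‖ξ‖ ^ 2 / (2 * ε)) - (S z + ‖z‖ ^ 2 / (2 * ε))
      ≤ (R / ε) * ‖ξ - z‖ := by
    intro ξ z
    have h1 := h.isSubgrad hε ξ z
    have h2 : inner ℝ ((1 / ε) • m ξ) (ξ - z) ≤ (R / ε) * ‖ξ - z‖ := by
      refine (real_inner_le_norm _ _).trans ?_
      rw [norm_smul, Real.norm_eq_abs, abs_of_pos (by positivity)]
      have := hR _ (h.mem ξ)
      calc 1 / ε * ‖m ξ‖ * ‖ξ - z‖ ≤ 1 / ε * R * ‖ξ - z‖ := by gcongr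
        _ = _ := by ring
    have h3 : inner ℝ ((1 / ε) • m ξ) (ξ - z) = - inner ℝ ((1 / ε) • m ξ) (z - ξ) := by
      rw [← inner_neg_right, neg_sub]
    dsimp only at h1
    linarith
  have hL : LipschitzWith (R / ε).toNNReal (fun ξ => S ξ + ‖ξ‖ ^ 2 / (2 * ε)) := by
    refine LipschitzWith.of_dist_le_mul fun ξ z => ?_
    rw [Real.coe_toNNReal _ (by positivity), Real.dist_eq, dist_eq_norm, abs_le]
    have := key ξ z
    have := key z ξ
    rw [norm_sub_rev] at this
    constructor <;> linarith
  exact hL.continuous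

theorem shift (h : IsSupConv K g ε S m) (ξ : H) {z : H} (hz : z ∈ K) :
    g z ≤ g (m ξ) + (S (ξ + (z - m ξ)) - S ξ) := by
  have h1 := h.le (ξ + (z - m ξ)) z hz
  rw [h.eq ξ]
  have e : z - (ξ + (z - m ξ)) = m ξ - ξ := by abel
  rw [e] at h1
  linarith

end IsSupConv

theorem HasSecondOrderExpansion.sub_sq {G : H → ℝ} {x q : H} {X : H →L[ℝ] H} {S : H → ℝ} {ε : ℝ}
    (hGS : G = fun ξ => S ξ + ‖ξ‖ ^ 2 / (2 * ε)) (h : HasSecondOrderExpansion G x q X)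
    (hε : 0 < ε) :
    HasSecondOrderExpansion S x (q - (1 / ε) • x) (X - (1 / ε) • ContinuousLinearMap.id ℝ H) := by
  intro ν hν
  filter_upwards [h ν hν] with v hv
  rw [hGS] at hv
  convert hv using 2
  simp only [_root_.sub_apply, inner_sub_left, inner_smul_left, norm_add_sq_real,
    ContinuousLinearMap.id_apply, _root_.smul_apply, real_inner_self_eq_norm_sq,
    conj_trivial]
  field_simp
  ring

/-- The quadruple penalization whose maximizers produce the jets in `exists_jets`. -/
def quadPenal (g₁ g₂ : H → ℝ) (ε : ℝ) (p₁ p₂ x y ξ η : H) : ℝ :=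
  g₁ x + g₂ y - (‖x - ξ‖ ^ 2 + ‖y - η‖ ^ 2 + ‖ξ - η‖ ^ 2) / (2 * ε) - inner ℝ p₁ ξ - inner ℝ p₂ η

theorem jet_of_expansion {K : Set H} {g S : H → ℝ} {m : H → H} {ε : ℝ} {ξ P : H} {X : H →L[ℝ] H}
    (h : IsSupConv K g ε S m) (hX : HasSecondOrderExpansion S ξ P X) :
    ∀ ν > (0 : ℝ), ∀ᶠ z in 𝓝[K] (m ξ), g z ≤ g (m ξ) + inner ℝ P (z - m ξ)
      + 1 / 2 * inner ℝ (X (z - m ξ)) (z - m ξ) + ν * ‖z - m ξ‖ ^ 2 := by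
  intro ν hν
  have h1 : Tendsto (fun z => z - m ξ) (𝓝[K] (m ξ)) (𝓝 0) := by
    have : Tendsto (fun z => z - m ξ) (𝓝 (m ξ)) (𝓝 (m ξ - m ξ)) :=
      (continuous_id.sub continuous_const).tendsto _
    rw [sub_self] at this
    exact this.mono_left nhdsWithin_le_nhds
  filter_upwards [h1.eventually (hX ν hν), self_mem_nhdsWithin] with z hz hzK
  have h2 := h.shift ξ hzK
  have h3 := (abs_le.1 hz).2
  linarith

theorem exists_jets [FiniteDimensional ℝ H] {K : Set H} (hK : IsCompact K) (hne : K.Nonempty)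
    {g₁ g₂ : H → ℝ} (hg₁ : UpperSemicontinuousOn g₁ K) (hg₂ : UpperSemicontinuousOn g₂ K)
    {ε r : ℝ} (hε : 0 < ε) (hr : 0 < r) :
    ∃ (p₁ p₂ x y ξ η : H) (X Y : H →L[ℝ] H), x ∈ K ∧ y ∈ K ∧ ‖p₁‖ ≤ r ∧ ‖p₂‖ ≤ r ∧
      (∀ x' ∈ K, ∀ y' ∈ K, ∀ ξ' η',
        quadPenal g₁ g₂ ε p₁ p₂ x' y' ξ' η' ≤ quadPenal g₁ g₂ ε p₁ p₂ x y ξ η) ∧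
      (∀ ν > (0 : ℝ), ∀ᶠ z in 𝓝[K] x, g₁ z ≤ g₁ x + inner ℝ ((1 / ε) • (ξ - η) + p₁) (z - x)
        + 1 / 2 * inner ℝ (X (z - x)) (z - x) + ν * ‖z - x‖ ^ 2) ∧
      (∀ ν > (0 : ℝ), ∀ᶠ z in 𝓝[K] y, g₂ z ≤ g₂ y + inner ℝ (-(1 / ε) • (ξ - η) + p₂) (z - y)
        + 1 / 2 * inner ℝ (Y (z - y)) (z - y) + ν * ‖z - y‖ ^ 2) ∧
      ∀ h k, inner ℝ (X h) h + inner ℝ (Y k) k ≤ ‖h - k‖ ^ 2 / ε := by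
  classical
  let : MeasurableSpace H := borel H
  have : BorelSpace H := ⟨rfl⟩
  let : MeasurableSpace (WithLp 2 (H × H)) := borel _
  have : BorelSpace (WithLp 2 (H × H)) := ⟨rfl⟩
  obtain ⟨S₁, m₁, h₁⟩ := exists_isSupConv hK hne hg₁ (ε := ε)
  obtain ⟨S₂, m₂, h₂⟩ := exists_isSupConv hK hne hg₂ (ε := ε)
  set G₁ : H → ℝ := fun ξ => S₁ ξ + ‖ξ‖ ^ 2 / (2 * ε) with hG₁
  set G₂ : H → ℝ := fun ξ => S₂ ξ + ‖ξ‖ ^ 2 / (2 * ε) with hG₂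
  set μ : Measure H := Measure.addHaar with hμ
  have al₁ := alexandrov μ (fun x => ⟨_, h₁.isSubgrad hε x⟩) (h₁.continuous_add_sq hK hε)
  have al₂ := alexandrov μ (fun x => ⟨_, h₂.isSubgrad hε x⟩) (h₂.continuous_add_sq hK hε)
  set e := WithLp.prodContinuousLinearEquiv 2 ℝ H H with he
  set ν : Measure (WithLp 2 (H × H)) := (μ.prod μ).map e.symm with hν
  have : ν.IsAddHaarMeasure := e.symm.isAddHaarMeasure_map (μ.prod μ)
  have hgood : ∀ᵐ ζ ∂ν, (∃ q X, IsSubgrad G₁ ζ.fst q ∧ HasSecondOrderExpansion G₁ ζ.fst q X) ∧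
      (∃ q X, IsSubgrad G₂ ζ.snd q ∧ HasSecondOrderExpansion G₂ ζ.snd q X) := by
    have hme : MeasurableEmbedding e.symm := e.symm.toHomeomorph.measurableEmbedding
    rw [hν, hme.ae_map_iff]
    have a1 := (Measure.quasiMeasurePreserving_fst (μ := μ) (ν := μ)).ae al₁
    have a2 := (Measure.quasiMeasurePreserving_snd (μ := μ) (ν := μ)).ae al₂
    filter_upwards [a1, a2] with z hz1 hz2
    exact ⟨hz1, hz2⟩
  set W : WithLp 2 (H × H) → ℝ := fun ζ => S₁ ζ.fst + S₂ ζ.snd - ‖ζ.fst - ζ.snd‖ ^ 2 / (2 * ε)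
    with hW
  have hWG : ∀ ζ, W ζ = G₁ ζ.fst + G₂ ζ.snd - (‖ζ.fst‖ ^ 2 + ‖ζ.snd‖ ^ 2 + ‖ζ.fst - ζ.snd‖ ^ 2)
      / (2 * ε) := by
    intro ζ; simp only [hW, hG₁, hG₂]; ring
  have hsc : ∀ ζ, ∃ l, ∀ z, W ζ + inner ℝ l (z - ζ) - (3 / (2 * ε)) * ‖z - ζ‖ ^ 2 ≤ W z := by
    intro ζ
    refine ⟨WithLp.toLp 2 ((1 / ε) • m₁ ζ.fst - (1 / ε) • (ζ.fst + (ζ.fst - ζ.snd)),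
      (1 / ε) • m₂ ζ.snd - (1 / ε) • (ζ.snd - (ζ.fst - ζ.snd))), fun z => ?_⟩
    have s1 := h₁.isSubgrad hε ζ.fst z.fst
    have s2 := h₂.isSubgrad hε ζ.snd z.snd
    rw [hWG, hWG, WithLp.prod_inner_apply, WithLp.prod_norm_sq_eq_of_L2]
    change _ + (inner ℝ ((1 / ε) • m₁ ζ.fst - (1 / ε) • (ζ.fst + (ζ.fst - ζ.snd)))
      (z.fst - ζ.fst) + inner ℝ ((1 / ε) • m₂ ζ.snd - (1 / ε) • (ζ.snd - (ζ.fst - ζ.snd)))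
      (z.snd - ζ.snd)) - 3 / (2 * ε) * (‖z.fst - ζ.fst‖ ^ 2 + ‖z.snd - ζ.snd‖ ^ 2) ≤ _
    change G₁ _ + _ ≤ G₁ _ at s1
    change G₂ _ + _ ≤ G₂ _ at s2
    generalize z.fst = a at *
    generalize z.snd = b at *
    generalize ζ.fst = c at *
    generalize ζ.snd = d at *
    obtain ⟨u, rfl⟩ : ∃ u, a = c + u := ⟨a - c, by abel⟩
    obtain ⟨v, rfl⟩ : ∃ v, b = d + v := ⟨b - d, by abel⟩
    rw [add_sub_cancel_left] at *
    rw [add_sub_cancel_left]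
    have e1 : c + u - (d + v) = (c - d) + (u - v) := by abel
    rw [e1, norm_add_sq_real c u, norm_add_sq_real d v, norm_add_sq_real (c - d) (u - v)]
    have e2 : ‖u - v‖ ^ 2 ≤ 2 * (‖u‖ ^ 2 + ‖v‖ ^ 2) := by
      have := norm_sub_sq_real u v
      have := norm_add_sq_real u v
      nlinarith [sq_nonneg ‖u + v‖]
    simp only [inner_sub_left, inner_smul_left, inner_add_left, inner_sub_right, conj_trivial]
      at s1 s2 ⊢
    have e3 := mul_le_mul_of_nonneg_left e2 (by positivity : 0 ≤ 1 / (2 * ε))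
    rw [← sub_nonneg] at e3 s1 s2 ⊢
    refine (add_nonneg (add_nonneg s1 s2) e3).trans (le_of_eq ?_)
    field_simp
    ring
  obtain ⟨R, hR⟩ := hK.isBounded.exists_norm_le
  have hScont : Continuous W := by
    have c1 := h₁.continuous_add_sq hK hε
    have c2 := h₂.continuous_add_sq hK hε
    have : W = fun ζ => G₁ ζ.fst + G₂ ζ.snd
        - (‖ζ.fst‖ ^ 2 + ‖ζ.snd‖ ^ 2 + ‖ζ.fst - ζ.snd‖ ^ 2) / (2 * ε) := funext hWG
    rw [this]
    have f1 : Continuous fun ζ : WithLp 2 (H × H) => ζ.fst := continuous_fst.comp e.continuous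
    have f2 : Continuous fun ζ : WithLp 2 (H × H) => ζ.snd := continuous_snd.comp e.continuous
    have := c1.comp f1
    have := c2.comp f2
    simp only [Function.comp_def] at *
    fun_prop
  obtain ⟨x₁, hx₁, hb₁⟩ := UpperSemicontinuousOn.exists_isMaxOn hne hK hg₁
  obtain ⟨x₂, hx₂, hb₂⟩ := UpperSemicontinuousOn.exists_isMaxOn hne hK hg₂
  have hSle : ∀ {g S : H → ℝ} {m : H → H} {xm : H}, IsSupConv K g ε S m → IsMaxOn g K xm →
      ∀ ξ, S ξ ≤ g xm - (‖ξ‖ ^ 2 / 2 - R ^ 2) / (2 * ε) := by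
    intro g S m xm h hxm ξ
    rw [h.eq]
    have a : g (m ξ) ≤ g xm := hxm (h.mem ξ)
    have b : ‖ξ‖ ^ 2 / 2 - R ^ 2 ≤ ‖m ξ - ξ‖ ^ 2 := by
      have c := hR _ (h.mem ξ)
      have d : ‖ξ‖ ≤ ‖m ξ - ξ‖ + ‖m ξ‖ := by
        have := norm_sub_le (m ξ) (m ξ - ξ)
        rw [sub_sub_cancel] at this
        linarith
      nlinarith [norm_nonneg ξ, norm_nonneg (m ξ - ξ), norm_nonneg (m ξ),
        sq_nonneg (‖m ξ - ξ‖ - ‖m ξ‖)]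
    have := div_le_div_of_nonneg_right b (by positivity : 0 ≤ 2 * ε)
    linarith
  have hmax : ∀ p, ∃ ζ, ∀ z, W z ≤ W ζ + inner ℝ p (z - ζ) := by
    intro p
    have hc : Continuous fun z => inner ℝ p z - W z :=
      (continuous_const.inner continuous_id).sub hScont
    have hco : Tendsto (fun z => inner ℝ p z - W z) (cocompact _) atTop := by
      have l1 : Tendsto (fun z : WithLp 2 (H × H) => ‖z‖ + (-(g₁ x₁ + g₂ x₂) - R ^ 2 / ε
          - ε * (‖p‖ + 1) ^ 2)) (cocompact _) atTop :=
        tendsto_atTop_add_const_right _ _ (tendsto_norm_cocompact_atTop)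
      refine tendsto_atTop_mono (fun z => ?_) l1
      have a1 := hSle h₁ hb₁ z.fst
      have a2 := hSle h₂ hb₂ z.snd
      have a3 : 0 ≤ ‖z.fst - z.snd‖ ^ 2 / (2 * ε) := by positivity
      have a4 : -(‖p‖ * ‖z‖) ≤ inner ℝ p z := neg_le_of_abs_le (abs_real_inner_le_norm p z)
      have a5 := WithLp.prod_norm_sq_eq_of_L2 z
      have a6 : (‖p‖ + 1) * ‖z‖ ≤ ‖z‖ ^ 2 / (4 * ε) + ε * (‖p‖ + 1) ^ 2 := by
        have : 0 ≤ (‖z‖ - 2 * ε * (‖p‖ + 1)) ^ 2 / (4 * ε) := by positivity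
        rw [← sub_nonneg]
        refine this.trans (le_of_eq ?_)
        field_simp
        ring
      have a7 : (‖z.fst‖ ^ 2 / 2 - R ^ 2) / (2 * ε) + (‖z.snd‖ ^ 2 / 2 - R ^ 2) / (2 * ε)
          = ‖z‖ ^ 2 / (4 * ε) - R ^ 2 / ε := by
        rw [a5]; field_simp; ring
      simp only [hW]
      linarith
    obtain ⟨ζ, hζ⟩ := hc.exists_forall_le hco
    refine ⟨ζ, fun z => ?_⟩
    have := hζ z
    rw [inner_sub_right]
    linarith
  obtain ⟨p, ζ, hpr, hζg, hζm⟩ := jensen_perturbation ν (by positivity) hsc hmax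
    (ae_iff.1 hgood) hr
  simp only [mem_ofPred_eq, not_not] at hζg
  obtain ⟨⟨q₁, X₁, hq₁, hX₁⟩, ⟨q₂, X₂, hq₂, hX₂⟩⟩ := hζg
  have hp1 : ‖p.fst‖ ≤ r := (WithLp.norm_fst_le _ p).trans hpr
  have hp2 : ‖p.snd‖ ≤ r := (WithLp.norm_snd_le _ p).trans hpr
  set ξ := ζ.fst with hξ
  set η := ζ.snd with hη
  have hmaxW : ∀ u v, S₁ (ξ + u) + S₂ (η + v) ≤ S₁ ξ + S₂ η
      + inner ℝ ((1 / ε) • (ξ - η) + p.fst) u + inner ℝ (-(1 / ε) • (ξ - η) + p.snd) v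
      + ‖u - v‖ ^ 2 / (2 * ε) := by
    intro u v
    have := hζm (WithLp.toLp 2 (ξ + u, η + v))
    rw [WithLp.prod_inner_apply] at this
    change S₁ (ξ + u) + S₂ (η + v) - ‖(ξ + u) - (η + v)‖ ^ 2 / (2 * ε) ≤
      S₁ ξ + S₂ η - ‖ξ - η‖ ^ 2 / (2 * ε) + (inner ℝ p.fst (ξ + u - ξ)
        + inner ℝ p.snd (η + v - η)) at this
    have e1 : ξ + u - (η + v) = (ξ - η) + (u - v) := by abel
    rw [e1, norm_add_sq_real, add_sub_cancel_left, add_sub_cancel_left] at this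
    rw [← sub_nonneg] at this ⊢
    refine this.trans (le_of_eq ?_)
    simp only [inner_add_left, inner_smul_left, inner_sub_right, conj_trivial]
    field_simp
    ring
  have hgrad₁ : ∀ s, IsSubgrad G₁ ξ s → s - (1 / ε) • ξ = (1 / ε) • (ξ - η) + p.fst := by
    intro s hs
    rw [← sub_eq_zero]
    refine eq_zero_of_forall_inner_le_sq (Λ := 1 / ε) (by positivity) fun u => ?_
    have a := hs (ξ + u)
    have b := hmaxW u 0
    simp only [hG₁, add_zero, sub_zero, inner_zero_right, add_sub_cancel_left,
      norm_add_sq_real] at a b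
    rw [← sub_nonneg] at a b ⊢
    refine (add_nonneg a b).trans (le_of_eq ?_)
    simp only [inner_add_left, inner_sub_left, inner_smul_left, conj_trivial]
    field_simp
    ring
  have hgrad₂ : ∀ s, IsSubgrad G₂ η s → s - (1 / ε) • η = -(1 / ε) • (ξ - η) + p.snd := by
    intro s hs
    rw [← sub_eq_zero]
    refine eq_zero_of_forall_inner_le_sq (Λ := 1 / ε) (by positivity) fun u => ?_
    have a := hs (η + u)
    have b := hmaxW 0 u
    simp only [hG₂, add_zero, zero_sub, inner_zero_right, add_sub_cancel_left,
      norm_add_sq_real, norm_neg] at a b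
    rw [← sub_nonneg] at a b ⊢
    refine (add_nonneg a b).trans (le_of_eq ?_)
    simp only [inner_add_left, inner_sub_left, inner_smul_left, conj_trivial]
    field_simp
    ring
  have ex₁ := hX₁.sub_sq hG₁ hε
  have ex₂ := hX₂.sub_sq hG₂ hε
  rw [hgrad₁ _ hq₁] at ex₁
  rw [hgrad₂ _ hq₂] at ex₂
  refine ⟨p.fst, p.snd, m₁ ξ, m₂ η, ξ, η, _, _, h₁.mem _, h₂.mem _, hp1, hp2, ?_,
    jet_of_expansion h₁ ex₁, jet_of_expansion h₂ ex₂, ?_⟩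
  · intro x' hx' y' hy' ξ' η'
    have a := h₁.le ξ' x' hx'
    have b := h₂.le η' y' hy'
    have c := hζm (WithLp.toLp 2 (ξ', η'))
    rw [WithLp.prod_inner_apply] at c
    change S₁ ξ' + S₂ η' - ‖ξ' - η'‖ ^ 2 / (2 * ε) ≤
      S₁ ξ + S₂ η - ‖ξ - η‖ ^ 2 / (2 * ε) + (inner ℝ p.fst (ξ' - ξ)
        + inner ℝ p.snd (η' - η)) at c
    rw [h₁.eq ξ, h₂.eq η, inner_sub_right, inner_sub_right] at c
    unfold quadPenal
    rw [add_div, add_div, add_div, add_div]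
    linarith
  · intro h k
    have key : ∀ δ > (0 : ℝ), 1 / 2 * inner ℝ ((X₁ - (1 / ε) • ContinuousLinearMap.id ℝ H) h) h
        + 1 / 2 * inner ℝ ((X₂ - (1 / ε) • ContinuousLinearMap.id ℝ H) k) k
        ≤ ‖h - k‖ ^ 2 / (2 * ε) + δ * (‖h‖ ^ 2 + ‖k‖ ^ 2) := by
      intro δ hδ
      have t1 : Tendsto (fun t : ℝ => t • h) (𝓝[>] 0) (𝓝 0) := by
        have : Tendsto (fun t : ℝ => t • h) (𝓝 0) (𝓝 ((0 : ℝ) • h)) :=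
          (continuous_id.smul continuous_const).tendsto _
        rw [zero_smul] at this
        exact this.mono_left nhdsWithin_le_nhds
      have t2 : Tendsto (fun t : ℝ => t • k) (𝓝[>] 0) (𝓝 0) := by
        have : Tendsto (fun t : ℝ => t • k) (𝓝 0) (𝓝 ((0 : ℝ) • k)) :=
          (continuous_id.smul continuous_const).tendsto _
        rw [zero_smul] at this
        exact this.mono_left nhdsWithin_le_nhds
      obtain ⟨t, ⟨ht1, ht2⟩, ht⟩ := ((t1.eventually (ex₁ δ hδ)).and
        (t2.eventually (ex₂ δ hδ)) |>.and self_mem_nhdsWithin).exists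
      have ht0 : (0 : ℝ) < t := ht
      have a := (abs_le.1 ht1).1
      have b := (abs_le.1 ht2).1
      have c := hmaxW (t • h) (t • k)
      rw [← smul_sub, norm_smul, mul_pow, Real.norm_eq_abs, sq_abs] at c
      simp only [map_smul, inner_smul_left, inner_smul_right, conj_trivial, norm_smul, mul_pow,
        Real.norm_eq_abs, sq_abs] at a b c
      have ht2 : 0 < t ^ 2 := by positivity
      refine le_of_mul_le_mul_left ?_ ht2
      have e1 : t ^ 2 * (‖h - k‖ ^ 2 / (2 * ε) + δ * (‖h‖ ^ 2 + ‖k‖ ^ 2))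
        = t ^ 2 * ‖h - k‖ ^ 2 / (2 * ε) + δ * (t ^ 2 * ‖h‖ ^ 2) + δ * (t ^ 2 * ‖k‖ ^ 2) := by
        ring
      rw [e1]
      linarith
    have hl : Tendsto (fun δ : ℝ => ‖h - k‖ ^ 2 / (2 * ε) + δ * (‖h‖ ^ 2 + ‖k‖ ^ 2)) (𝓝[>] 0)
        (𝓝 (‖h - k‖ ^ 2 / (2 * ε))) := by
      have : Tendsto (fun δ : ℝ => ‖h - k‖ ^ 2 / (2 * ε) + δ * (‖h‖ ^ 2 + ‖k‖ ^ 2)) (𝓝 0)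
          (𝓝 (‖h - k‖ ^ 2 / (2 * ε) + 0 * (‖h‖ ^ 2 + ‖k‖ ^ 2))) := by
        apply Continuous.tendsto
        fun_prop
      rw [zero_mul, add_zero] at this
      exact this.mono_left nhdsWithin_le_nhds
    have := ge_of_tendsto hl (eventually_mem_nhdsWithin.mono fun δ hδ => key δ hδ)
    have e2 : ‖h - k‖ ^ 2 / ε = 2 * (‖h - k‖ ^ 2 / (2 * ε)) := by field_simp
    rw [e2]
    linarith

end TheoremOnSums

section Jets

variable {E : Type*} [NormedAddCommGroup E] [NormedSpace ℝ E]

/-- `(q, X)` belongs to the second-order superjet of `u` at `p` relative to `S`. -/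
def SupJet (S : Set E) (u : E → ℝ) (p : E) (q : E →L[ℝ] ℝ) (X : E →L[ℝ] E →L[ℝ] ℝ) : Prop :=
  ∀ ν > (0 : ℝ), ∀ᶠ z in 𝓝[S] p,
    u z ≤ u p + q (z - p) + 1 / 2 * X (z - p) (z - p) + ν * ‖z - p‖ ^ 2

/-- `Φ` has the second-order Taylor expansion at `p` with coefficients `q` and `X`. -/
def HasJet (Φ : E → ℝ) (p : E) (q : E →L[ℝ] ℝ) (X : E →L[ℝ] E →L[ℝ] ℝ) : Prop :=
  (fun h => Φ (p + h) - Φ p - q h - 1 / 2 * X h h) =o[𝓝 0] (fun h : E => ‖h‖ ^ 2)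

/-- The rank-one bilinear form `(h, k) ↦ q h * q' k`. -/
def dualProd (q q' : E →L[ℝ] ℝ) : E →L[ℝ] E →L[ℝ] ℝ := q.smulRight q'

@[simp] theorem dualProd_apply (q q' : E →L[ℝ] ℝ) (h k : E) : dualProd q q' h k = q h * q' k := by
  simp [dualProd]

variable {S : Set E} {u Φ Ψ : E → ℝ} {p : E} {q q' : E →L[ℝ] ℝ} {X X' : E →L[ℝ] E →L[ℝ] ℝ}

theorem HasJet.eventually (h : HasJet Φ p q X) {ν : ℝ} (hν : 0 < ν) :
    ∀ᶠ z in 𝓝 p, |Φ z - Φ p - q (z - p) - 1 / 2 * X (z - p) (z - p)| ≤ ν * ‖z - p‖ ^ 2 := by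
  have h1 := h.def hν
  have h2 : Tendsto (fun z => z - p) (𝓝 p) (𝓝 0) := by
    have : Tendsto (fun z => z - p) (𝓝 p) (𝓝 (p - p)) := (continuous_sub_right p).tendsto p
    rwa [sub_self] at this
  filter_upwards [h2.eventually h1] with z hz
  simpa using hz

theorem SupJet.add_hasJet (h : SupJet S u p q X) (hΦ : HasJet Φ p q' X') :
    SupJet S (fun z => u z + Φ z) p (q + q') (X + X') := by
  intro ν hν
  filter_upwards [h (ν / 2) (half_pos hν), (hΦ.eventually (half_pos hν)).filter_mono
    nhdsWithin_le_nhds] with z h1 h2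
  have := (abs_le.1 h2).2
  simp only [_root_.add_apply]
  linarith

theorem SupJet.mono_fun (h : SupJet S u p q X) {w : E → ℝ} (hw : ∀ᶠ z in 𝓝[S] p, w z ≤ u z)
    (hp : w p = u p) : SupJet S w p q X := by
  intro ν hν
  filter_upwards [h ν hν, hw] with z h1 h2
  rw [hp]; exact h2.trans h1

theorem SupJet.mono_nhds (h : SupJet S u p q X) {S' : Set E} (hS : 𝓝[S'] p ≤ 𝓝[S] p) :
    SupJet S' u p q X := fun ν hν => hS (h ν hν)

theorem SupJet.of_isLocalMaxOn (h : IsLocalMaxOn u S p) : SupJet S u p 0 0 := by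
  intro ν hν
  filter_upwards [h] with z hz
  have : 0 ≤ ν * ‖z - p‖ ^ 2 := by positivity
  simp only [_root_.zero_apply]
  linarith

theorem HasJet.add (h : HasJet Φ p q X) (h' : HasJet Ψ p q' X') :
    HasJet (fun z => Φ z + Ψ z) p (q + q') (X + X') := by
  refine (Asymptotics.IsLittleO.add h h').congr_left fun k => ?_
  simp only [_root_.add_apply]
  ring

theorem HasJet.const_mul (h : HasJet Φ p q X) (c : ℝ) :
    HasJet (fun z => c * Φ z) p (c • q) (c • X) := by
  refine (Asymptotics.IsLittleO.const_mul_left h c).congr_left fun k => ?_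
  simp only [_root_.smul_apply, smul_eq_mul]
  ring

theorem HasJet.neg (h : HasJet Φ p q X) : HasJet (fun z => -Φ z) p (-q) (-X) := by
  refine (Asymptotics.IsLittleO.neg_left h).congr_left fun k => ?_
  simp only [_root_.neg_apply]
  ring

theorem hasJet_const (c : ℝ) : HasJet (fun _ : E => c) p 0 0 := by
  have : (fun h : E => (fun _ : E => c) (p + h) - (fun _ : E => c) p - (0 : E →L[ℝ] ℝ) h
      - 1 / 2 * (0 : E →L[ℝ] E →L[ℝ] ℝ) h h) = fun _ => 0 := by
    funext h; simp
  unfold HasJet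
  rw [this]
  exact Asymptotics.isLittleO_zero _ _

theorem SupJet.of_isLocalMaxOn_sub {S : Set E} (hΦ : HasJet Φ p q X)
    (h : IsLocalMaxOn (fun z => u z - Φ z) S p) : SupJet S u p q X := by
  have := (SupJet.of_isLocalMaxOn h).add_hasJet hΦ
  have e : (0 : E →L[ℝ] E →L[ℝ] ℝ) + X = X := by ext h k; simp
  rw [zero_add, e] at this
  simpa using this

theorem isLittleO_cube : (fun h : E => ‖h‖ ^ 3) =o[𝓝 0] (fun h : E => ‖h‖ ^ 2) := by
  have h0 : (fun h : E => ‖h‖) =o[𝓝 0] (fun _ : E => (1 : ℝ)) := by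
    rw [Asymptotics.isLittleO_one_iff]
    exact tendsto_norm_zero
  have := h0.mul_isBigO (Asymptotics.isBigO_refl (fun h : E => ‖h‖ ^ 2) (𝓝 0))
  refine this.congr (fun h => by ring) (fun h => by ring)

theorem isBigO_dual (q : E →L[ℝ] ℝ) (l : Filter E) : (fun h => q h) =O[l] (fun h : E => ‖h‖) :=
  (q.isBigO_id l).norm_right

theorem isBigO_form (X : E →L[ℝ] E →L[ℝ] ℝ) (l : Filter E) :
    (fun h => X h h) =O[l] (fun h : E => ‖h‖ ^ 2) := by
  refine Asymptotics.IsBigO.of_bound ‖X‖ (Eventually.of_forall fun h => ?_)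
  have := X.le_opNorm₂ h h
  rw [norm_pow, norm_norm]
  linarith

theorem HasJet.sub_isBigO (h : HasJet Φ p q X) :
    (fun k => Φ (p + k) - Φ p - q k) =O[𝓝 0] (fun k : E => ‖k‖ ^ 2) := by
  have := h.isBigO.add ((isBigO_form X (𝓝 0)).const_mul_left (1 / 2))
  exact this.congr_left fun k => by ring

theorem isBigO_sq_norm : (fun h : E => ‖h‖ ^ 2) =O[𝓝 0] (fun h : E => ‖h‖) := by
  have h0 : (fun h : E => ‖h‖) =O[𝓝 0] (fun _ : E => (1 : ℝ)) :=
    Asymptotics.IsLittleO.isBigO (by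
      rw [Asymptotics.isLittleO_one_iff]
      exact tendsto_norm_zero)
  have := h0.mul (Asymptotics.isBigO_refl (fun h : E => ‖h‖) (𝓝 0))
  refine this.congr (fun h => by ring) (fun h => by ring)

theorem HasJet.sub_isBigO_norm (h : HasJet Φ p q X) :
    (fun k => Φ (p + k) - Φ p) =O[𝓝 0] (fun k : E => ‖k‖) := by
  have := (h.sub_isBigO.trans isBigO_sq_norm).add (isBigO_dual q (𝓝 0))
  exact this.congr_left fun k => by ring

theorem HasJet.tendsto (h : HasJet Φ p q X) :
    Tendsto (fun k => Φ (p + k) - Φ p) (𝓝 0) (𝓝 0) :=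
  h.sub_isBigO_norm.trans_tendsto tendsto_norm_zero

theorem HasJet.continuousAt (h : HasJet Φ p q X) : ContinuousAt Φ p := by
  have h2 : Tendsto (fun z => z - p) (𝓝 p) (𝓝 0) := by
    have : Tendsto (fun z => z - p) (𝓝 p) (𝓝 (p - p)) := (continuous_sub_right p).tendsto p
    rwa [sub_self] at this
  have := (h.tendsto.comp h2).add_const (Φ p)
  simpa [Function.comp_def, ContinuousAt] using this

theorem HasJet.comp {θ : ℝ → ℝ} {b c : ℝ} (h : HasJet Φ p q X)
    (hθ : (fun s : ℝ => θ (Φ p + s) - θ (Φ p) - b * s - 1 / 2 * c * s ^ 2) =o[𝓝 0]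
      (fun s : ℝ => s ^ 2)) :
    HasJet (fun z => θ (Φ z)) p (b • q) (b • X + c • dualProd q q) := by
  have h1 := hθ.comp_tendsto h.tendsto
  have h2 : (fun k => (Φ (p + k) - Φ p) ^ 2) =O[𝓝 0] (fun k : E => ‖k‖ ^ 2) :=
    h.sub_isBigO_norm.pow 2
  have h3 : (fun k => (Φ (p + k) - Φ p - q k) * (Φ (p + k) - Φ p + q k)) =o[𝓝 0]
      (fun k : E => ‖k‖ ^ 2) := by
    have a := h.sub_isBigO.mul (h.sub_isBigO_norm.add (isBigO_dual q (𝓝 0)))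
    refine a.trans_isLittleO ?_
    exact isLittleO_cube.congr_left fun k => by ring
  have h4 : (fun k => b * (Φ (p + k) - Φ p - q k - 1 / 2 * X k k)) =o[𝓝 0]
      (fun k : E => ‖k‖ ^ 2) := Asymptotics.IsLittleO.const_mul_left h b
  refine (((h1.trans_isBigO h2).add h4).add (h3.const_mul_left (1 / 2 * c))).congr_left
    fun k => ?_
  simp only [Function.comp, _root_.add_apply, _root_.smul_apply,
    smul_eq_mul, dualProd_apply, add_sub_cancel]
  ring

theorem HasJet.mul (h : HasJet Φ p q X) (h' : HasJet Ψ p q' X') :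
    HasJet (fun z => Φ z * Ψ z) p (Φ p • q' + Ψ p • q)
      (Φ p • X' + Ψ p • X + (dualProd q q' + dualProd q' q)) := by
  have one : (fun k => Φ (p + k)) =O[𝓝 0] (fun _ : E => (1 : ℝ)) := by
    have : Tendsto (fun k => Φ (p + k)) (𝓝 0) (𝓝 (Φ p)) := by
      have := h.tendsto.add_const (Φ p)
      simpa using this
    exact this.isBigO_one ℝ
  have a1 := one.mul_isLittleO h'
  have a2 := Asymptotics.IsLittleO.const_mul_left h (Ψ p)
  have a3 : (fun k => (Φ (p + k) - Φ p - q k) * q' k) =o[𝓝 0] (fun k : E => ‖k‖ ^ 2) :=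
    (h.sub_isBigO.mul (isBigO_dual q' (𝓝 0))).trans_isLittleO
      (isLittleO_cube.congr_left fun k => by ring)
  have a4 : (fun k => (Φ (p + k) - Φ p) * (1 / 2 * X' k k)) =o[𝓝 0] (fun k : E => ‖k‖ ^ 2) :=
    (h.sub_isBigO_norm.mul ((isBigO_form X' (𝓝 0)).const_mul_left (1 / 2))).trans_isLittleO
      (isLittleO_cube.congr_left fun k => by ring)
  have a1' : (fun k => Φ (p + k) * (Ψ (p + k) - Ψ p - q' k - 1 / 2 * X' k k)) =o[𝓝 0]
      (fun k : E => ‖k‖ ^ 2) := by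
    simpa using a1
  refine (((a1'.add a2).add a3).add a4).congr_left fun k => ?_
  simp only [_root_.add_apply, _root_.smul_apply,
    smul_eq_mul, dualProd_apply]
  ring

/-- The quadratic polynomial `z ↦ c + q (z - p) + ½ X (z - p) (z - p)`. -/
def quadPoly (c : ℝ) (p : E) (q : E →L[ℝ] ℝ) (X : E →L[ℝ] E →L[ℝ] ℝ) (z : E) : ℝ :=
  c + q (z - p) + 1 / 2 * X (z - p) (z - p)

@[simp] theorem quadPoly_self (c : ℝ) : quadPoly c p q X p = c := by simp [quadPoly]

theorem hasJet_quadPoly (c : ℝ) (hX : ∀ h k, X h k = X k h) (z : E) :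
    HasJet (quadPoly c p q X) z (q + X (z - p)) X := by
  have : (fun h : E => quadPoly c p q X (z + h) - quadPoly c p q X z - (q + X (z - p)) h
      - 1 / 2 * X h h) = fun _ => 0 := by
    funext h
    unfold quadPoly
    have e : z + h - p = (z - p) + h := by abel
    rw [e]
    simp only [map_add, _root_.add_apply]
    rw [hX h (z - p)]
    ring
  unfold HasJet
  rw [this]
  exact Asymptotics.isLittleO_zero _ _

theorem continuous_quadPoly (c : ℝ) : Continuous (quadPoly c p q X) := by
  unfold quadPoly
  fun_prop

/-- Symmetrization of a bilinear form. -/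
def symmForm (X : E →L[ℝ] E →L[ℝ] ℝ) : E →L[ℝ] E →L[ℝ] ℝ := (1 / 2 : ℝ) • (X + X.flip)

theorem symmForm_comm (h k : E) : symmForm X h k = symmForm X k h := by
  simp [symmForm]; ring

@[simp] theorem symmForm_self (h : E) : symmForm X h h = X h h := by
  simp [symmForm]; ring

theorem hasJet_of_hasFDerivAt {Φ' : E → E →L[ℝ] ℝ} (h : ∀ᶠ z in 𝓝 p, HasFDerivAt Φ (Φ' z) z)
    (h2 : HasFDerivAt Φ' X p) : HasJet Φ p (Φ' p) X := by
  rw [HasJet, Asymptotics.isLittleO_iff]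
  intro c hc
  have h3 := (hasFDerivAt_iff_isLittleO_nhds_zero.1 h2).def hc
  have h4 : ∀ᶠ k in 𝓝 (0 : E), HasFDerivAt Φ (Φ' (p + k)) (p + k) := by
    have : Tendsto (fun k => p + k) (𝓝 0) (𝓝 p) := by
      have : Tendsto (fun k => p + k) (𝓝 0) (𝓝 (p + 0)) := (continuous_const_add p).tendsto 0
      rwa [add_zero] at this
    exact this.eventually h
  obtain ⟨r, hr, hball⟩ := Metric.eventually_nhds_iff_ball.1 (h3.and h4)
  filter_upwards [Metric.ball_mem_nhds (0 : E) hr] with k hk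
  have hseg : ∀ s ∈ Icc (0 : ℝ) 1, s • k ∈ Metric.ball (0 : E) r := by
    intro s hs
    rw [mem_ball_zero_iff] at hk ⊢
    rw [norm_smul, Real.norm_eq_abs, abs_of_nonneg hs.1]
    nlinarith [norm_nonneg k, hs.2]
  have hd : ∀ s ∈ Icc (0 : ℝ) 1, HasDerivWithinAt
      (fun s : ℝ => Φ (p + s • k) - s * Φ' p k - 1 / 2 * s ^ 2 * X k k)
      (Φ' (p + s • k) k - Φ' p k - s * X k k) (Icc 0 1) s := by
    intro s hs
    have a := (hball _ (hseg s hs)).2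
    have b : HasDerivAt (fun s : ℝ => p + s • k) k s := by
      simpa using ((hasDerivAt_id s).smul_const k).const_add p
    have c := a.comp_hasDerivAt s b
    have d : HasDerivAt (fun s : ℝ => s * Φ' p k) (Φ' p k) s := by
      simpa using (hasDerivAt_id s).mul_const (Φ' p k)
    have e : HasDerivAt (fun s : ℝ => 1 / 2 * s ^ 2 * X k k) (s * X k k) s := by
      have := (((hasDerivAt_id s).pow 2).const_mul (1 / 2 : ℝ)).mul_const (X k k)
      refine this.congr_deriv ?_
      simp
    exact ((c.sub d).sub e).hasDerivWithinAt
  have hb : ∀ s ∈ Icc (0 : ℝ) 1, ‖Φ' (p + s • k) k - Φ' p k - s * X k k‖ ≤ c * ‖k‖ ^ 2 := by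
    intro s hs
    have a := (hball _ (hseg s hs)).1
    have b : Φ' (p + s • k) k - Φ' p k - s * X k k = (Φ' (p + s • k) - Φ' p - X (s • k)) k := by
      simp
    rw [b]
    refine (ContinuousLinearMap.le_opNorm _ _).trans ?_
    have e : ‖s • k‖ ≤ ‖k‖ := by
      rw [norm_smul, Real.norm_eq_abs, abs_of_nonneg hs.1]
      nlinarith [norm_nonneg k, hs.2]
    calc _ ≤ (c * ‖s • k‖) * ‖k‖ := by gcongr
      _ ≤ (c * ‖k‖) * ‖k‖ := by gcongr
      _ = _ := by ring
  have := (convex_Icc (0 : ℝ) 1).norm_image_sub_le_of_norm_hasDerivWithin_le hd hb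
    (left_mem_Icc.2 zero_le_one) (right_mem_Icc.2 zero_le_one)
  simp only [one_smul, zero_smul, add_zero, one_mul, zero_mul, sub_zero, norm_one, mul_one] at this
  rw [norm_pow, norm_norm]
  refine le_trans (le_of_eq ?_) this
  congr 1
  ring

theorem SupJet.comp_equiv {F : Type*} [NormedAddCommGroup F] [NormedSpace ℝ F] (e : F ≃L[ℝ] E)
    {K : Set E} {x : F} {q : F →L[ℝ] ℝ} {X : F →L[ℝ] F →L[ℝ] ℝ}
    (h : SupJet (e ⁻¹' K) (fun z => u (e z)) x q X) :
    SupJet K u (e x) (q.comp (e.symm : E →L[ℝ] F))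
      (X.bilinearComp (e.symm : E →L[ℝ] F) (e.symm : E →L[ℝ] F)) := by
  intro ν hν
  set L := ‖(e.symm : E →L[ℝ] F)‖ with hL
  have h1 := h (ν / (L ^ 2 + 1)) (by positivity)
  have ht : Tendsto e.symm (𝓝[K] (e x)) (𝓝[e ⁻¹' K] x) := by
    refine tendsto_nhdsWithin_iff.2 ⟨?_, ?_⟩
    · have : Tendsto e.symm (𝓝 (e x)) (𝓝 (e.symm (e x))) := e.symm.continuous.tendsto _
      rw [e.symm_apply_apply] at this
      exact this.mono_left nhdsWithin_le_nhds
    · filter_upwards [self_mem_nhdsWithin] with z hz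
      simpa using hz
  filter_upwards [ht.eventually h1] with z hz
  have e1 : e.symm z - x = e.symm (z - e x) := by simp
  rw [e1] at hz
  simp only [ContinuousLinearEquiv.apply_symm_apply] at hz
  refine hz.trans ?_
  have e2 : ‖e.symm (z - e x)‖ ≤ L * ‖z - e x‖ := (e.symm : E →L[ℝ] F).le_opNorm _
  have e3 : ‖e.symm (z - e x)‖ ^ 2 ≤ L ^ 2 * ‖z - e x‖ ^ 2 := by
    rw [← mul_pow]; gcongr
  have e4 : ν / (L ^ 2 + 1) * ‖e.symm (z - e x)‖ ^ 2 ≤ ν * ‖z - e x‖ ^ 2 := by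
    calc _ ≤ ν / (L ^ 2 + 1) * ((L ^ 2 + 1) * ‖z - e x‖ ^ 2) := by
          gcongr; nlinarith [sq_nonneg ‖z - e x‖]
      _ = _ := by field_simp
  simpa using e4

end Jets

theorem EuclideanSpace.eq_sum_single {n : ℕ} (w : En n) :
    w = ∑ i, w i • (EuclideanSpace.single i (1 : ℝ) : En n) := by
  ext j
  simp [Pi.single_apply]

/-- The data and standing assumptions of the quasi-variational inequality. -/
structure QVI (n d : ℕ) (U : Type) [MetricSpace U] [CompactSpace U] [Nonempty U] where
  T : ℝ
  Γ : ℝ → En n → U → En n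
  ℓ : ℝ → En n → U → ℝ
  a : ℝ → En n → En n
  σm : ℝ → En n → Matrix (Fin n) (Fin d) ℝ
  f : ℝ → En n → ℝ → Ed d → ℝ
  ψ : En n → ℝ
  (KΓ δ Cf kf Cψ Caσ kaσ ρ : ℝ)
  hT : 0 < T
  hKΓ : 0 < KΓ
  hδ : 0 < δ
  hρ : 0 < ρ
  hCf : 0 < Cf
  hkf : 0 < kf
  hCψ : 0 < Cψ
  hCaσ : 0 < Caσ
  hkaσ : 0 < kaσ
  hΓc : ContinuousOn (fun p : ℝ × En n × U => Γ p.1 p.2.1 p.2.2)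
    (Icc 0 T ×ˢ (univ : Set (En n × U)))
  hΓb : ∀ t ∈ Icc (0:ℝ) T, ∀ (x : En n) (b : U), ‖Γ t x b‖ ≤ max KΓ ‖x‖
  hℓc : ContinuousOn (fun p : ℝ × En n × U => ℓ p.1 p.2.1 p.2.2)
    (Icc 0 T ×ˢ (univ : Set (En n × U)))
  hℓlb : ∀ t ∈ Icc (0:ℝ) T, ∀ (x : En n) (b : U), δ ≤ ℓ t x b
  hψc : Continuous ψ
  hψg : ∀ x : En n, |ψ x| ≤ Cψ * (1 + ‖x‖ ^ ρ)
  hψΓ : ∀ (x : En n) (b : U), ψ (Γ T x b) - ℓ T x b < ψ x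
  hac : ContinuousOn (fun p : ℝ × En n => a p.1 p.2) (Strip n T)
  hσc : ContinuousOn (fun p : ℝ × En n => σm p.1 p.2) (Strip n T)
  haσg : ∀ t ∈ Icc (0:ℝ) T, ∀ x : En n, ‖a t x‖ + frob (σm t x) ≤ Caσ * (1 + ‖x‖)
  haσLip : ∀ t ∈ Icc (0:ℝ) T, ∀ x x' : En n,
    ‖a t x - a t x'‖ + frob (σm t x - σm t x') ≤ kaσ * ‖x - x'‖
  hfc : ∀ ε > (0:ℝ), ∀ p ∈ Strip n T, ∃ δ' > (0:ℝ),
    ∀ q ∈ Strip n T, dist q p ≤ δ' → ∀ (y : ℝ) (z : Ed d),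
      |f q.1 q.2 y z - f p.1 p.2 y z| ≤ ε
  hfLip : ∀ t ∈ Icc (0:ℝ) T, ∀ (x : En n) (y y' : ℝ) (z z' : Ed d),
    |f t x y' z' - f t x y z| ≤ kf * (|y' - y| + ‖z' - z‖)
  hfg : ∀ t ∈ Icc (0:ℝ) T, ∀ x : En n, |f t x 0 0| ≤ Cf * (1 + ‖x‖ ^ ρ)

namespace QVI

variable {n d : ℕ} {U : Type} [MetricSpace U] [CompactSpace U] [Nonempty U] (Q : QVI n d U)

/-- The closed time-space domain. -/
abbrev dom : Set (ℝ × En n) := Strip n Q.T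

/-- The `k`-th column of the diffusion matrix. -/
def col (p : ℝ × En n) (k : Fin d) : En n := WithLp.toLp 2 (fun i => Q.σm p.1 p.2 i k)

/-- The vector `σᵀ q` for a linear form `q`. -/
def sg (p : ℝ × En n) (q : ℝ × En n →L[ℝ] ℝ) : Ed d := WithLp.toLp 2 (fun k => q (0, Q.col p k))

/-- The linear part `-q_t - ⟨a, q_x⟩ - ½ tr (σσᵀ X)` of the operator. -/
def lin (p : ℝ × En n) (q : ℝ × En n →L[ℝ] ℝ) (X : ℝ × En n →L[ℝ] ℝ × En n →L[ℝ] ℝ) : ℝ :=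
  -q (1, 0) - q (0, Q.a p.1 p.2) - 1 / 2 * ∑ k, X (0, Q.col p k) (0, Q.col p k)

/-- The full parabolic operator. -/
def op (p : ℝ × En n) (y : ℝ) (q : ℝ × En n →L[ℝ] ℝ)
    (X : ℝ × En n →L[ℝ] ℝ × En n →L[ℝ] ℝ) : ℝ :=
  Q.lin p q X - Q.f p.1 p.2 y (Q.sg p q)

/-- The intervention operator on functions of `(t, x)`. -/
def M (u : ℝ × En n → ℝ) (p : ℝ × En n) : ℝ :=
  ⨆ b : U, (u (p.1, Q.Γ p.1 p.2 b) - Q.ℓ p.1 p.2 b)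

/-- Subsolutions in terms of superjets. -/
def JSub (u : ℝ × En n → ℝ) : Prop :=
  UpperSemicontinuousOn u Q.dom ∧ (∀ x, u (Q.T, x) ≤ Q.ψ x) ∧
  ∀ p ∈ Q.dom, p.1 < Q.T → ∀ q X, SupJet Q.dom u p q X → u p ≤ Q.M u p ∨ Q.op p (u p) q X ≤ 0

/-- Supersolutions in terms of subjets. -/
def JSuper (v : ℝ × En n → ℝ) : Prop :=
  LowerSemicontinuousOn v Q.dom ∧ (∀ x, Q.ψ x ≤ v (Q.T, x)) ∧
  ∀ p ∈ Q.dom, p.1 < Q.T → ∀ q X, SupJet Q.dom (fun z => -v z) p (-q) (-X) →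
    Q.M v p ≤ v p ∧ 0 ≤ Q.op p (v p) q X

variable {Q}

theorem mem_dom {p : ℝ × En n} : p ∈ Q.dom ↔ p.1 ∈ Icc 0 Q.T := by simp [Strip]

theorem op_symmForm (p : ℝ × En n) (y : ℝ) (q : ℝ × En n →L[ℝ] ℝ)
    (X : ℝ × En n →L[ℝ] ℝ × En n →L[ℝ] ℝ) : Q.op p y q (symmForm X) = Q.op p y q X := by
  simp [op, lin]

end QVI

section Parabolic

variable {n : ℕ}

/-- The bilinear form with `½ parForm h h = h₁² + ‖h₂‖²`. -/
def parForm (n : ℕ) : ℝ × En n →L[ℝ] ℝ × En n →L[ℝ] ℝ :=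
  (2 : ℝ) • (dualProd (ContinuousLinearMap.fst ℝ ℝ (En n)) (ContinuousLinearMap.fst ℝ ℝ (En n))
    + ∑ i, dualProd ((EuclideanSpace.proj i).comp (ContinuousLinearMap.snd ℝ ℝ (En n)))
      ((EuclideanSpace.proj i).comp (ContinuousLinearMap.snd ℝ ℝ (En n))))

theorem parForm_apply (h k : ℝ × En n) :
    parForm n h k = 2 * (h.1 * k.1 + inner ℝ h.2 k.2) := by
  rw [parForm, _root_.smul_apply, _root_.smul_apply, _root_.add_apply, _root_.add_apply,
    _root_.sum_apply, _root_.sum_apply, PiLp.inner_apply]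
  simp [dualProd_apply, mul_comm]

theorem parForm_comm (h k : ℝ × En n) : parForm n h k = parForm n k h := by
  rw [parForm_apply, parForm_apply, mul_comm h.1, real_inner_comm]

theorem half_parForm_self (h : ℝ × En n) : 1 / 2 * parForm n h h = h.1 ^ 2 + ‖h.2‖ ^ 2 := by
  rw [parForm_apply, real_inner_self_eq_norm_sq]; ring

theorem norm_sq_le_half_parForm (h : ℝ × En n) : ‖h‖ ^ 2 ≤ 1 / 2 * parForm n h h := by
  rw [half_parForm_self, Prod.norm_def]
  rcases max_cases ‖h.1‖ ‖h.2‖ with ⟨e, -⟩ | ⟨e, -⟩ <;> rw [e]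
  · rw [Real.norm_eq_abs, sq_abs]; nlinarith [sq_nonneg ‖h.2‖]
  · nlinarith [sq_nonneg h.1]

end Parabolic

section Bridge

variable {n d : ℕ} {φ : ℝ → En n → ℝ}

theorem HasJet.hasFDerivAt {E : Type*} [NormedAddCommGroup E] [NormedSpace ℝ E] {Φ : E → ℝ}
    {p : E} {q : E →L[ℝ] ℝ} {X : E →L[ℝ] E →L[ℝ] ℝ} (h : HasJet Φ p q X) : HasFDerivAt Φ q p := by
  rw [hasFDerivAt_iff_isLittleO_nhds_zero]
  refine h.sub_isBigO.trans_isLittleO ?_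
  rw [← Asymptotics.isLittleO_norm_right]
  have h0 : (fun h : E => ‖h‖) =o[𝓝 0] (fun _ : E => (1 : ℝ)) := by
    rw [Asymptotics.isLittleO_one_iff]
    exact tendsto_norm_zero
  have := h0.mul_isBigO (Asymptotics.isBigO_refl (fun h : E => ‖h‖) (𝓝 0))
  refine this.congr (fun h => by ring) (fun h => by ring)

theorem IsTest.hasFDerivAt (h : IsTest φ) (p : ℝ × En n) :
    HasFDerivAt (fun p : ℝ × En n => φ p.1 p.2) (fderiv ℝ (fun p : ℝ × En n => φ p.1 p.2) p) p :=
  (h.differentiable (by norm_num) p).hasFDerivAt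

theorem IsTest.hasFDerivAt_fderiv (h : IsTest φ) (p : ℝ × En n) :
    HasFDerivAt (fderiv ℝ (fun p : ℝ × En n => φ p.1 p.2))
      (fderiv ℝ (fderiv ℝ (fun p : ℝ × En n => φ p.1 p.2)) p) p := by
  have : ContDiff ℝ 1 (fderiv ℝ (fun p : ℝ × En n => φ p.1 p.2)) :=
    h.fderiv_right (by norm_num)
  exact (this.differentiable (by norm_num) p).hasFDerivAt

theorem IsTest.hasJet (h : IsTest φ) (p : ℝ × En n) :
    HasJet (fun p : ℝ × En n => φ p.1 p.2) p (fderiv ℝ (fun p : ℝ × En n => φ p.1 p.2) p)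
      (fderiv ℝ (fderiv ℝ (fun p : ℝ × En n => φ p.1 p.2)) p) :=
  hasJet_of_hasFDerivAt (Eventually.of_forall h.hasFDerivAt) (h.hasFDerivAt_fderiv p)

theorem hasFDerivAt_slice (t : ℝ) (x : En n) :
    HasFDerivAt (fun y : En n => (t, y)) (ContinuousLinearMap.inr ℝ ℝ (En n)) x :=
  hasFDerivAt_prodMk_right t x

theorem IsTest.ptd_eq (h : IsTest φ) (t : ℝ) (x : En n) :
    ptd φ t x = fderiv ℝ (fun p : ℝ × En n => φ p.1 p.2) (t, x) (1, 0) := by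
  have h1 : HasDerivAt (fun s : ℝ => (s, x)) ((1 : ℝ), (0 : En n)) t :=
    (hasDerivAt_id t).prodMk (hasDerivAt_const t x)
  exact ((h.hasFDerivAt (t, x)).comp_hasDerivAt t h1).deriv

theorem IsTest.fderiv_slice (h : IsTest φ) (t : ℝ) (x : En n) :
    fderiv ℝ (φ t) x = (fderiv ℝ (fun p : ℝ × En n => φ p.1 p.2) (t, x)).comp
      (ContinuousLinearMap.inr ℝ ℝ (En n)) :=
  ((h.hasFDerivAt (t, x)).comp x (hasFDerivAt_slice t x)).fderiv

theorem IsTest.pd_eq (h : IsTest φ) (t : ℝ) (x : En n) (i : Fin n) :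
    pd (φ t) x i = fderiv ℝ (fun p : ℝ × En n => φ p.1 p.2) (t, x)
      (0, EuclideanSpace.single i 1) := by
  rw [pd, h.fderiv_slice]; rfl

theorem IsTest.pd2_eq (h : IsTest φ) (t : ℝ) (x : En n) (i j : Fin n) :
    pd2 (φ t) x i j = fderiv ℝ (fderiv ℝ (fun p : ℝ × En n => φ p.1 p.2)) (t, x)
      (0, EuclideanSpace.single i 1) (0, EuclideanSpace.single j 1) := by
  have e : (fun y => fderiv ℝ (φ t) y (EuclideanSpace.single j 1))
      = fun y => fderiv ℝ (fun p : ℝ × En n => φ p.1 p.2) (t, y)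
        (0, EuclideanSpace.single j 1) := by
    funext y
    exact h.pd_eq t y j
  rw [pd2, e]
  have h1 := ((h.hasFDerivAt_fderiv (t, x)).comp x (hasFDerivAt_slice t x)).clm_apply
    (hasFDerivAt_const ((0 : ℝ), (EuclideanSpace.single j (1 : ℝ) : En n)) x)
  have := h1.fderiv
  simp only [Function.comp] at this
  rw [this]
  simp

end Bridge

namespace QVI

variable {n d : ℕ} {U : Type} [MetricSpace U] [CompactSpace U] [Nonempty U] {Q : QVI n d U}

theorem op_eq_of_isTest {φ : ℝ → En n → ℝ} (h : IsTest φ) (t : ℝ) (x : En n) (y : ℝ) :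
    -(ptd φ t x) - genL Q.a Q.σm φ t x - Q.f t x y (sigGrad Q.σm φ t x)
      = Q.op (t, x) y (fderiv ℝ (fun p : ℝ × En n => φ p.1 p.2) (t, x))
        (fderiv ℝ (fderiv ℝ (fun p : ℝ × En n => φ p.1 p.2)) (t, x)) := by
  set q := fderiv ℝ (fun p : ℝ × En n => φ p.1 p.2) (t, x) with hq
  set X := fderiv ℝ (fderiv ℝ (fun p : ℝ × En n => φ p.1 p.2)) (t, x) with hX
  have lin1 : ∀ w : En n, q (0, w) = ∑ i, w i * q (0, EuclideanSpace.single i 1) := by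
    intro w
    have : q (0, w) = (q.comp (ContinuousLinearMap.inr ℝ ℝ (En n))) w := rfl
    rw [this]
    conv_lhs => rw [EuclideanSpace.eq_sum_single w]
    simp [map_sum]
  have lin2 : ∀ w : En n, X (0, w) (0, w) = ∑ i, ∑ j, w i * w j *
      X (0, EuclideanSpace.single i 1) (0, EuclideanSpace.single j 1) := by
    intro w
    have : X (0, w) (0, w) = (X.bilinearComp (ContinuousLinearMap.inr ℝ ℝ (En n))
      (ContinuousLinearMap.inr ℝ ℝ (En n))) w w := rfl
    rw [this]
    conv_lhs => rw [EuclideanSpace.eq_sum_single w]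
    rw [map_sum, map_sum, Finset.sum_comm]
    refine Finset.sum_congr rfl fun i _ => ?_
    rw [map_smul, _root_.sum_apply, smul_eq_mul, Finset.mul_sum]
    refine Finset.sum_congr rfl fun j _ => ?_
    simp
    ring
  have e1 : genL Q.a Q.σm φ t x = q (0, Q.a t x)
      + 1 / 2 * ∑ k, X (0, Q.col (t, x) k) (0, Q.col (t, x) k) := by
    rw [genL, lin1]
    simp only [h.pd_eq, h.pd2_eq, ← hq, ← hX]
    congr 2
    simp only [lin2]
    rw [Finset.sum_comm]
    conv_rhs => rw [Finset.sum_comm]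
    conv_lhs => rw [Finset.sum_comm]
    refine Finset.sum_congr rfl fun i _ => ?_
    rw [Finset.sum_comm]
    refine Finset.sum_congr rfl fun j _ => ?_
    rw [Matrix.mul_apply, Finset.sum_mul]
    rfl
  have e2 : sigGrad Q.σm φ t x = Q.sg (t, x) q := by
    ext k
    simp [sigGrad, sg, h.pd_eq, ← hq, lin1 (Q.col (t, x) k)]
    rfl
  rw [e1, e2, h.ptd_eq, op, lin]
  ring

end QVI

theorem tendsto_clm_apply {ι E F : Type*} [NormedAddCommGroup E] [NormedSpace ℝ E]
    [NormedAddCommGroup F] [NormedSpace ℝ F] {l : Filter ι} {L : ι → E →L[ℝ] F} {L₀ : E →L[ℝ] F}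
    {x : ι → E} {x₀ : E} (hL : Tendsto L l (𝓝 L₀)) (hx : Tendsto x l (𝓝 x₀)) :
    Tendsto (fun i => L i (x i)) l (𝓝 (L₀ x₀)) :=
  (isBoundedBilinearMap_apply.continuous.tendsto (L₀, x₀)).comp (hL.prodMk_nhds hx)

namespace QVI

variable {n d : ℕ} {U : Type} [MetricSpace U] [CompactSpace U] [Nonempty U] {Q : QVI n d U}

theorem op_add_form (p : ℝ × En n) (y : ℝ) (q : ℝ × En n →L[ℝ] ℝ)
    (X Y : ℝ × En n →L[ℝ] ℝ × En n →L[ℝ] ℝ) (c : ℝ) :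
    Q.op p y q (X + c • Y) = Q.op p y q X
      - c * (1 / 2 * ∑ k, Y (0, Q.col p k) (0, Q.col p k)) := by
  simp only [op, lin, _root_.add_apply, _root_.smul_apply, smul_eq_mul, Finset.sum_add_distrib,
    ← Finset.mul_sum]
  ring

theorem isTest_quadPoly (c : ℝ) (p : ℝ × En n) (q : ℝ × En n →L[ℝ] ℝ)
    (X : ℝ × En n →L[ℝ] ℝ × En n →L[ℝ] ℝ) : IsTest (fun t x => quadPoly c p q X (t, x)) := by
  unfold IsTest quadPoly
  simp only [Prod.mk.eta]
  fun_prop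

theorem op_quadPoly {c : ℝ} {p : ℝ × En n} {q : ℝ × En n →L[ℝ] ℝ}
    {X : ℝ × En n →L[ℝ] ℝ × En n →L[ℝ] ℝ} (hX : ∀ h k, X h k = X k h) (y : ℝ) :
    -(ptd (fun t x => quadPoly c p q X (t, x)) p.1 p.2)
      - genL Q.a Q.σm (fun t x => quadPoly c p q X (t, x)) p.1 p.2
      - Q.f p.1 p.2 y (sigGrad Q.σm (fun t x => quadPoly c p q X (t, x)) p.1 p.2)
      = Q.op p y q X := by
  rw [op_eq_of_isTest (isTest_quadPoly c p q X)]
  simp only [Prod.mk.eta]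
  have e : fderiv ℝ (fun z : ℝ × En n => quadPoly c p q X z) = fun z => q + X (z - p) := by
    funext z
    exact (hasJet_quadPoly c hX z).hasFDerivAt.fderiv
  rw [e]
  have e2 : fderiv ℝ (fun z : ℝ × En n => q + X (z - p)) p = X := by
    have h1 : HasFDerivAt (fun z : ℝ × En n => z - p) (ContinuousLinearMap.id ℝ (ℝ × En n)) p :=
      (hasFDerivAt_id p).sub_const p
    have h2 := (X.hasFDerivAt.comp p h1).const_add q
    exact h2.fderiv
  rw [e2]
  simp

theorem parForm_add_symmForm_comm (X : ℝ × En n →L[ℝ] ℝ × En n →L[ℝ] ℝ) (ν : ℝ)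
    (h k : ℝ × En n) : (symmForm X + ν • parForm n) h k = (symmForm X + ν • parForm n) k h := by
  simp only [_root_.add_apply, _root_.smul_apply]
  rw [symmForm_comm, parForm_comm]

theorem quadPoly_ge (c : ℝ) (p : ℝ × En n) (q : ℝ × En n →L[ℝ] ℝ)
    (X : ℝ × En n →L[ℝ] ℝ × En n →L[ℝ] ℝ) {ν : ℝ} (hν : 0 ≤ ν) (z : ℝ × En n) :
    c + q (z - p) + 1 / 2 * X (z - p) (z - p) + ν * ‖z - p‖ ^ 2
      ≤ quadPoly c p q (symmForm X + ν • parForm n) z := by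
  have := mul_le_mul_of_nonneg_left (norm_sq_le_half_parForm (z - p)) hν
  simp only [quadPoly, _root_.add_apply, _root_.smul_apply, symmForm_self, smul_eq_mul]
  linarith

theorem le_zero_of_forall_sub_mul {A B : ℝ} (h : ∀ ν > (0 : ℝ), A - ν * B ≤ 0) : A ≤ 0 := by
  have hl : Tendsto (fun ν : ℝ => A - ν * B) (𝓝[>] 0) (𝓝 A) := by
    have : Tendsto (fun ν : ℝ => A - ν * B) (𝓝 0) (𝓝 (A - 0 * B)) := by
      apply Continuous.tendsto
      fun_prop
    rw [zero_mul, sub_zero] at this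
    exact this.mono_left nhdsWithin_le_nhds
  exact le_of_tendsto hl (eventually_mem_nhdsWithin.mono h)

theorem jSub_iff {u : ℝ → En n → ℝ} :
    Q.JSub (fun p => u p.1 p.2) ↔ IsSub Q.T Q.Γ Q.ℓ Q.a Q.σm Q.f Q.ψ u := by
  constructor
  · rintro ⟨h1, h2, h3⟩
    refine ⟨h1, h2, fun t ht x φ hφ htouch hmin => ?_⟩
    have hp : (t, x) ∈ Q.dom := mem_dom.2 (Ico_subset_Icc_self ht)
    have hmax : IsLocalMaxOn (fun z : ℝ × En n => u z.1 z.2 - φ z.1 z.2) Q.dom (t, x) := by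
      filter_upwards [hmin] with z hz
      linarith
    rcases h3 (t, x) hp ht.2 _ _ (SupJet.of_isLocalMaxOn_sub (hφ.hasJet (t, x)) hmax) with h | h
    · exact min_le_of_left_le (sub_nonpos.2 h)
    · refine min_le_of_right_le ?_
      rw [op_eq_of_isTest hφ]
      exact h
  · rintro ⟨h1, h2, h3⟩
    refine ⟨h1, h2, fun p hp ht q X hX => ?_⟩
    by_cases hM : u p.1 p.2 ≤ Q.M (fun p => u p.1 p.2) p
    · exact Or.inl hM
    right
    rw [← op_symmForm]
    refine le_zero_of_forall_sub_mul
      (B := 1 / 2 * ∑ k, parForm n (0, Q.col p k) (0, Q.col p k)) fun ν hν => ?_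
    rw [← op_add_form]
    have := h3 p.1 ⟨(mem_dom.1 hp).1, ht⟩ p.2 _
      (isTest_quadPoly (u p.1 p.2) p q (symmForm X + ν • parForm n)) (by simp) ?_
    · rw [op_quadPoly (parForm_add_symmForm_comm X ν)] at this
      refine (min_le_iff.1 this).resolve_left fun hle => hM (sub_nonpos.1 hle)
    · filter_upwards [hX ν hν] with z hz
      have := quadPoly_ge (u p.1 p.2) p q X hν.le z
      simp only [Prod.mk.eta, quadPoly_self, sub_self]
      linarith

theorem jSuper_iff {v : ℝ → En n → ℝ} :
    Q.JSuper (fun p => v p.1 p.2) ↔ IsSuper Q.T Q.Γ Q.ℓ Q.a Q.σm Q.f Q.ψ v := by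
  constructor
  · rintro ⟨h1, h2, h3⟩
    refine ⟨h1, h2, fun t ht x φ hφ htouch hmax => ?_⟩
    have hp : (t, x) ∈ Q.dom := mem_dom.2 (Ico_subset_Icc_self ht)
    have hmax : IsLocalMaxOn (fun z : ℝ × En n => -v z.1 z.2 - -φ z.1 z.2) Q.dom (t, x) := by
      filter_upwards [hmax] with z hz
      linarith
    obtain ⟨h, h'⟩ := h3 (t, x) hp ht.2 _ _
      (SupJet.of_isLocalMaxOn_sub (hφ.hasJet (t, x)).neg hmax)
    refine le_min (sub_nonneg.2 h) ?_
    rw [op_eq_of_isTest hφ]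
    exact h'
  · rintro ⟨h1, h2, h3⟩
    refine ⟨h1, h2, fun p hp ht q X hX => ?_⟩
    have key : ∀ ν > (0 : ℝ), Q.M (fun p => v p.1 p.2) p ≤ v p.1 p.2 ∧
        0 ≤ Q.op p (v p.1 p.2) q (symmForm X + (-ν) • parForm n) := by
      intro ν hν
      have := h3 p.1 ⟨(mem_dom.1 hp).1, ht⟩ p.2 _
        (isTest_quadPoly (v p.1 p.2) p q (symmForm X + (-ν) • parForm n)) (by simp) ?_
      · rw [op_quadPoly (parForm_add_symmForm_comm X (-ν))] at this
        have := le_min_iff.1 this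
        exact ⟨sub_nonneg.1 this.1, this.2⟩
      · filter_upwards [hX ν hν] with z hz
        have := mul_le_mul_of_nonneg_left (norm_sq_le_half_parForm (z - p)) hν.le
        simp only [Prod.mk.eta, quadPoly_self, sub_self]
        simp only [quadPoly, _root_.add_apply, _root_.smul_apply, symmForm_self, smul_eq_mul,
          _root_.neg_apply] at hz ⊢
        linarith
    refine ⟨(key 1 one_pos).1, ?_⟩
    rw [← op_symmForm]
    refine neg_nonpos.1 (le_zero_of_forall_sub_mul
      (B := 1 / 2 * ∑ k, parForm n (0, Q.col p k) (0, Q.col p k)) fun ν hν => ?_)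
    have := (key ν hν).2
    rw [op_add_form] at this
    linarith

/-! ### Continuity of the operator -/

theorem continuousOn_col (k : Fin d) : ContinuousOn (fun p => Q.col p k) Q.dom := by
  unfold col
  refine (PiLp.continuous_toLp 2 _).comp_continuousOn (continuousOn_pi.2 fun i => ?_)
  exact (continuous_apply_apply i k).comp_continuousOn Q.hσc

theorem continuousOn_f :
    ContinuousOn (fun w : (ℝ × En n) × ℝ × Ed d => Q.f w.1.1 w.1.2 w.2.1 w.2.2)
      (Q.dom ×ˢ univ) := by
  rintro ⟨p, y, z⟩ ⟨hp, -⟩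
  rw [ContinuousWithinAt, Metric.tendsto_nhds]
  intro ε hε
  obtain ⟨r, hr, H⟩ := Q.hfc (ε / 4) (by positivity) p hp
  have hk := Q.hkf
  have h1 : ∀ᶠ w in 𝓝[Q.dom ×ˢ univ] ((p, y, z) : (ℝ × En n) × ℝ × Ed d), dist w.1 p < r :=
    nhdsWithin_le_nhds ((continuous_fst.tendsto _).eventually (Metric.ball_mem_nhds _ hr))
  have h2 : ∀ᶠ w in 𝓝[Q.dom ×ˢ univ] ((p, y, z) : (ℝ × En n) × ℝ × Ed d),
      dist w.2 (y, z) < ε / (4 * Q.kf) :=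
    nhdsWithin_le_nhds ((continuous_snd.tendsto _).eventually
      (Metric.ball_mem_nhds _ (by positivity)))
  filter_upwards [h1, h2, self_mem_nhdsWithin] with w a1 a2 a3
  have b1 := H w.1 a3.1 a1.le y z
  have b2 := Q.hfLip w.1.1 (mem_dom.1 a3.1) w.1.2 y w.2.1 z w.2.2
  rw [Prod.dist_eq, max_lt_iff, Real.dist_eq, dist_eq_norm] at a2
  have b3 : Q.kf * (|w.2.1 - y| + ‖w.2.2 - z‖) < ε / 2 := by
    calc _ < Q.kf * (ε / (4 * Q.kf) + ε / (4 * Q.kf)) := by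
          gcongr
          · exact a2.1
          · exact a2.2
      _ = ε / 2 := by field_simp; ring
  rw [Real.dist_eq]
  have b4 := abs_sub_le (Q.f w.1.1 w.1.2 w.2.1 w.2.2) (Q.f w.1.1 w.1.2 y z) (Q.f p.1 p.2 y z)
  linarith

theorem tendsto_f {ι : Type*} {l : Filter ι} {P : ι → ℝ × En n} {Y : ι → ℝ} {Z : ι → Ed d}
    {p : ℝ × En n} {y : ℝ} {z : Ed d} (hp : p ∈ Q.dom) (hmem : ∀ᶠ i in l, P i ∈ Q.dom)
    (hP : Tendsto P l (𝓝 p)) (hY : Tendsto Y l (𝓝 y)) (hZ : Tendsto Z l (𝓝 z)) :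
    Tendsto (fun i => Q.f (P i).1 (P i).2 (Y i) (Z i)) l (𝓝 (Q.f p.1 p.2 y z)) := by
  have h := (continuousOn_f (Q := Q)) (p, y, z) ⟨hp, trivial⟩
  have ht : Tendsto (fun i => (P i, Y i, Z i)) l (𝓝[Q.dom ×ˢ univ] (p, y, z)) := by
    refine tendsto_nhdsWithin_iff.2 ⟨hP.prodMk_nhds (hY.prodMk_nhds hZ), ?_⟩
    filter_upwards [hmem] with i hi using ⟨hi, trivial⟩
  exact h.tendsto.comp ht

theorem tendsto_of_continuousOn_dom {ι F : Type*} [TopologicalSpace F] {l : Filter ι}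
    {P : ι → ℝ × En n} {p : ℝ × En n} {g : ℝ × En n → F} (hg : ContinuousOn g Q.dom)
    (hp : p ∈ Q.dom) (hmem : ∀ᶠ i in l, P i ∈ Q.dom) (hP : Tendsto P l (𝓝 p)) :
    Tendsto (fun i => g (P i)) l (𝓝 (g p)) :=
  (hg p hp).tendsto.comp (tendsto_nhdsWithin_iff.2 ⟨hP, hmem⟩)

theorem tendsto_op {ι : Type*} {l : Filter ι} {P : ι → ℝ × En n} {Y : ι → ℝ}
    {q' : ι → ℝ × En n →L[ℝ] ℝ} {X' : ι → ℝ × En n →L[ℝ] ℝ × En n →L[ℝ] ℝ}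
    {p : ℝ × En n} {y : ℝ} {q : ℝ × En n →L[ℝ] ℝ} {X : ℝ × En n →L[ℝ] ℝ × En n →L[ℝ] ℝ}
    (hp : p ∈ Q.dom) (hmem : ∀ᶠ i in l, P i ∈ Q.dom)
    (hP : Tendsto P l (𝓝 p)) (hY : Tendsto Y l (𝓝 y)) (hq : Tendsto q' l (𝓝 q))
    (hX : Tendsto X' l (𝓝 X)) :
    Tendsto (fun i => Q.op (P i) (Y i) (q' i) (X' i)) l (𝓝 (Q.op p y q X)) := by
  have ha : Tendsto (fun i => ((0 : ℝ), Q.a (P i).1 (P i).2)) l (𝓝 (0, Q.a p.1 p.2)) :=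
    tendsto_const_nhds.prodMk_nhds (tendsto_of_continuousOn_dom Q.hac hp hmem hP)
  have hc : ∀ k, Tendsto (fun i => ((0 : ℝ), Q.col (P i) k)) l (𝓝 (0, Q.col p k)) := fun k =>
    tendsto_const_nhds.prodMk_nhds (tendsto_of_continuousOn_dom (continuousOn_col k) hp hmem hP)
  have hsg : Tendsto (fun i => Q.sg (P i) (q' i)) l (𝓝 (Q.sg p q)) := by
    unfold sg
    refine ((PiLp.continuous_toLp 2 _).tendsto _).comp (tendsto_pi_nhds.2 fun k => ?_)
    exact tendsto_clm_apply hq (hc k)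
  unfold op lin
  refine (((tendsto_clm_apply hq tendsto_const_nhds).neg.sub (tendsto_clm_apply hq ha)).sub
    (Tendsto.const_mul _ (tendsto_finsetSum _ fun k _ => ?_))).sub
    (tendsto_f hp hmem hP hY hsg)
  exact tendsto_clm_apply (tendsto_clm_apply hX (hc k)) (hc k)

/-! ### The intervention operator -/

theorem mem_dom_Γ {p : ℝ × En n} (hp : p ∈ Q.dom) (b : U) : (p.1, Q.Γ p.1 p.2 b) ∈ Q.dom :=
  mem_dom.2 (mem_dom.1 hp)

theorem continuousOn_jump :
    ContinuousOn (fun w : (ℝ × En n) × U => (w.1.1, Q.Γ w.1.1 w.1.2 w.2)) (Q.dom ×ˢ univ) := by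
  refine (continuous_fst.comp continuous_fst).continuousOn.prodMk ?_
  have : Continuous (fun w : (ℝ × En n) × U => (w.1.1, w.1.2, w.2)) := by fun_prop
  exact Q.hΓc.comp this.continuousOn fun w hw => ⟨mem_dom.1 hw.1, trivial⟩

theorem continuousOn_cost :
    ContinuousOn (fun w : (ℝ × En n) × U => Q.ℓ w.1.1 w.1.2 w.2) (Q.dom ×ˢ univ) := by
  have : Continuous (fun w : (ℝ × En n) × U => (w.1.1, w.1.2, w.2)) := by fun_prop
  exact Q.hℓc.comp this.continuousOn fun w hw => ⟨mem_dom.1 hw.1, trivial⟩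

theorem upperSemicontinuousOn_jump {u : ℝ × En n → ℝ} (hu : UpperSemicontinuousOn u Q.dom) :
    UpperSemicontinuousOn (fun w : (ℝ × En n) × U =>
      u (w.1.1, Q.Γ w.1.1 w.1.2 w.2) + -Q.ℓ w.1.1 w.1.2 w.2) (Q.dom ×ˢ univ) := by
  refine UpperSemicontinuousOn.add ?_ continuousOn_cost.neg.upperSemicontinuousOn
  intro w hw c hc
  have := hu _ (mem_dom_Γ hw.1 w.2) c hc
  have ht : Tendsto (fun w : (ℝ × En n) × U => (w.1.1, Q.Γ w.1.1 w.1.2 w.2))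
      (𝓝[Q.dom ×ˢ univ] w) (𝓝[Q.dom] (w.1.1, Q.Γ w.1.1 w.1.2 w.2)) := by
    refine tendsto_nhdsWithin_iff.2 ⟨continuousOn_jump w hw, ?_⟩
    filter_upwards [self_mem_nhdsWithin] with w' hw' using mem_dom_Γ hw'.1 w'.2
  exact ht.eventually this

theorem exists_M_eq {u : ℝ × En n → ℝ} (hu : UpperSemicontinuousOn u Q.dom) {p : ℝ × En n}
    (hp : p ∈ Q.dom) : ∃ b, Q.M u p = u (p.1, Q.Γ p.1 p.2 b) - Q.ℓ p.1 p.2 b ∧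
      ∀ b', u (p.1, Q.Γ p.1 p.2 b') - Q.ℓ p.1 p.2 b' ≤ Q.M u p := by
  have h : UpperSemicontinuousOn
      (fun b : U => u (p.1, Q.Γ p.1 p.2 b) + -Q.ℓ p.1 p.2 b) univ := by
    intro b _ c hc
    have := upperSemicontinuousOn_jump hu (p, b) ⟨hp, trivial⟩ c hc
    have ht : Tendsto (fun b : U => (p, b)) (𝓝[univ] b) (𝓝[Q.dom ×ˢ univ] (p, b)) := by
      refine tendsto_nhdsWithin_iff.2 ⟨?_, Eventually.of_forall fun _ => ⟨hp, trivial⟩⟩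
      rw [nhdsWithin_univ]
      exact (Continuous.prodMk_right p).tendsto b
    exact ht.eventually this
  obtain ⟨b, -, hb⟩ := h.exists_isMaxOn univ_nonempty isCompact_univ
  have hle : ∀ b', u (p.1, Q.Γ p.1 p.2 b') - Q.ℓ p.1 p.2 b'
      ≤ u (p.1, Q.Γ p.1 p.2 b) - Q.ℓ p.1 p.2 b := fun b' => by
    simpa [sub_eq_add_neg] using hb (mem_univ b')
  have e : Q.M u p = u (p.1, Q.Γ p.1 p.2 b) - Q.ℓ p.1 p.2 b :=
    le_antisymm (ciSup_le hle) (le_ciSup (f := fun b => u (p.1, Q.Γ p.1 p.2 b) - Q.ℓ p.1 p.2 b)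
      ⟨_, by rintro _ ⟨b', rfl⟩; exact hle b'⟩ b)
  exact ⟨b, e, fun b' => e ▸ hle b'⟩

theorem upperSemicontinuousOn_M {u : ℝ × En n → ℝ} (hu : UpperSemicontinuousOn u Q.dom) :
    UpperSemicontinuousOn (Q.M u) Q.dom := by
  intro p hp c hc
  obtain ⟨b₀, -, hle⟩ := exists_M_eq hu hp
  have h : ∀ b : U, ∀ᶠ w : (ℝ × En n) × U in 𝓝 p ×ˢ 𝓝 b, w.1 ∈ Q.dom →
      u (w.1.1, Q.Γ w.1.1 w.1.2 w.2) - Q.ℓ w.1.1 w.1.2 w.2 < c := by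
    intro b
    have h1 := upperSemicontinuousOn_jump hu (p, b) ⟨hp, trivial⟩ c
      (by have := hle b; simp only; linarith)
    rw [eventually_nhdsWithin_iff, nhds_prod_eq] at h1
    filter_upwards [h1] with w hw hmem
    have := hw ⟨hmem, trivial⟩
    linarith
  have h2 := (isCompact_univ (X := U)).eventually_forall_of_forall_eventually
    (P := fun p' b => p' ∈ Q.dom → u (p'.1, Q.Γ p'.1 p'.2 b) - Q.ℓ p'.1 p'.2 b < c)
    (x₀ := p) (fun b _ => by rw [nhds_prod_eq]; exact h b)
  filter_upwards [nhdsWithin_le_nhds h2, self_mem_nhdsWithin] with p' h3 h4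
  obtain ⟨b, e, -⟩ := exists_M_eq hu h4
  rw [e]
  exact h3 b trivial h4

variable (Q) in
/-- Polynomial growth of functions on the closed domain. -/
def Growth (u : ℝ × En n → ℝ) : Prop :=
  ∃ C > (0:ℝ), ∃ ρ > (0:ℝ), ∀ p ∈ Q.dom, |u p| ≤ C * (1 + ‖p.2‖ ^ ρ)

theorem Growth.exists_bound {u : ℝ × En n → ℝ} (hu : Q.Growth u) (R : ℝ) :
    ∃ B, ∀ p ∈ Q.dom, ‖p.2‖ ≤ R → |u p| ≤ B := by
  obtain ⟨C, hC, ρ, hρ, h⟩ := hu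
  refine ⟨C * (1 + R ^ ρ), fun p hp hR => (h p hp).trans ?_⟩
  gcongr

theorem Growth.le_M {u : ℝ × En n → ℝ} (hu : Q.Growth u) {p : ℝ × En n} (hp : p ∈ Q.dom)
    (b : U) : u (p.1, Q.Γ p.1 p.2 b) - Q.ℓ p.1 p.2 b ≤ Q.M u p := by
  obtain ⟨B, hB⟩ := hu.exists_bound (max Q.KΓ ‖p.2‖)
  refine le_ciSup (f := fun b => u (p.1, Q.Γ p.1 p.2 b) - Q.ℓ p.1 p.2 b) ⟨B, ?_⟩ b
  rintro _ ⟨b', rfl⟩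
  have h1 := (abs_le.1 (hB _ (mem_dom_Γ hp b') (Q.hΓb p.1 (mem_dom.1 hp) p.2 b'))).2
  have h2 := Q.hℓlb p.1 (mem_dom.1 hp) p.2 b'
  have := Q.hδ
  simp only
  linarith

theorem M_mono {u v : ℝ × En n → ℝ} (hv : Q.Growth v) (huv : ∀ p ∈ Q.dom, u p ≤ v p)
    {p : ℝ × En n} (hp : p ∈ Q.dom) : Q.M u p ≤ Q.M v p :=
  ciSup_le fun b => (sub_le_sub_right (huv _ (mem_dom_Γ hp b)) _).trans (hv.le_M hp b)

theorem exists_lt_of_lt_M {u : ℝ × En n → ℝ} {p : ℝ × En n} {c : ℝ} (hc : c < Q.M u p) :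
    ∃ b, c < u (p.1, Q.Γ p.1 p.2 b) - Q.ℓ p.1 p.2 b :=
  exists_lt_of_lt_ciSup hc

theorem lowerSemicontinuousOn_M {v : ℝ × En n → ℝ} (hv : LowerSemicontinuousOn v Q.dom)
    (hg : Q.Growth v) : LowerSemicontinuousOn (Q.M v) Q.dom := by
  intro p hp c hc
  obtain ⟨b, hb⟩ := exists_lt_of_lt_M hc
  set η := (v (p.1, Q.Γ p.1 p.2 b) - Q.ℓ p.1 p.2 b - c) / 2 with hη
  have hη0 : 0 < η := by rw [hη]; linarith
  have ht0 : Tendsto (fun p' : ℝ × En n => (p', b)) (𝓝[Q.dom] p) (𝓝[Q.dom ×ˢ univ] (p, b)) := by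
    refine tendsto_nhdsWithin_iff.2 ⟨?_, ?_⟩
    · exact ((Continuous.prodMk_left b).tendsto p).mono_left nhdsWithin_le_nhds
    · filter_upwards [self_mem_nhdsWithin] with p' hp' using ⟨hp', trivial⟩
  have ht : Tendsto (fun p' : ℝ × En n => (p'.1, Q.Γ p'.1 p'.2 b)) (𝓝[Q.dom] p)
      (𝓝[Q.dom] (p.1, Q.Γ p.1 p.2 b)) := by
    refine tendsto_nhdsWithin_iff.2
      ⟨(continuousOn_jump (Q := Q) (p, b) ⟨hp, trivial⟩).tendsto.comp ht0, ?_⟩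
    filter_upwards [self_mem_nhdsWithin] with p' hp' using mem_dom_Γ hp' b
  have h1 := ht.eventually (hv _ (mem_dom_Γ hp b) (v (p.1, Q.Γ p.1 p.2 b) - η) (by simp [hη0]))
  have h2 := ((continuousOn_cost (Q := Q) (p, b) ⟨hp, trivial⟩).tendsto.comp ht0).eventually
    (eventually_lt_nhds (b := Q.ℓ p.1 p.2 b + η) (by simp only; linarith))
  filter_upwards [h1, h2, self_mem_nhdsWithin] with p' a1 a2 a3
  refine lt_of_lt_of_le ?_ (hg.le_M a3 b)
  simp only [Function.comp] at a2
  linarith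

end QVI

section Doubling

theorem quadPenal_estimates {H : Type*} [NormedAddCommGroup H] [InnerProductSpace ℝ H] {K : Set H}
    {g₁ g₂ : H → ℝ} {ε r R : ℝ} (hε : 0 < ε) (hε1 : ε ≤ 1) (hR : ∀ z ∈ K, ‖z‖ ≤ R) (hR0 : 0 ≤ R)
    (hr : 0 < r) (hrε : 4 * r * (R + 1) ≤ ε) {p₁ p₂ x y ξ η : H} (hx : x ∈ K) (hy : y ∈ K)
    (hp₁ : ‖p₁‖ ≤ r) (hp₂ : ‖p₂‖ ≤ r)
    (hmax : ∀ x' ∈ K, ∀ y' ∈ K, ∀ ξ' η',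
      quadPenal g₁ g₂ ε p₁ p₂ x' y' ξ' η' ≤ quadPenal g₁ g₂ ε p₁ p₂ x y ξ η) :
    ∃ N, 0 ≤ N ∧ (∀ z ∈ K, g₁ z + g₂ z - ε ≤ g₁ x + g₂ y - N) ∧ ‖x - y‖ ^ 2 ≤ 12 * ε * N ∧
      ‖ξ - η‖ ^ 2 ≤ 4 * ε * N := by
  refine ⟨(‖x - ξ‖ ^ 2 + ‖y - η‖ ^ 2 + ‖ξ - η‖ ^ 2) / (4 * ε), by positivity, fun z hz => ?_,
    ?_, ?_⟩
  · have h := hmax z hz z hz z z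
    simp only [quadPenal, sub_self, norm_zero] at h
    have bd : ∀ p w v : H, ‖p‖ ≤ r → w ∈ K → -inner ℝ p v ≤ r * (R + 1) + r * ‖w - v‖ ^ 2 := by
      intro p w v hp hw
      have h1 : -inner ℝ p v ≤ ‖p‖ * ‖v‖ := (neg_le_abs _).trans (abs_real_inner_le_norm p v)
      have h2 : ‖v‖ ≤ ‖w‖ + ‖w - v‖ := by
        have := norm_sub_le w (w - v); rwa [sub_sub_cancel] at this
      have h3 : ‖v‖ ≤ R + 1 + ‖w - v‖ ^ 2 := by
        nlinarith [hR w hw, sq_nonneg (‖w - v‖ - 1)]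
      calc _ ≤ ‖p‖ * ‖v‖ := h1
        _ ≤ r * (R + 1 + ‖w - v‖ ^ 2) := by gcongr
        _ = _ := by ring
    have bz : ∀ p : H, ‖p‖ ≤ r → inner ℝ p z ≤ r * R := fun p hp =>
      (real_inner_le_norm p z).trans (by gcongr; exact hR z hz)
    have b1 := bd p₁ x ξ hp₁ hx
    have b2 := bd p₂ y η hp₂ hy
    have b3 := bz p₁ hp₁
    have b4 := bz p₂ hp₂
    have b5 : r * (‖x - ξ‖ ^ 2 + ‖y - η‖ ^ 2)
        ≤ (‖x - ξ‖ ^ 2 + ‖y - η‖ ^ 2 + ‖ξ - η‖ ^ 2) / (4 * ε) := by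
      rw [le_div_iff₀ (by positivity)]
      have : 4 * r * ε ≤ 1 := by nlinarith
      have h0 : 0 ≤ ‖x - ξ‖ ^ 2 + ‖y - η‖ ^ 2 := by positivity
      nlinarith [sq_nonneg ‖ξ - η‖]
    have e : (‖x - ξ‖ ^ 2 + ‖y - η‖ ^ 2 + ‖ξ - η‖ ^ 2) / (2 * ε)
        = 2 * ((‖x - ξ‖ ^ 2 + ‖y - η‖ ^ 2 + ‖ξ - η‖ ^ 2) / (4 * ε)) := by
      field_simp; norm_num
    rw [e] at h
    norm_num at h
    nlinarith
  · have e : 12 * ε * ((‖x - ξ‖ ^ 2 + ‖y - η‖ ^ 2 + ‖ξ - η‖ ^ 2) / (4 * ε))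
        = 3 * (‖x - ξ‖ ^ 2 + ‖y - η‖ ^ 2 + ‖ξ - η‖ ^ 2) := by field_simp; ring
    rw [e]
    have h1 : ‖x - y‖ ≤ ‖x - ξ‖ + ‖ξ - η‖ + ‖y - η‖ := by
      have : x - y = (x - ξ) + (ξ - η) - (y - η) := by abel
      rw [this]
      exact (norm_sub_le _ _).trans (by gcongr; exact norm_add_le _ _)
    calc ‖x - y‖ ^ 2 ≤ (‖x - ξ‖ + ‖ξ - η‖ + ‖y - η‖) ^ 2 := by gcongr
      _ ≤ _ := by
        nlinarith [sq_nonneg (‖x - ξ‖ - ‖ξ - η‖), sq_nonneg (‖x - ξ‖ - ‖y - η‖),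
          sq_nonneg (‖ξ - η‖ - ‖y - η‖)]
  · have e : 4 * ε * ((‖x - ξ‖ ^ 2 + ‖y - η‖ ^ 2 + ‖ξ - η‖ ^ 2) / (4 * ε))
        = ‖x - ξ‖ ^ 2 + ‖y - η‖ ^ 2 + ‖ξ - η‖ ^ 2 := by field_simp
    rw [e]
    nlinarith [sq_nonneg ‖x - ξ‖, sq_nonneg ‖y - η‖]

variable {n : ℕ}

/-- The isomorphism `(s, x) ↦ (τ s, x)`. -/
def scaleTime (n : ℕ) (τ : ℝ) (hτ : τ ≠ 0) : WithLp 2 (ℝ × En n) ≃L[ℝ] ℝ × En n :=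
  (WithLp.prodContinuousLinearEquiv 2 ℝ ℝ (En n)).trans
    ((ContinuousLinearEquiv.unitsEquivAut ℝ (Units.mk0 τ hτ)).prodCongr
      (ContinuousLinearEquiv.refl ℝ (En n)))

theorem scaleTime_apply {τ : ℝ} (hτ : τ ≠ 0) (h : WithLp 2 (ℝ × En n)) :
    scaleTime n τ hτ h = (h.fst * τ, h.snd) := rfl

theorem scaleTime_symm_apply {τ : ℝ} (hτ : τ ≠ 0) (z : ℝ × En n) :
    (scaleTime n τ hτ).symm z = WithLp.toLp 2 (z.1 * τ⁻¹, z.2) := by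
  apply (scaleTime n τ hτ).injective
  rw [ContinuousLinearEquiv.apply_symm_apply, scaleTime_apply]
  simp [hτ]

/-- The linear form `(s, x) ↦ α s + ⟪β, x⟫`. -/
def linForm (α : ℝ) (β : En n) : ℝ × En n →L[ℝ] ℝ :=
  α • ContinuousLinearMap.fst ℝ ℝ (En n) + (innerSL ℝ β).comp (ContinuousLinearMap.snd ℝ ℝ (En n))

theorem linForm_apply (α : ℝ) (β : En n) (h : ℝ × En n) :
    linForm α β h = α * h.1 + inner ℝ β h.2 := by simp [linForm]

theorem exists_doubling_jets {K : Set (ℝ × En n)} (hK : IsCompact K) (hne : K.Nonempty)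
    {g₁ g₂ : ℝ × En n → ℝ} (hg₁ : UpperSemicontinuousOn g₁ K) (hg₂ : UpperSemicontinuousOn g₂ K)
    {ε δ : ℝ} (hε : 0 < ε) (hε1 : ε ≤ 1) (hδ : 0 < δ) :
    ∃ (P P' : ℝ × En n) (α : ℝ) (β : En n) (q₁ q₂ : ℝ × En n →L[ℝ] ℝ)
      (X₁ X₂ : ℝ × En n →L[ℝ] ℝ × En n →L[ℝ] ℝ) (N : ℝ), P ∈ K ∧ P' ∈ K ∧ 0 ≤ N ∧
      (∀ z ∈ K, g₁ z + g₂ z - ε ≤ g₁ P + g₂ P' - N) ∧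
      |P.1 - P'.1| ≤ δ ∧ ‖P.2 - P'.2‖ ^ 2 ≤ 12 * ε * N ∧ ε * ‖β‖ ^ 2 ≤ 4 * N ∧
      ‖q₁‖ ≤ ε ∧ ‖q₂‖ ≤ ε ∧
      SupJet K g₁ P (linForm α β + q₁) X₁ ∧ SupJet K g₂ P' (-linForm α β + q₂) X₂ ∧
      ∀ h k : En n, X₁ (0, h) (0, h) + X₂ (0, k) (0, k) ≤ ‖h - k‖ ^ 2 / ε := by
  obtain ⟨z₁, hz₁, hm₁⟩ := hg₁.exists_isMaxOn hne hK
  obtain ⟨z₂, hz₂, hm₂⟩ := hg₂.exists_isMaxOn hne hK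
  obtain ⟨z₀, hz₀⟩ := hne
  set B := g₁ z₁ + g₂ z₂ - (g₁ z₀ + g₂ z₀) + 1 with hB
  have hB0 : 0 < B := by
    have := hm₁ hz₀; have := hm₂ hz₀; simp only [mem_ofPred_eq] at *; linarith
  set τ := δ / √(12 * B) with hτd
  have hτ0 : 0 < τ := by positivity
  have hτ := hτ0.ne'
  set e := scaleTime n τ hτ with he
  have hK' : IsCompact (e ⁻¹' K) := e.toHomeomorph.isCompact_preimage.2 hK
  obtain ⟨R, hR0, hR⟩ : ∃ R, 0 ≤ R ∧ ∀ z ∈ e ⁻¹' K, ‖z‖ ≤ R := by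
    obtain ⟨R, hR⟩ := hK'.isBounded.exists_norm_le
    exact ⟨max R 0, le_max_right _ _, fun z hz => (hR z hz).trans (le_max_left _ _)⟩
  set L := ‖(e.symm : ℝ × En n →L[ℝ] WithLp 2 (ℝ × En n))‖ with hL
  set r := min (ε / (4 * (R + 1))) (ε / (L + 1)) with hr
  have hr0 : 0 < r := by positivity
  have hrε : 4 * r * (R + 1) ≤ ε := by
    have := (le_div_iff₀ (by positivity)).1 (min_le_left (ε / (4 * (R + 1))) (ε / (L + 1)))
    linarith
  have hrL : r * L ≤ ε := by
    have := (le_div_iff₀ (by positivity)).1 (min_le_right (ε / (4 * (R + 1))) (ε / (L + 1)))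
    linarith
  have husc : ∀ {g : ℝ × En n → ℝ}, UpperSemicontinuousOn g K →
      UpperSemicontinuousOn (fun z => g (e z)) (e ⁻¹' K) := by
    intro g hg z hz c hc
    have ht : Tendsto e (𝓝[e ⁻¹' K] z) (𝓝[K] (e z)) :=
      tendsto_nhdsWithin_iff.2 ⟨(e.continuous.tendsto z).mono_left nhdsWithin_le_nhds,
        eventually_mem_nhdsWithin⟩
    exact ht.eventually (hg _ hz c hc)
  obtain ⟨p₁, p₂, x, y, ξ, η, X, Y, hx, hy, hp₁, hp₂, hmax, hX, hY, hXY⟩ :=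
    exists_jets hK' ⟨e.symm z₀, by simpa using hz₀⟩ (husc hg₁) (husc hg₂) hε hr0
  obtain ⟨N, hN0, hN1, hN2, hN3⟩ := quadPenal_estimates hε hε1 hR hR0 hr0 hrε hx hy hp₁ hp₂ hmax
  have hNB : N ≤ B := by
    have h1 := hN1 (e.symm z₀) (by simpa using hz₀)
    have h2 := hm₁ hx
    have h3 := hm₂ hy
    simp only [mem_ofPred_eq, ContinuousLinearEquiv.apply_symm_apply] at h1 h2 h3
    linarith
  have hxy : ‖x - y‖ ^ 2 = (x.fst - y.fst) ^ 2 + ‖x.snd - y.snd‖ ^ 2 := by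
    rw [WithLp.prod_norm_sq_eq_of_L2, Real.norm_eq_abs, sq_abs]; rfl
  set form : (WithLp 2 (ℝ × En n) →L[ℝ] WithLp 2 (ℝ × En n)) →
      WithLp 2 (ℝ × En n) →L[ℝ] WithLp 2 (ℝ × En n) →L[ℝ] ℝ := fun Z => (innerSL ℝ).comp Z with hform
  have hjet : ∀ {g : ℝ × En n → ℝ} {w P : WithLp 2 (ℝ × En n)}
      {Z : WithLp 2 (ℝ × En n) →L[ℝ] WithLp 2 (ℝ × En n)},
      (∀ ν > (0 : ℝ), ∀ᶠ z in 𝓝[e ⁻¹' K] w, g (e z) ≤ g (e w) + inner ℝ P (z - w)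
        + 1 / 2 * inner ℝ (Z (z - w)) (z - w) + ν * ‖z - w‖ ^ 2) →
      SupJet K g (e w) ((innerSL ℝ P).comp (e.symm : ℝ × En n →L[ℝ] WithLp 2 (ℝ × En n)))
        ((form Z).bilinearComp (e.symm : ℝ × En n →L[ℝ] WithLp 2 (ℝ × En n))
          (e.symm : ℝ × En n →L[ℝ] WithLp 2 (ℝ × En n))) := by
    intro g w P Z h
    apply SupJet.comp_equiv
    intro ν hν
    filter_upwards [h ν hν] with z hz
    exact hz
  have hlin : ∀ w : WithLp 2 (ℝ × En n),
      (innerSL ℝ ((1 / ε) • w)).comp (e.symm : ℝ × En n →L[ℝ] WithLp 2 (ℝ × En n))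
        = linForm ((1 / ε) * τ⁻¹ * w.fst) ((1 / ε) • w.snd) := by
    intro w
    refine ContinuousLinearMap.ext fun z => ?_
    rw [linForm_apply, ContinuousLinearMap.comp_apply, innerSL_apply_apply,
      ContinuousLinearEquiv.coe_coe, he, scaleTime_symm_apply, WithLp.prod_inner_apply]
    simp [inner_smul_left]
    ring
  have hq : ∀ p : WithLp 2 (ℝ × En n), ‖p‖ ≤ r →
      ‖(innerSL ℝ p).comp (e.symm : ℝ × En n →L[ℝ] WithLp 2 (ℝ × En n))‖ ≤ ε := fun p hp =>
    (ContinuousLinearMap.opNorm_comp_le _ _).trans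
      ((by rw [innerSL_apply_norm]; gcongr : _ ≤ r * L).trans hrL)
  have j₁ := hjet hX
  rw [map_add, ContinuousLinearMap.add_comp, hlin] at j₁
  have j₂ := hjet hY
  rw [map_add, ContinuousLinearMap.add_comp, neg_smul, map_neg, ContinuousLinearMap.neg_comp,
    hlin] at j₂
  refine ⟨e x, e y, (1 / ε) * τ⁻¹ * (ξ - η).fst, (1 / ε) • (ξ - η).snd,
    (innerSL ℝ p₁).comp (e.symm : ℝ × En n →L[ℝ] WithLp 2 (ℝ × En n)),
    (innerSL ℝ p₂).comp (e.symm : ℝ × En n →L[ℝ] WithLp 2 (ℝ × En n)), _, _, N,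
    hx, hy, hN0, ?_, ?_, ?_, ?_, hq p₁ hp₁, hq p₂ hp₂, j₁, j₂, ?_⟩
  rotate_left 4
  · intro h k
    have e0 : ∀ h : En n, e.symm (0, h) = WithLp.toLp 2 (0, h) := fun h => by
      rw [he, scaleTime_symm_apply]; simp
    have := hXY (e.symm (0, h)) (e.symm (0, k))
    have e1 : ‖e.symm (0, h) - e.symm (0, k)‖ ^ 2 = ‖h - k‖ ^ 2 := by
      rw [← map_sub, Prod.mk_sub_mk, sub_self, e0, WithLp.prod_norm_sq_eq_of_L2]
      simp
    rw [e1] at this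
    simpa [hform] using this
  · intro z hz
    simpa using hN1 (e.symm z) (by simpa using hz)
  · rw [he, scaleTime_apply, scaleTime_apply]
    simp only [← sub_mul, abs_mul, abs_of_pos hτ0]
    rw [hτd, mul_div_assoc', div_le_iff₀ (by positivity), mul_comm]
    refine mul_le_mul_of_nonneg_left (Real.le_sqrt_of_sq_le ?_) hδ.le
    rw [sq_abs]
    have := sq_nonneg ‖x.snd - y.snd‖
    have : ε * N ≤ 1 * B := by gcongr
    linarith
  · rw [he, scaleTime_apply, scaleTime_apply]
    have := sq_nonneg (x.fst - y.fst)
    simp only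
    linarith
  · rw [norm_smul, mul_pow, Real.norm_eq_abs, sq_abs]
    have h1 : ‖(ξ - η).snd‖ ^ 2 ≤ ‖ξ - η‖ ^ 2 := by
      rw [WithLp.prod_norm_sq_eq_of_L2]
      have := sq_nonneg ‖(ξ - η).fst‖
      linarith
    have e2 : ε * ((1 / ε) ^ 2 * ‖(ξ - η).snd‖ ^ 2) = ‖(ξ - η).snd‖ ^ 2 / ε := by field_simp
    rw [e2, div_le_iff₀ hε]
    linarith

end Doubling

namespace QVI

variable {n d : ℕ} {U : Type} [MetricSpace U] [CompactSpace U] [Nonempty U] {Q : QVI n d U}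

variable (Q) in
/-- Drift and diffusion columns bundled together. -/
def coef (p : ℝ × En n) : En n × (Fin d → En n) := (Q.a p.1 p.2, fun k => Q.col p k)

theorem continuousOn_coef : ContinuousOn Q.coef Q.dom :=
  Q.hac.prodMk (continuousOn_pi.2 continuousOn_col)

theorem norm_sub_col_le (p p' : ℝ × En n) (k : Fin d) :
    ‖Q.col p k - Q.col p' k‖ ≤ frob (Q.σm p.1 p.2 - Q.σm p'.1 p'.2) := by
  rw [EuclideanSpace.norm_eq, frob]
  refine Real.sqrt_le_sqrt (Finset.sum_le_sum fun i _ => ?_)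
  have := Finset.single_le_sum (f := fun j => ((Q.σm p.1 p.2 - Q.σm p'.1 p'.2) i j) ^ 2)
    (fun j _ => sq_nonneg _) (Finset.mem_univ k)
  simpa [col] using this

theorem norm_col_le (p : ℝ × En n) (k : Fin d) : ‖Q.col p k‖ ≤ frob (Q.σm p.1 p.2) := by
  rw [EuclideanSpace.norm_eq, frob]
  refine Real.sqrt_le_sqrt (Finset.sum_le_sum fun i _ => ?_)
  have := Finset.single_le_sum (f := fun j => (Q.σm p.1 p.2 i j) ^ 2)
    (fun j _ => sq_nonneg _) (Finset.mem_univ k)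
  simpa [col] using this

theorem norm_coef_sub_le {t : ℝ} (ht : t ∈ Icc 0 Q.T) (x x' : En n) :
    ‖Q.coef (t, x) - Q.coef (t, x')‖ ≤ Q.kaσ * ‖x - x'‖ := by
  have h := Q.haσLip t ht x x'
  have h0 : 0 ≤ frob (Q.σm t x - Q.σm t x') := Real.sqrt_nonneg _
  have hk := Q.hkaσ
  rw [Prod.norm_def, max_le_iff]
  refine ⟨?_, (pi_norm_le_iff_of_nonneg (by positivity)).2 fun k => ?_⟩
  · simp only [coef, Prod.fst_sub]
    linarith
  · simp only [coef, Prod.snd_sub, Pi.sub_apply]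
    have := norm_sub_col_le (Q := Q) (t, x) (t, x') k
    have := norm_nonneg (Q.a t x - Q.a t x')
    simp only at *
    linarith

theorem isCompact_cap (p : ℝ × En n) (r : ℝ) : IsCompact (Q.dom ∩ Metric.closedBall p r) :=
  (isCompact_closedBall p r).inter_left (isClosed_Icc.prod isClosed_univ)

theorem exists_doubling {p : ℝ × En n} (hp : p ∈ Q.dom) {r : ℝ} (hr : 0 < r)
    {g₁ g₂ : ℝ × En n → ℝ} (hg₁ : UpperSemicontinuousOn g₁ (Q.dom ∩ Metric.closedBall p r))
    (hg₂ : UpperSemicontinuousOn g₂ (Q.dom ∩ Metric.closedBall p r))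
    {ε : ℝ} (hε : 0 < ε) (hε1 : ε ≤ 1) :
    ∃ (P P' : ℝ × En n) (α : ℝ) (β : En n) (q₁ q₂ : ℝ × En n →L[ℝ] ℝ)
      (X₁ X₂ : ℝ × En n →L[ℝ] ℝ × En n →L[ℝ] ℝ) (N : ℝ),
      P ∈ Q.dom ∩ Metric.closedBall p r ∧ P' ∈ Q.dom ∩ Metric.closedBall p r ∧ 0 ≤ N ∧
      (∀ z ∈ Q.dom ∩ Metric.closedBall p r, g₁ z + g₂ z - ε ≤ g₁ P + g₂ P' - N) ∧
      |P.1 - P'.1| ≤ ε ∧ ‖P.2 - P'.2‖ ^ 2 ≤ 12 * ε * N ∧ ε * ‖β‖ ^ 2 ≤ 4 * N ∧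
      ‖q₁‖ ≤ ε ∧ ‖q₂‖ ≤ ε ∧
      SupJet (Q.dom ∩ Metric.closedBall p r) g₁ P (linForm α β + q₁) X₁ ∧
      SupJet (Q.dom ∩ Metric.closedBall p r) g₂ P' (-linForm α β + q₂) X₂ ∧
      (∀ h k : En n, X₁ (0, h) (0, h) + X₂ (0, k) (0, k) ≤ ‖h - k‖ ^ 2 / ε) ∧
      ‖Q.coef P - Q.coef P'‖ ≤ ε + Q.kaσ * ‖P.2 - P'.2‖ := by
  have hK := isCompact_cap (Q := Q) p r
  have hu := hK.uniformContinuousOn_of_continuous (continuousOn_coef.mono inter_subset_left)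
  obtain ⟨δ, hδ, H⟩ := Metric.uniformContinuousOn_iff.1 hu ε hε
  obtain ⟨P, P', α, β, q₁, q₂, X₁, X₂, N, h1, h2, h3, h4, h5, h6, h7, h8, h9, h10, h11, h12⟩ :=
    exists_doubling_jets hK ⟨p, hp, Metric.mem_closedBall_self hr.le⟩ hg₁ hg₂ hε hε1
      (lt_min (half_pos hδ) hε)
  refine ⟨P, P', α, β, q₁, q₂, X₁, X₂, N, h1, h2, h3, h4, h5.trans (min_le_right _ _), h6, h7, h8,
    h9, h10, h11, h12, ?_⟩
  have hm : ((P'.1, P.2) : ℝ × En n) ∈ Q.dom ∩ Metric.closedBall p r := by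
    refine ⟨mem_dom.2 (mem_dom.1 h2.1), ?_⟩
    have a1 := h1.2
    have a2 := h2.2
    rw [Metric.mem_closedBall, Prod.dist_eq, max_le_iff] at a1 a2 ⊢
    exact ⟨a2.1, a1.2⟩
  have hd : dist P (P'.1, P.2) < δ := by
    rw [Prod.dist_eq, dist_self, max_eq_left dist_nonneg, Real.dist_eq]
    have := h5.trans (min_le_left _ _)
    linarith
  have e1 := H P h1 _ hm hd
  have e2 := norm_coef_sub_le (Q := Q) (mem_dom.1 h2.1) P.2 P'.2
  rw [dist_eq_norm] at e1
  calc ‖Q.coef P - Q.coef P'‖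
      = ‖(Q.coef P - Q.coef (P'.1, P.2)) + (Q.coef (P'.1, P.2) - Q.coef (P'.1, P'.2))‖ := by
        congr 1; simp
    _ ≤ _ := (norm_add_le _ _).trans (add_le_add e1.le e2)

theorem op_comparison_le {P P' p : ℝ × En n} (hp : p ∈ Q.dom) {y y' α ε : ℝ} {β : En n}
    {q₁ q₂ Ψ : ℝ × En n →L[ℝ] ℝ} {X₁ X₂ Z : ℝ × En n →L[ℝ] ℝ × En n →L[ℝ] ℝ} 
    (hsup : 0 ≤ Q.op P' y' (linForm α β - q₂) (-X₂))
    (hsub : Q.op P y (linForm α β + q₁ + Ψ) (X₁ + Z) ≤ 0)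
    (hX : ∀ h k : En n, X₁ (0, h) (0, h) + X₂ (0, k) (0, k) ≤ ‖h - k‖ ^ 2 / ε) {η : ℝ}
    (hf : ∀ y z, |Q.f P.1 P.2 y z - Q.f p.1 p.2 y z| ≤ η)
    (hf' : ∀ y z, |Q.f P'.1 P'.2 y z - Q.f p.1 p.2 y z| ≤ η) :
    0 ≤ -Q.lin P Ψ Z + (q₁ (1, Q.a P.1 P.2) + q₂ (1, Q.a P'.1 P'.2)
      + inner ℝ β (Q.a P.1 P.2 - Q.a P'.1 P'.2)
      + 1 / 2 * ∑ k, ‖Q.col P k - Q.col P' k‖ ^ 2 / ε + 2 * η)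
      + Q.kf * (|y - y'| + ‖(WithLp.toLp 2 fun k => Ψ (0, Q.col P k) + (q₁ (0, Q.col P k)
        + q₂ (0, Q.col P' k) + inner ℝ β (Q.col P k - Q.col P' k)) : Ed d)‖) := by
  have e : Q.sg P (linForm α β + q₁ + Ψ) - Q.sg P' (linForm α β - q₂)
      = WithLp.toLp 2 fun k => Ψ (0, Q.col P k) + (q₁ (0, Q.col P k)
        + q₂ (0, Q.col P' k) + inner ℝ β (Q.col P k - Q.col P' k)) := by
    ext k
    simp [sg, linForm_apply, inner_sub_right]
    ring
  rw [← e]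
  have h1 := (abs_le.1 (Q.hfLip p.1 (mem_dom.1 hp) p.2 y' y (Q.sg P' (linForm α β - q₂))
    (Q.sg P (linForm α β + q₁ + Ψ)))).2
  have h2 := (abs_le.1 (hf y (Q.sg P (linForm α β + q₁ + Ψ)))).2
  have h3 := (abs_le.1 (hf' y' (Q.sg P' (linForm α β - q₂)))).1
  have h4 : ∑ k, (X₁ (0, Q.col P k) (0, Q.col P k) + X₂ (0, Q.col P' k) (0, Q.col P' k))
      ≤ ∑ k, ‖Q.col P k - Q.col P' k‖ ^ 2 / ε := Finset.sum_le_sum fun k _ => hX _ _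
  have split : ∀ (q : ℝ × En n →L[ℝ] ℝ) (w : En n), q (1, w) = q (1, 0) + q (0, w) := by
    intro q w
    rw [← map_add]; simp
  rw [split q₁, split q₂, inner_sub_right]
  simp only [op, lin, _root_.add_apply, _root_.sub_apply, _root_.neg_apply, linForm_apply,
    inner_zero_right, Finset.sum_add_distrib, Finset.sum_neg_distrib] at *
  linarith

end QVI

/-- Convergence of values and of the penalization at an approximate maximum of a sum of two
upper semicontinuous functions. -/
theorem tendsto_of_sum_ge {ι : Type*} {l : Filter ι} {A B N e : ι → ℝ} {a b : ℝ}
    (hA : ∀ η > 0, ∀ᶠ i in l, A i < a + η) (hB : ∀ η > 0, ∀ᶠ i in l, B i < b + η)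
    (hN : ∀ i, 0 ≤ N i) (he : Tendsto e l (𝓝 0)) (h : ∀ i, a + b - e i ≤ A i + B i - N i) :
    Tendsto A l (𝓝 a) ∧ Tendsto B l (𝓝 b) ∧ Tendsto N l (𝓝 0) := by
  have key : ∀ η > 0, ∀ᶠ i in l, |A i - a| < η ∧ |B i - b| < η ∧ |N i| < η := by
    intro η hη
    filter_upwards [hA (η / 4) (by positivity), hB (η / 4) (by positivity),
      he.eventually (eventually_lt_nhds (show (0 : ℝ) < η / 4 by positivity))] with i h1 h2 h3
    have := h i
    have := hN i
    refine ⟨abs_lt.2 ⟨?_, ?_⟩, abs_lt.2 ⟨?_, ?_⟩, abs_lt.2 ⟨?_, ?_⟩⟩ <;> linarith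
  refine ⟨Metric.tendsto_nhds.2 fun η hη => ?_, Metric.tendsto_nhds.2 fun η hη => ?_,
    Metric.tendsto_nhds.2 fun η hη => ?_⟩ <;> filter_upwards [key η hη] with i hi
  · exact hi.1
  · exact hi.2.1
  · simpa [Real.dist_eq] using hi.2.2

namespace QVI

variable {n d : ℕ} {U : Type} [MetricSpace U] [CompactSpace U] [Nonempty U] {Q : QVI n d U}

theorem nhdsWithin_cap {p P : ℝ × En n} {r : ℝ} (h : dist P p < r) :
    𝓝[Q.dom ∩ Metric.closedBall p r] P = 𝓝[Q.dom] P :=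
  nhdsWithin_inter_of_mem' (mem_nhdsWithin_of_mem_nhds (mem_of_superset
    (Metric.isOpen_ball.mem_nhds h) Metric.ball_subset_closedBall))

theorem doubling_limit {u v : ℝ × En n → ℝ} (hu : Q.JSub u) (hv : Q.JSuper v) {p : ℝ × En n}
    (hp : p ∈ Q.dom) (hpT : p.1 < Q.T) (hM : Q.M u p < u p) {Φ : ℝ × En n → ℝ}
    {Φ' : ℝ × En n → ℝ × En n →L[ℝ] ℝ} {Φ'' : ℝ × En n → ℝ × En n →L[ℝ] ℝ × En n →L[ℝ] ℝ}
    (hΦ : ∀ z, HasJet Φ z (Φ' z) (Φ'' z)) (hc' : Continuous Φ') (hc'' : Continuous Φ'')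
    {r : ℝ} (hr : 0 < r)
    (hlt : ∀ z ∈ Q.dom, z ∈ Metric.closedBall p r → z ≠ p → u z - v z < Φ z)
    (heq : u p - v p = Φ p) :
    0 ≤ -Q.lin p (Φ' p) (Φ'' p) + Q.kf * (|u p - v p| + ‖Q.sg p (Φ' p)‖) := by
  set K := Q.dom ∩ Metric.closedBall p r with hKd
  have hK : IsCompact K := isCompact_cap p r
  have hpK : p ∈ K := ⟨hp, Metric.mem_closedBall_self hr.le⟩
  have hΦc : Continuous Φ := continuous_iff_continuousAt.2 fun z => (hΦ z).continuousAt
  set g₁ : ℝ × En n → ℝ := fun z => u z + -Φ z with hg₁d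
  set g₂ : ℝ × En n → ℝ := fun z => -v z with hg₂d
  have hg₁ : UpperSemicontinuousOn g₁ K :=
    (hu.1.mono inter_subset_left).add hΦc.neg.continuousOn.upperSemicontinuousOn
  have hg₂ : UpperSemicontinuousOn g₂ K := by
    intro z hz c hc
    filter_upwards [(hv.1.mono inter_subset_left) z hz (-c) (by simp only [hg₂d] at hc; linarith)]
      with w hw
    simp only [hg₂d]; linarith
  obtain ⟨z₁, -, hm₁⟩ := hg₁.exists_isMaxOn ⟨p, hpK⟩ hK
  obtain ⟨z₂, -, hm₂⟩ := hg₂.exists_isMaxOn ⟨p, hpK⟩ hK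
  set ε : ℕ → ℝ := fun k => 1 / ((k : ℝ) + 1) with hεd
  have hε0 : ∀ k, 0 < ε k := fun k => by simp only [hεd]; positivity
  have hε1 : ∀ k, ε k ≤ 1 := fun k => by
    simp only [hεd]
    rw [div_le_one (by positivity)]
    linarith [Nat.cast_nonneg (α := ℝ) k]
  have hεl : Tendsto ε (hyperfilter ℕ) (𝓝 0) :=
    tendsto_one_div_add_atTop_nhds_zero_nat.mono_left Nat.hyperfilter_le_atTop
  choose P P' α β q₁ q₂ X₁ X₂ N hPK hPK' hN hmax h5 h6 h7 hq₁ hq₂ hj₁ hj₂ hX hcoef using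
    fun k => exists_doubling hp hr hg₁ hg₂ (hε0 k) (hε1 k)
  have hpval : g₁ p + g₂ p = 0 := by simp only [hg₁d, hg₂d]; linarith
  set B := g₁ z₁ + g₂ z₂ + 1 with hB
  have hNB : ∀ k, N k ≤ B := by
    intro k
    have a1 := hmax k p hpK
    have a2 := hm₁ (hPK k)
    have a3 := hm₂ (hPK' k)
    have a4 := hε1 k
    simp only [mem_ofPred_eq] at a2 a3
    linarith
  have hd : Tendsto (fun k => ‖(P k).2 - (P' k).2‖) (hyperfilter ℕ) (𝓝 0) := by
    have h0 : Tendsto (fun k => √(12 * ε k * B)) (hyperfilter ℕ) (𝓝 0) := by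
      have := ((hεl.const_mul 12).mul_const B).sqrt
      simpa using this
    refine squeeze_zero (fun k => norm_nonneg _) (fun k => Real.le_sqrt_of_sq_le ?_) h0
    refine (h6 k).trans ?_
    have := hε0 k
    have := hNB k
    gcongr
  have hsub : Tendsto (fun k => P' k - P k) (hyperfilter ℕ) (𝓝 0) := by
    have a1 : Tendsto (fun k => (P' k - P k).1) (hyperfilter ℕ) (𝓝 0) := by
      refine squeeze_zero_norm (fun k => ?_) hεl
      rw [Prod.fst_sub, Real.norm_eq_abs, abs_sub_comm]
      exact h5 k
    have a2 : Tendsto (fun k => (P' k - P k).2) (hyperfilter ℕ) (𝓝 0) := by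
      refine squeeze_zero_norm (fun k => ?_) hd
      rw [Prod.snd_sub, norm_sub_rev]
    exact a1.prodMk_nhds a2
  obtain ⟨ph, hphK, hph⟩ : ∃ x ∈ K, Tendsto P (hyperfilter ℕ) (𝓝 x) :=
    hK.ultrafilter_le_nhds ((hyperfilter ℕ).map P) 
      (le_principal_iff.2 (show ∀ᶠ k in hyperfilter ℕ, P k ∈ K from Eventually.of_forall hPK))
  have hph' : Tendsto P' (hyperfilter ℕ) (𝓝 ph) := by
    have := hph.add hsub
    simpa using this
  have hwK : Tendsto P (hyperfilter ℕ) (𝓝[K] ph) :=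
    tendsto_nhdsWithin_iff.2 ⟨hph, Eventually.of_forall hPK⟩
  have hwK' : Tendsto P' (hyperfilter ℕ) (𝓝[K] ph) :=
    tendsto_nhdsWithin_iff.2 ⟨hph', Eventually.of_forall hPK'⟩
  have hA : ∀ η > 0, ∀ᶠ k in hyperfilter ℕ, g₁ (P k) < g₁ ph + η := fun η hη =>
    hwK.eventually (hg₁ ph hphK _ (by linarith))
  have hB' : ∀ η > 0, ∀ᶠ k in hyperfilter ℕ, g₂ (P' k) < g₂ ph + η := fun η hη =>
    hwK'.eventually (hg₂ ph hphK _ (by linarith))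
  obtain rfl : ph = p := by
    by_contra hne
    have hneg := hlt ph hphK.1 hphK.2 hne
    set η := (Φ ph - (u ph - v ph)) / 3 with hη
    have hη0 : 0 < η := by rw [hη]; linarith
    obtain ⟨k, a1, a2, a3⟩ := ((hA η hη0).and ((hB' η hη0).and
      (hεl.eventually (eventually_lt_nhds hη0)))).exists
    have := hmax k p hpK
    have := hN k
    simp only [hg₁d, hg₂d] at *
    linarith
  obtain ⟨hAl, hBl, hNl⟩ := tendsto_of_sum_ge hA hB' hN hεl (fun k => hmax k ph hpK)
  have hΦl : Tendsto (fun k => Φ (P k)) (hyperfilter ℕ) (𝓝 (Φ ph)) := (hΦc.tendsto ph).comp hph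
  have hul : Tendsto (fun k => u (P k)) (hyperfilter ℕ) (𝓝 (u ph)) := by
    have := hAl.add hΦl
    simpa [hg₁d] using this
  have hvl : Tendsto (fun k => v (P' k)) (hyperfilter ℕ) (𝓝 (v ph)) := by
    have := hBl.neg
    simpa [hg₂d] using this
  have hdom : ∀ᶠ k in hyperfilter ℕ, P k ∈ Q.dom := Eventually.of_forall fun k => (hPK k).1
  have hdom' : ∀ᶠ k in hyperfilter ℕ, P' k ∈ Q.dom := Eventually.of_forall fun k => (hPK' k).1
  have hcP : Tendsto (fun k => Q.coef (P k)) (hyperfilter ℕ) (𝓝 (Q.coef ph)) :=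
    tendsto_of_continuousOn_dom continuousOn_coef hp hdom hph
  have hcP' : Tendsto (fun k => Q.coef (P' k)) (hyperfilter ℕ) (𝓝 (Q.coef ph)) :=
    tendsto_of_continuousOn_dom continuousOn_coef hp hdom' hph'
  have haP : Tendsto (fun k => Q.a (P k).1 (P k).2) (hyperfilter ℕ) (𝓝 (Q.a ph.1 ph.2)) :=
    (continuous_fst.tendsto _).comp hcP
  have haP' : Tendsto (fun k => Q.a (P' k).1 (P' k).2) (hyperfilter ℕ) (𝓝 (Q.a ph.1 ph.2)) :=
    (continuous_fst.tendsto _).comp hcP'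
  have hcolP : ∀ j, Tendsto (fun k => Q.col (P k) j) (hyperfilter ℕ) (𝓝 (Q.col ph j)) := fun j =>
    (((continuous_apply j).comp continuous_snd).tendsto _).comp hcP
  have hcolP' : ∀ j, Tendsto (fun k => Q.col (P' k) j) (hyperfilter ℕ) (𝓝 (Q.col ph j)) := fun j =>
    (((continuous_apply j).comp continuous_snd).tendsto _).comp hcP'
  set D : ℕ → ℝ := fun k => ‖Q.coef (P k) - Q.coef (P' k)‖ ^ 2 / ε k with hD
  have hDl : Tendsto D (hyperfilter ℕ) (𝓝 0) := by
    have h0 : Tendsto (fun k => 2 * ε k + 24 * Q.kaσ ^ 2 * N k) (hyperfilter ℕ) (𝓝 0) := by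
      have := (hεl.const_mul 2).add (hNl.const_mul (24 * Q.kaσ ^ 2))
      simpa using this
    refine squeeze_zero (fun k => by have := hε0 k; simp only [hD]; positivity) (fun k => ?_) h0
    have e0 := hε0 k
    have e1 := hcoef k
    have e2 := mul_le_mul_of_nonneg_left (h6 k) (sq_nonneg Q.kaσ)
    rw [hD, div_le_iff₀ e0]
    have e3 : ‖Q.coef (P k) - Q.coef (P' k)‖ ^ 2 ≤ (ε k + Q.kaσ * ‖(P k).2 - (P' k).2‖) ^ 2 := by
      gcongr
    nlinarith [sq_nonneg (ε k - Q.kaσ * ‖(P k).2 - (P' k).2‖)]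
  have hinner : ∀ w : ℕ → En n, (∀ k, ‖w k‖ ≤ ‖Q.coef (P k) - Q.coef (P' k)‖) →
      Tendsto (fun k => (inner ℝ (β k) (w k) : ℝ)) (hyperfilter ℕ) (𝓝 0) := by
    intro w hw
    have h0 : Tendsto (fun k => √(4 * N k * D k)) (hyperfilter ℕ) (𝓝 0) := by
      have := ((hNl.const_mul 4).mul hDl).sqrt
      simpa using this
    refine squeeze_zero_norm (fun k => Real.le_sqrt_of_sq_le ?_) h0
    have e0 := hε0 k
    have e1 : ‖(inner ℝ (β k) (w k) : ℝ)‖ ≤ ‖β k‖ * ‖Q.coef (P k) - Q.coef (P' k)‖ :=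
      (norm_inner_le_norm _ _).trans (by gcongr; exact hw k)
    calc _ ≤ (‖β k‖ * ‖Q.coef (P k) - Q.coef (P' k)‖) ^ 2 := by gcongr
      _ = (ε k * ‖β k‖ ^ 2) * D k := by simp only [hD]; field_simp
      _ ≤ 4 * N k * D k := by
        refine mul_le_mul_of_nonneg_right (h7 k) ?_
        simp only [hD]; positivity
  have hia := hinner (fun k => Q.a (P k).1 (P k).2 - Q.a (P' k).1 (P' k).2)
    (fun k => norm_fst_le (Q.coef (P k) - Q.coef (P' k)))
  have hcolle : ∀ j k, ‖Q.col (P k) j - Q.col (P' k) j‖ ≤ ‖Q.coef (P k) - Q.coef (P' k)‖ :=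
    fun j k => (norm_le_pi_norm (Q.coef (P k) - Q.coef (P' k)).2 j).trans (norm_snd_le _)
  have hic : ∀ j, Tendsto (fun k => (inner ℝ (β k) (Q.col (P k) j - Q.col (P' k) j) : ℝ))
      (hyperfilter ℕ) (𝓝 0) := fun j => hinner _ (hcolle j)
  have hcq : ∀ j, Tendsto (fun k => ‖Q.col (P k) j - Q.col (P' k) j‖ ^ 2 / ε k)
      (hyperfilter ℕ) (𝓝 0) := by
    intro j
    refine squeeze_zero (fun k => by have := hε0 k; positivity) (fun k => ?_) hDl
    have := hε0 k
    have := hcolle j k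
    simp only [hD]
    gcongr
  have hq₁l : Tendsto q₁ (hyperfilter ℕ) (𝓝 0) := squeeze_zero_norm hq₁ hεl
  have hq₂l : Tendsto q₂ (hyperfilter ℕ) (𝓝 0) := squeeze_zero_norm hq₂ hεl
  have hΦ'l : Tendsto (fun k => Φ' (P k)) (hyperfilter ℕ) (𝓝 (Φ' ph)) := (hc'.tendsto ph).comp hph
  have hΦ''l : Tendsto (fun k => Φ'' (P k)) (hyperfilter ℕ) (𝓝 (Φ'' ph)) :=
    (hc''.tendsto ph).comp hph
  have hw : ∀ {c : ℝ} {w : ℕ → En n} {w₀ : En n}, Tendsto w (hyperfilter ℕ) (𝓝 w₀) →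
      Tendsto (fun k => ((c, w k) : ℝ × En n)) (hyperfilter ℕ) (𝓝 (c, w₀)) :=
    fun h => tendsto_const_nhds.prodMk_nhds h
  obtain ⟨c, hc1, hc2⟩ := exists_between hM
  refine le_of_forall_pos_le_add fun η hη => ?_
  obtain ⟨s, hs, hfs⟩ := Q.hfc (η / 2) (half_pos hη) ph hp
  have hev : ∀ᶠ k in hyperfilter ℕ, 0 ≤ -Q.lin (P k) (Φ' (P k)) (Φ'' (P k))
      + (q₁ k (1, Q.a (P k).1 (P k).2) + q₂ k (1, Q.a (P' k).1 (P' k).2)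
      + inner ℝ (β k) (Q.a (P k).1 (P k).2 - Q.a (P' k).1 (P' k).2)
      + 1 / 2 * ∑ j, ‖Q.col (P k) j - Q.col (P' k) j‖ ^ 2 / ε k + 2 * (η / 2))
      + Q.kf * (|u (P k) - v (P' k)| + ‖(WithLp.toLp 2 fun j => Φ' (P k) (0, Q.col (P k) j)
        + (q₁ k (0, Q.col (P k) j) + q₂ k (0, Q.col (P' k) j)
        + inner ℝ (β k) (Q.col (P k) j - Q.col (P' k) j)) : Ed d)‖) := by
    have hball : ∀ s > 0, ∀ᶠ z in 𝓝 ph, dist z ph < s := fun s hs => Metric.ball_mem_nhds ph hs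
    have hT : ∀ᶠ z : ℝ × En n in 𝓝 ph, z.1 < Q.T :=
      (continuous_fst.tendsto ph).eventually (eventually_lt_nhds hpT)
    have hwd : Tendsto P (hyperfilter ℕ) (𝓝[Q.dom] ph) := tendsto_nhdsWithin_iff.2 ⟨hph, hdom⟩
    filter_upwards [hph.eventually (hball r hr), hph'.eventually (hball r hr), hph.eventually hT,
      hph'.eventually hT, hph.eventually (hball s hs), hph'.eventually (hball s hs),
      hwd.eventually (upperSemicontinuousOn_M hu.1 ph hp c hc1),
      hul.eventually (eventually_gt_nhds hc2)] with k a1 a2 a3 a4 a5 a6 a7 a8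
    have j₁ := ((hj₁ k).mono_nhds (nhdsWithin_cap a1).ge).add_hasJet (hΦ (P k))
    have j₂ := (hj₂ k).mono_nhds (nhdsWithin_cap a2).ge
    have j₁' : SupJet Q.dom u (P k) (linForm (α k) (β k) + q₁ k + Φ' (P k)) (X₁ k + Φ'' (P k)) := by
      simpa [hg₁d] using j₁
    have j₂' : SupJet Q.dom (fun z => -v z) (P' k) (-(linForm (α k) (β k) - q₂ k)) (-(-X₂ k)) := by
      have e : -(-X₂ k) = X₂ k := neg_neg (G := ℝ × En n →L[ℝ] ℝ × En n →L[ℝ] ℝ) (X₂ k)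
      rw [e, neg_sub, sub_eq_neg_add]
      exact j₂
    have o₁ := (hu.2.2 _ (hPK k).1 a3 _ _ j₁').resolve_left (by linarith)
    have o₂ := (hv.2.2 _ (hPK' k).1 a4 _ _ j₂').2
    exact op_comparison_le hp o₂ o₁ (hX k) (fun y z => hfs _ (hPK k).1 a5.le y z)
      (fun y z => hfs _ (hPK' k).1 a6.le y z)
  refine le_trans (ge_of_tendsto ?_ hev) (le_refl _)
  have t1 : Tendsto (fun k => Q.lin (P k) (Φ' (P k)) (Φ'' (P k))) (hyperfilter ℕ)
      (𝓝 (Q.lin ph (Φ' ph) (Φ'' ph))) := by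
    unfold lin
    refine ((tendsto_clm_apply hΦ'l tendsto_const_nhds).neg.sub
      (tendsto_clm_apply hΦ'l (hw haP))).sub (Tendsto.const_mul _ (tendsto_finsetSum _ ?_))
    intro j _
    exact tendsto_clm_apply (tendsto_clm_apply hΦ''l (hw (hcolP j))) (hw (hcolP j))
  have t2 := (((tendsto_clm_apply hq₁l (hw (c := 1) haP)).add
    (tendsto_clm_apply hq₂l (hw (c := 1) haP'))).add hia).add
    ((tendsto_finsetSum Finset.univ fun j _ => hcq j).const_mul (1 / 2))
  have t3 : Tendsto (fun k => (WithLp.toLp 2 fun j => Φ' (P k) (0, Q.col (P k) j)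
        + (q₁ k (0, Q.col (P k) j) + q₂ k (0, Q.col (P' k) j)
        + inner ℝ (β k) (Q.col (P k) j - Q.col (P' k) j)) : Ed d)) (hyperfilter ℕ)
      (𝓝 (Q.sg ph (Φ' ph))) := by
    refine ((PiLp.continuous_toLp 2 _).tendsto _).comp (tendsto_pi_nhds.2 fun j => ?_)
    have := (tendsto_clm_apply hΦ'l (hw (c := 0) (hcolP j))).add
      (((tendsto_clm_apply hq₁l (hw (c := 0) (hcolP j))).add
      (tendsto_clm_apply hq₂l (hw (c := 0) (hcolP' j)))).add (hic j))
    simpa using this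
  have := (t1.neg.add (t2.add_const (2 * (η / 2)))).add
    ((((hul.sub hvl).abs).add t3.norm).const_mul Q.kf)
  refine this.trans_eq ?_
  congr 1
  simp
  ring

end QVI

theorem continuous_add_form {α E : Type*} [TopologicalSpace α] [NormedAddCommGroup E]
    [NormedSpace ℝ E] {f g : α → E →L[ℝ] E →L[ℝ] ℝ} (hf : Continuous f) (hg : Continuous g) :
    Continuous fun x => f x + g x := by
  have key : ∀ {F : Type _} [SeminormedAddCommGroup F] {f g : α → F}, Continuous f →
      Continuous g → Continuous fun x => f x + g x := fun hf hg => hf.add hg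
  exact key (F := E →L[ℝ] E →L[ℝ] ℝ) hf hg

section PositivePart

theorem hasDerivAt_posPart_pow (k : ℕ) (a : ℝ) :
    HasDerivAt (fun s : ℝ => max s 0 ^ (k + 2)) (((k : ℝ) + 2) * max a 0 ^ (k + 1)) a := by
  rcases lt_trichotomy a 0 with ha | rfl | ha
  · rw [max_eq_right ha.le, zero_pow (by omega), mul_zero]
    refine (hasDerivAt_const a (0 : ℝ)).congr_of_eventuallyEq ?_
    filter_upwards [eventually_lt_nhds ha] with s hs
    rw [max_eq_right hs.le, zero_pow (by omega)]
  · rw [max_self, zero_pow (by omega), mul_zero, hasDerivAt_iff_isLittleO_nhds_zero]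
    have h1 : (fun h : ℝ => max (0 + h) 0 ^ (k + 2) - max (0 : ℝ) 0 ^ (k + 2) - h • (0 : ℝ))
        = fun h => max h 0 ^ (k + 2) := by
      funext h
      simp
    rw [h1]
    have h2 : (fun h : ℝ => h ^ (k + 2)) =o[𝓝 0] fun h => h := by
      simpa using (Asymptotics.isLittleO_pow_pow (𝕜 := ℝ) (show 1 < k + 2 by omega))
    refine Asymptotics.IsBigO.trans_isLittleO (Asymptotics.IsBigO.of_bound 1
      (Eventually.of_forall fun h => ?_)) h2
    rw [one_mul, norm_pow, norm_pow]
    gcongr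
    rw [Real.norm_eq_abs, Real.norm_eq_abs, abs_of_nonneg (le_max_right h 0)]
    exact max_le (le_abs_self h) (abs_nonneg h)
  · rw [max_eq_left ha.le]
    have := hasDerivAt_pow (k + 2) a
    push_cast at this
    refine this.congr_of_eventuallyEq ?_
    filter_upwards [eventually_gt_nhds ha] with s hs
    rw [max_eq_left hs.le]

theorem taylor_of_hasDerivAt {θ θ' : ℝ → ℝ} {b c : ℝ} (h : ∀ s, HasDerivAt θ (θ' s) s)
    (h' : HasDerivAt θ' c b) :
    (fun s : ℝ => θ (b + s) - θ b - θ' b * s - 1 / 2 * c * s ^ 2) =o[𝓝 0] fun s : ℝ => s ^ 2 := by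
  have h1 : ∀ z : ℝ, HasFDerivAt θ (θ' z • ContinuousLinearMap.id ℝ ℝ) z := by
    intro z
    refine (h z).hasFDerivAt.congr_fderiv ?_
    ext
    simp
  have h2 := hasJet_of_hasFDerivAt (Eventually.of_forall h1)
    (h'.smul_const (ContinuousLinearMap.id ℝ ℝ)).hasFDerivAt
  rw [HasJet] at h2
  refine Asymptotics.IsLittleO.congr h2 (fun s => ?_) (fun s => ?_)
  · simp
    ring
  · simp

theorem posPart_pow_taylor (m : ℕ) (c b : ℝ) :
    (fun s : ℝ => (1 + max (b + s - c) 0 ^ (m + 3)) - (1 + max (b - c) 0 ^ (m + 3))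
      - ((m + 3 : ℝ) * max (b - c) 0 ^ (m + 2)) * s
      - 1 / 2 * ((m + 3 : ℝ) * (m + 2) * max (b - c) 0 ^ (m + 1)) * s ^ 2)
      =o[𝓝 0] fun s : ℝ => s ^ 2 := by
  have h1 : ∀ s : ℝ, HasDerivAt (fun s : ℝ => 1 + max (s - c) 0 ^ (m + 3))
      ((m + 3 : ℝ) * max (s - c) 0 ^ (m + 2)) s := by
    intro s
    have := ((hasDerivAt_posPart_pow (m + 1) (s - c)).comp_sub_const s c).const_add 1
    push_cast at this
    rwa [show (m : ℝ) + 1 + 2 = m + 3 by ring] at this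
  have h2 := ((hasDerivAt_posPart_pow m (b - c)).comp_sub_const b c).const_mul (m + 3 : ℝ)
  rw [← mul_assoc] at h2
  exact taylor_of_hasDerivAt h1 h2

end PositivePart

namespace QVI

variable {n d : ℕ} {U : Type} [MetricSpace U] [CompactSpace U] [Nonempty U] (Q : QVI n d U)

/-- A smooth function of the space variable, bounded below by one, on which every term of the
operator is controlled by the function itself. -/
structure Penalty (H : ℝ × En n → ℝ) (H' : ℝ × En n → ℝ × En n →L[ℝ] ℝ)
    (H'' : ℝ × En n → ℝ × En n →L[ℝ] ℝ × En n →L[ℝ] ℝ) (C : ℝ) : Prop where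
  jet : ∀ z, HasJet H z (H' z) (H'' z)
  cont' : Continuous H'
  cont'' : Continuous H''
  time : ∀ z, H' z (1, 0) = 0
  one_le : ∀ z, 1 ≤ H z
  nonneg : 0 ≤ C
  drift : ∀ z ∈ Q.dom, |H' z (0, Q.a z.1 z.2)| ≤ C * H z
  diff : ∀ z ∈ Q.dom, |∑ k, H'' z (0, Q.col z k) (0, Q.col z k)| ≤ C * H z
  grad : ∀ z ∈ Q.dom, ‖Q.sg z (H' z)‖ ≤ C * H z

/-- The penalization `1 + ((|x - x₀|² - c)⁺)^(m+3)`. -/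
def pen (m : ℕ) (c : ℝ) (x₀ : En n) (z : ℝ × En n) : ℝ :=
  1 + max (‖z.2 - x₀‖ ^ 2 - c) 0 ^ (m + 3)

/-- The bilinear form `2 ⟪h₂, k₂⟫`. -/
def spForm (n : ℕ) : ℝ × En n →L[ℝ] ℝ × En n →L[ℝ] ℝ :=
  parForm n - (2 : ℝ) • dualProd (ContinuousLinearMap.fst ℝ ℝ (En n))
    (ContinuousLinearMap.fst ℝ ℝ (En n))

theorem spForm_apply (h k : ℝ × En n) : spForm n h k = 2 * inner ℝ h.2 k.2 := by
  rw [spForm, _root_.sub_apply, _root_.sub_apply, _root_.smul_apply, _root_.smul_apply,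
    parForm_apply, dualProd_apply]
  simp
  ring

variable {Q}

theorem posPart_bounds (m : ℕ) {w : ℝ} (hw : 0 ≤ w) :
    w ^ (m + 2) * (1 + w) ≤ 2 * (1 + w ^ (m + 3)) ∧
      w ^ (m + 1) * (1 + w) ^ 2 ≤ 4 * (1 + w ^ (m + 3)) := by
  rcases le_total w 1 with h | h
  · have h1 : w ^ (m + 2) ≤ 1 := pow_le_one₀ hw h
    have h2 : w ^ (m + 1) ≤ 1 := pow_le_one₀ hw h
    have h3 : 0 ≤ w ^ (m + 3) := by positivity
    constructor
    · calc w ^ (m + 2) * (1 + w) ≤ 1 * (1 + 1) := by gcongr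
        _ ≤ _ := by linarith
    · calc w ^ (m + 1) * (1 + w) ^ 2 ≤ 1 * (1 + 1) ^ 2 := by gcongr
        _ ≤ _ := by linarith
  · constructor
    · calc w ^ (m + 2) * (1 + w) ≤ w ^ (m + 2) * (w + w) := by gcongr
        _ = 2 * w ^ (m + 3) := by ring
        _ ≤ _ := by linarith
    · calc w ^ (m + 1) * (1 + w) ^ 2 ≤ w ^ (m + 1) * (w + w) ^ 2 := by gcongr
        _ = 4 * w ^ (m + 3) := by ring
        _ ≤ _ := by linarith

theorem norm_sg_le (z : ℝ × En n) (q : ℝ × En n →L[ℝ] ℝ) {B : ℝ}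
    (h : ∀ k, |q (0, Q.col z k)| ≤ B) : ‖Q.sg z q‖ ≤ d * B := by
  have h1 : ‖Q.sg z q‖ ≤ ∑ k, |q (0, Q.col z k)| := by
    rw [EuclideanSpace.norm_eq]
    refine Real.sqrt_le_iff.2 ⟨Finset.sum_nonneg fun _ _ => abs_nonneg _, ?_⟩
    refine le_trans (Finset.sum_le_sum (g := fun k => |q (0, Q.col z k)| ^ 2) fun k _ => le_rfl) ?_
    exact Finset.sum_sq_le_sq_sum_of_nonneg (fun k _ => abs_nonneg _)
  refine h1.trans ((Finset.sum_le_sum fun k _ => h k).trans_eq ?_)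
  simp

theorem exists_penalty (m : ℕ) {c : ℝ} (hc : 0 ≤ c) (x₀ : En n) :
    ∃ H' H'' C, Q.Penalty (pen m c x₀) H' H'' C := by
  set N : ℝ × En n → ℝ := quadPoly 0 (0, x₀) 0 (spForm n) with hN
  have hNe : ∀ z, N z = ‖z.2 - x₀‖ ^ 2 := by
    intro z
    rw [hN, quadPoly, spForm_apply, Prod.snd_sub, real_inner_self_eq_norm_sq]
    simp
  set w : ℝ × En n → ℝ := fun z => max (‖z.2 - x₀‖ ^ 2 - c) 0 with hw
  have hw0 : ∀ z, 0 ≤ w z := fun z => le_max_right _ _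
  have hwc : Continuous w := by rw [hw]; fun_prop
  set b : ℝ × En n → ℝ := fun z => (m + 3 : ℝ) * w z ^ (m + 2) with hb
  set e : ℝ × En n → ℝ := fun z => (m + 3 : ℝ) * (m + 2) * w z ^ (m + 1) with he
  set G : ℝ × En n → ℝ × En n →L[ℝ] ℝ := fun z => 0 + spForm n (z - (0, x₀)) with hG
  have hGc : Continuous G := by rw [hG]; fun_prop
  have hGa : ∀ z k, G z k = 2 * inner ℝ (z.2 - x₀) k.2 := by
    intro z k
    simp only [hG, zero_add, spForm_apply, Prod.snd_sub]
  have hdp : Continuous fun z => dualProd (G z) (G z) := by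
    unfold dualProd
    exact (ContinuousLinearMap.smulRightL ℝ (ℝ × En n) (ℝ × En n →L[ℝ] ℝ)).continuous₂.comp
      (hGc.prodMk hGc)
  set K := Q.Caσ * (1 + ‖x₀‖) with hK
  have hK0 : 0 ≤ K := mul_nonneg Q.hCaσ.le (by positivity)
  have hlin : ∀ z : ℝ × En n, Q.Caσ * (1 + ‖z.2‖) ≤ K * (1 + ‖z.2 - x₀‖) := by
    intro z
    rw [hK, mul_assoc]
    refine mul_le_mul_of_nonneg_left ?_ Q.hCaσ.le
    have : ‖z.2‖ ≤ ‖z.2 - x₀‖ + ‖x₀‖ := by simpa using norm_add_le (z.2 - x₀) x₀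
    nlinarith [norm_nonneg (z.2 - x₀), norm_nonneg x₀]
  set C₀ := (m + 3 : ℝ) * (2 * (K * (2 * (1 + c)))) * 2 with hC₀
  set C₁ := (m + 3 : ℝ) * (2 * (K ^ 2 * (2 * (1 + c)))) * 2
    + (m + 3 : ℝ) * (m + 2) * (4 * (K ^ 2 * (4 * (1 + c) ^ 2))) * 4 with hC₁
  have hC₀0 : 0 ≤ C₀ := by positivity
  have hC₁0 : 0 ≤ C₁ := by positivity
  have hr : ∀ z : ℝ × En n, (1 + ‖z.2 - x₀‖) ^ 2 ≤ 2 * (1 + c) * (1 + w z) := by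
    intro z
    have h1 : ‖z.2 - x₀‖ ^ 2 - c ≤ w z := le_max_left _ _
    have := hw0 z
    nlinarith [sq_nonneg (1 - ‖z.2 - x₀‖), mul_nonneg hc this]
  have hH : ∀ z : ℝ × En n, pen m c x₀ z = 1 + w z ^ (m + 3) := fun z => rfl
  have hb1 : ∀ (z : ℝ × En n) (h : En n), ‖h‖ ≤ K * (1 + ‖z.2 - x₀‖) →
      |(b z • G z) (0, h)| ≤ C₀ * pen m c x₀ z := by
    intro z h hh
    have h0 := hw0 z
    have h1 : |(inner ℝ (z.2 - x₀) h : ℝ)| ≤ K * (2 * (1 + c) * (1 + w z)) := by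
      refine (abs_real_inner_le_norm _ _).trans ?_
      calc ‖z.2 - x₀‖ * ‖h‖ ≤ (1 + ‖z.2 - x₀‖) * (K * (1 + ‖z.2 - x₀‖)) := by
            gcongr; linarith
        _ = K * (1 + ‖z.2 - x₀‖) ^ 2 := by ring
        _ ≤ _ := by gcongr; exact hr z
    rw [_root_.smul_apply, hGa, smul_eq_mul, abs_mul (b z), abs_mul 2, abs_two,
      abs_of_nonneg (show 0 ≤ b z by simp only [hb]; positivity), hH]
    calc b z * (2 * |(inner ℝ (z.2 - x₀) h : ℝ)|)
        ≤ b z * (2 * (K * (2 * (1 + c) * (1 + w z)))) := by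
          have : 0 ≤ b z := by simp only [hb]; positivity
          gcongr
      _ = (m + 3 : ℝ) * (2 * (K * (2 * (1 + c)))) * (w z ^ (m + 2) * (1 + w z)) := by
          simp only [hb]; ring
      _ ≤ (m + 3 : ℝ) * (2 * (K * (2 * (1 + c)))) * (2 * (1 + w z ^ (m + 3))) := by
          exact mul_le_mul_of_nonneg_left (posPart_bounds m h0).1 (by positivity)
      _ = _ := by rw [hC₀]; ring
  have hb2 : ∀ (z : ℝ × En n) (h : En n), ‖h‖ ≤ K * (1 + ‖z.2 - x₀‖) →
      |(b z • spForm n + e z • dualProd (G z) (G z)) (0, h) (0, h)| ≤ C₁ * pen m c x₀ z := by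
    intro z h hh
    have h0 := hw0 z
    have hbz : 0 ≤ b z := by simp only [hb]; positivity
    have hez : 0 ≤ e z := by simp only [he]; positivity
    have h1 : ‖h‖ ^ 2 ≤ K ^ 2 * (2 * (1 + c) * (1 + w z)) := by
      calc ‖h‖ ^ 2 ≤ (K * (1 + ‖z.2 - x₀‖)) ^ 2 := by gcongr
        _ = K ^ 2 * (1 + ‖z.2 - x₀‖) ^ 2 := by ring
        _ ≤ _ := by gcongr; exact hr z
    have h2 : (inner ℝ (z.2 - x₀) h : ℝ) ^ 2 ≤ K ^ 2 * (4 * (1 + c) ^ 2 * (1 + w z) ^ 2) := by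
      calc (inner ℝ (z.2 - x₀) h : ℝ) ^ 2 ≤ (‖z.2 - x₀‖ * ‖h‖) ^ 2 :=
            sq_le_sq' (by linarith [(abs_le.1 (abs_real_inner_le_norm (z.2 - x₀) h)).1])
              (real_inner_le_norm _ _)
        _ ≤ ((1 + ‖z.2 - x₀‖) * (K * (1 + ‖z.2 - x₀‖))) ^ 2 := by gcongr; linarith
        _ = K ^ 2 * ((1 + ‖z.2 - x₀‖) ^ 2) ^ 2 := by ring
        _ ≤ K ^ 2 * (2 * (1 + c) * (1 + w z)) ^ 2 := by gcongr; exact hr z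
        _ = _ := by ring
    have h3 : (b z • spForm n + e z • dualProd (G z) (G z)) (0, h) (0, h)
        = b z * (2 * ‖h‖ ^ 2) + e z * (4 * (inner ℝ (z.2 - x₀) h : ℝ) ^ 2) := by
      rw [_root_.add_apply, _root_.add_apply, _root_.smul_apply, _root_.smul_apply,
        _root_.smul_apply, _root_.smul_apply, spForm_apply, dualProd_apply, hGa,
        real_inner_self_eq_norm_sq, smul_eq_mul, smul_eq_mul]
      ring
    rw [h3, abs_of_nonneg (by positivity), hH]
    calc _ ≤ b z * (2 * (K ^ 2 * (2 * (1 + c) * (1 + w z))))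
          + e z * (4 * (K ^ 2 * (4 * (1 + c) ^ 2 * (1 + w z) ^ 2))) := by gcongr
      _ = (m + 3 : ℝ) * (2 * (K ^ 2 * (2 * (1 + c)))) * (w z ^ (m + 2) * (1 + w z))
          + (m + 3 : ℝ) * (m + 2) * (4 * (K ^ 2 * (4 * (1 + c) ^ 2)))
            * (w z ^ (m + 1) * (1 + w z) ^ 2) := by
          simp only [hb, he]; ring
      _ ≤ (m + 3 : ℝ) * (2 * (K ^ 2 * (2 * (1 + c)))) * (2 * (1 + w z ^ (m + 3)))
          + (m + 3 : ℝ) * (m + 2) * (4 * (K ^ 2 * (4 * (1 + c) ^ 2)))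
            * (4 * (1 + w z ^ (m + 3))) := by
          exact add_le_add
            (mul_le_mul_of_nonneg_left (posPart_bounds m h0).1 (by positivity))
            (mul_le_mul_of_nonneg_left (posPart_bounds m h0).2 (by positivity))
      _ = _ := by rw [hC₁]; ring
  have hcol : ∀ z ∈ Q.dom, ∀ k, ‖Q.col z k‖ ≤ K * (1 + ‖z.2 - x₀‖) := by
    intro z hz k
    have h1 := Q.haσg z.1 (mem_dom.1 hz) z.2
    have h2 := norm_col_le (Q := Q) z k
    have h3 := norm_nonneg (Q.a z.1 z.2)
    linarith [hlin z]
  have hpen : ∀ z : ℝ × En n, 0 ≤ pen m c x₀ z := by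
    intro z
    have := hw0 z
    rw [hH]; positivity
  refine ⟨fun z => b z • G z, fun z => b z • spForm n + e z • dualProd (G z) (G z),
    C₀ + d * C₁ + d * C₀, ?_, ?_, ?_, ?_, ?_, by positivity, ?_, ?_, ?_⟩
  · intro z
    have hs : ∀ h k : ℝ × En n, spForm n h k = spForm n k h := by
      intro h k
      rw [spForm_apply, spForm_apply, real_inner_comm]
    have := (hasJet_quadPoly (p := ((0 : ℝ), x₀)) (q := 0) 0 hs z).comp
      (θ := fun r => 1 + max (r - c) 0 ^ (m + 3)) (posPart_pow_taylor m c (N z))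
    rw [← hN, hNe] at this
    refine (congrArg (fun g => HasJet g z _ _) (funext fun z => ?_)).mp this
    rw [hNe]; rfl
  · exact (continuous_const.mul (hwc.pow _)).smul hGc
  · have h1 : Continuous fun z => b z • spForm n :=
      (continuous_const.mul (hwc.pow _)).smul continuous_const
    have h2 : Continuous fun z => e z • dualProd (G z) (G z) :=
      (continuous_const.mul (hwc.pow _)).smul hdp
    exact continuous_add_form h1 h2
  · intro z
    rw [_root_.smul_apply, hGa]
    simp
  · intro z
    have := hw0 z
    rw [hH]
    have : 0 ≤ w z ^ (m + 3) := by positivity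
    linarith
  · intro z hz
    have h1 := Q.haσg z.1 (mem_dom.1 hz) z.2
    have h2 : 0 ≤ frob (Q.σm z.1 z.2) := Real.sqrt_nonneg _
    refine (hb1 z _ (by linarith [hlin z])).trans ?_
    refine mul_le_mul_of_nonneg_right ?_ (hpen z)
    have : 0 ≤ d * C₁ := by positivity
    have : 0 ≤ d * C₀ := by positivity
    linarith
  · intro z hz
    have h1 : |∑ k, (b z • spForm n + e z • dualProd (G z) (G z)) (0, Q.col z k) (0, Q.col z k)|
        ≤ d * (C₁ * pen m c x₀ z) := by
      refine (Finset.abs_sum_le_sum_abs _ _).trans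
        ((Finset.sum_le_sum fun k _ => hb2 z _ (hcol z hz k)).trans_eq ?_)
      simp
    refine h1.trans ?_
    rw [← mul_assoc]
    refine mul_le_mul_of_nonneg_right ?_ (hpen z)
    have : 0 ≤ d * C₀ := by positivity
    linarith
  · intro z hz
    refine (norm_sg_le z _ fun k => hb1 z _ (hcol z hz k)).trans ?_
    rw [← mul_assoc]
    refine mul_le_mul_of_nonneg_right ?_ (hpen z)
    have : 0 ≤ d * C₁ := by positivity
    linarith

end QVI

theorem Real.rpow_le_one_add_rpow {r a b : ℝ} (hr : 0 ≤ r) (ha : 0 < a) (hab : a ≤ b) :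
    r ^ a ≤ 1 + r ^ b := by
  rcases le_total r 1 with h | h
  · have := Real.rpow_le_one hr h ha.le
    have := Real.rpow_nonneg hr b
    linarith
  · have := Real.rpow_le_rpow_of_exponent_le h hab
    linarith

/-- Multiplication by a positive continuous function preserves upper semicontinuity. -/
theorem UpperSemicontinuousOn.const_mul_of_pos {α : Type*} [TopologicalSpace α] {s : Set α}
    {u c : α → ℝ} (hu : UpperSemicontinuousOn u s) (hc : ContinuousOn c s)
    (hpos : ∀ z ∈ s, 0 < c z) : UpperSemicontinuousOn (fun z => c z * u z) s := by
  intro z hz y hy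
  have h0 : u z < y / c z := by rw [lt_div_iff₀ (hpos z hz), mul_comm]; exact hy
  obtain ⟨m, h1, h2⟩ := exists_between h0
  rw [lt_div_iff₀ (hpos z hz), mul_comm] at h2
  have h3 : ∀ᶠ w in 𝓝[s] z, c w * m < y :=
    ((hc z hz).mul_const m).eventually (eventually_lt_nhds h2)
  filter_upwards [hu z hz m h1, h3, self_mem_nhdsWithin] with w a1 a2 hw
  exact (mul_le_mul_of_nonneg_left a1.le (hpos w hw).le).trans_lt a2

theorem LowerSemicontinuousOn.neg_upper {α : Type*} [TopologicalSpace α] {s : Set α}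
    {v : α → ℝ} (hv : LowerSemicontinuousOn v s) : UpperSemicontinuousOn (fun z => -v z) s := by
  intro z hz c hc
  filter_upwards [hv z hz (-c) (by linarith)] with w hw
  linarith

namespace QVI

variable {n d : ℕ} {U : Type} [MetricSpace U] [CompactSpace U] [Nonempty U] {Q : QVI n d U}

theorem hasJet_exp_time (μ : ℝ) (z : ℝ × En n) :
    HasJet (fun z : ℝ × En n => Real.exp (μ * z.1)) z
      ((μ * Real.exp (μ * z.1)) • ContinuousLinearMap.fst ℝ ℝ (En n))
      ((μ ^ 2 * Real.exp (μ * z.1)) • dualProd (ContinuousLinearMap.fst ℝ ℝ (En n))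
        (ContinuousLinearMap.fst ℝ ℝ (En n))) := by
  have h1 : ∀ s, HasDerivAt (fun s => Real.exp (μ * s)) (μ * Real.exp (μ * s)) s := by
    intro s
    have := ((hasDerivAt_id s).const_mul μ).exp
    simp only [id] at this
    rwa [mul_one, mul_comm] at this
  have h2 : HasDerivAt (fun s => μ * Real.exp (μ * s)) (μ ^ 2 * Real.exp (μ * z.1)) z.1 := by
    have := (h1 z.1).const_mul μ
    rwa [← mul_assoc, ← sq] at this
  have h3 : HasJet (fun z : ℝ × En n => z.1) z (ContinuousLinearMap.fst ℝ ℝ (En n)) 0 := by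
    have : (fun h : ℝ × En n => (z + h).1 - z.1 - ContinuousLinearMap.fst ℝ ℝ (En n) h
        - 1 / 2 * (0 : ℝ × En n →L[ℝ] ℝ × En n →L[ℝ] ℝ) h h) = fun _ => 0 := by
      funext h
      simp
    rw [HasJet, this]
    exact Asymptotics.isLittleO_zero _ _
  have h4 := h3.comp (taylor_of_hasDerivAt h1 h2)
  have e : (μ * Real.exp (μ * z.1)) • (0 : ℝ × En n →L[ℝ] ℝ × En n →L[ℝ] ℝ)
      + (μ ^ 2 * Real.exp (μ * z.1)) • dualProd (ContinuousLinearMap.fst ℝ ℝ (En n))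
        (ContinuousLinearMap.fst ℝ ℝ (En n)) = (μ ^ 2 * Real.exp (μ * z.1)) •
        dualProd (ContinuousLinearMap.fst ℝ ℝ (En n)) (ContinuousLinearMap.fst ℝ ℝ (En n)) := by
    ext h k <;> simp
  rwa [e] at h4

/-- Exponential-in-time barrier built on a penalization. -/
def barrier (A μ α β : ℝ) (H : ℝ × En n → ℝ) (z : ℝ × En n) : ℝ :=
  A + Real.exp (μ * z.1) * (α + β * H z)

theorem continuous_dualProd {α E : Type*} [TopologicalSpace α] [NormedAddCommGroup E]
    [NormedSpace ℝ E] {q q' : α → E →L[ℝ] ℝ} (hq : Continuous q) (hq' : Continuous q') :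
    Continuous fun x => dualProd (q x) (q' x) := by
  unfold dualProd
  exact (ContinuousLinearMap.smulRightL ℝ E (E →L[ℝ] ℝ)).continuous₂.comp (hq.prodMk hq')

theorem Penalty.exists_barrier {H : ℝ × En n → ℝ} {H' : ℝ × En n → ℝ × En n →L[ℝ] ℝ}
    {H'' : ℝ × En n → ℝ × En n →L[ℝ] ℝ × En n →L[ℝ] ℝ} {C : ℝ} (hH : Q.Penalty H H' H'' C)
    (A μ α β : ℝ) : ∃ B' B'', (∀ z, HasJet (barrier A μ α β H) z (B' z) (B'' z)) ∧
      Continuous B' ∧ Continuous B'' ∧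
      (∀ z ∈ Q.dom, |Q.lin z (B' z) (B'' z) + Real.exp (μ * z.1) * (μ * (α + β * H z))|
        ≤ Real.exp (μ * z.1) * (|β| * (2 * C * H z))) ∧
      ∀ z ∈ Q.dom, ‖Q.sg z (B' z)‖ ≤ Real.exp (μ * z.1) * (|β| * (C * H z)) := by
  set F := ContinuousLinearMap.fst ℝ ℝ (En n) with hF
  set E : ℝ × En n → ℝ := fun z => Real.exp (μ * z.1) with hE
  have hEc : Continuous E := by rw [hE]; fun_prop
  have hHc : Continuous H := continuous_iff_continuousAt.2 fun z => (hH.jet z).continuousAt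
  set G : ℝ × En n → ℝ := fun z => α + β * H z with hG
  have hGc : Continuous G := by rw [hG]; fun_prop
  have hJ : ∀ z, HasJet (barrier A μ α β H) z
      (0 + (E z • (0 + β • H' z) + G z • ((μ * E z) • F)))
      (0 + (E z • (0 + β • H'' z) + G z • ((μ ^ 2 * E z) • dualProd F F)
        + (dualProd ((μ * E z) • F) (0 + β • H' z) + dualProd (0 + β • H' z) ((μ * E z) • F)))) := by
    intro z
    exact (hasJet_const A).add ((hasJet_exp_time μ z).mul
      ((hasJet_const α).add ((hH.jet z).const_mul β)))
  have hcH' : Continuous fun z => 0 + β • H' z := continuous_const.add (hH.cont'.const_smul β)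
  have hcF : Continuous fun z => (μ * E z) • F :=
    (continuous_const.mul hEc).smul continuous_const
  refine ⟨_, _, hJ, ?_, ?_, ?_, ?_⟩
  · exact continuous_const.add ((hEc.smul hcH').add (hGc.smul hcF))
  · have h0 : Continuous fun z => β • H'' z := by
      have := hH.cont''
      exact ((β • ContinuousLinearMap.id ℝ (ℝ × En n →L[ℝ] ℝ × En n →L[ℝ] ℝ)).continuous).comp this
    have h1 : Continuous fun z => E z • (0 + β • H'' z) :=
      hEc.smul (continuous_add_form continuous_const h0)
    have h2 : Continuous fun z => G z • ((μ ^ 2 * E z) • dualProd F F) :=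
      hGc.smul ((continuous_const.mul hEc).smul continuous_const)
    exact continuous_add_form continuous_const (continuous_add_form (continuous_add_form h1 h2)
      (continuous_add_form (continuous_dualProd hcF hcH') (continuous_dualProd hcH' hcF)))
  · intro z hz
    have h1 := hH.drift z hz
    have h2 := hH.diff z hz
    have h3 : Q.lin z (0 + (E z • (0 + β • H' z) + G z • ((μ * E z) • F)))
      (0 + (E z • (0 + β • H'' z) + G z • ((μ ^ 2 * E z) • dualProd F F)
        + (dualProd ((μ * E z) • F) (0 + β • H' z) + dualProd (0 + β • H' z) ((μ * E z) • F))))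
        + E z * (μ * G z) = -(E z * (β * (H' z (0, Q.a z.1 z.2)
          + 1 / 2 * ∑ k, H'' z (0, Q.col z k) (0, Q.col z k)))) := by
      simp only [lin, _root_.add_apply, _root_.smul_apply, _root_.zero_apply, hH.time,
        dualProd_apply, hF, ContinuousLinearMap.coe_fst', smul_eq_mul, mul_zero, zero_mul,
        add_zero, zero_add, Finset.mul_sum]
      have : ∑ x, 1 / 2 * (E z * (β * ((H'' z) (0, Q.col z x)) (0, Q.col z x)))
          = E z * β * ∑ x, 1 / 2 * ((H'' z) (0, Q.col z x)) (0, Q.col z x) := by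
        rw [Finset.mul_sum]
        exact Finset.sum_congr rfl fun _ _ => by ring
      rw [this]
      ring
    have hE0 : 0 ≤ E z := (Real.exp_pos _).le
    have hCH : 0 ≤ C * H z := mul_nonneg hH.nonneg (by linarith [hH.one_le z])
    rw [h3, abs_neg, abs_mul, abs_mul, abs_of_nonneg hE0]
    gcongr
    rw [abs_le] at h1 h2 ⊢
    constructor <;> linarith
  · intro z hz
    have h1 : Q.sg z (0 + (E z • (0 + β • H' z) + G z • ((μ * E z) • F)))
        = (E z * β) • Q.sg z (H' z) := by
      ext k
      simp [sg, hF, mul_assoc]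
    rw [h1, norm_smul, norm_mul, Real.norm_eq_abs, Real.norm_eq_abs,
      abs_of_nonneg (Real.exp_pos _).le, mul_assoc]
    gcongr
    exact hH.grad z hz

theorem Growth.sub {u v : ℝ × En n → ℝ} (hu : Q.Growth u) (hv : Q.Growth v) :
    Q.Growth fun z => u z - v z := by
  obtain ⟨C, hC, ρ, hρ, h⟩ := hu
  obtain ⟨C', hC', ρ', hρ', h'⟩ := hv
  refine ⟨2 * (C + C'), by positivity, max ρ ρ', lt_max_of_lt_left hρ, fun p hp => ?_⟩
  have h1 := h p hp
  have h2 := h' p hp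
  have h3 := Real.rpow_le_one_add_rpow (norm_nonneg p.2) hρ (le_max_left ρ ρ')
  have h4 := Real.rpow_le_one_add_rpow (norm_nonneg p.2) hρ' (le_max_right ρ ρ')
  have h5 := Real.rpow_nonneg (norm_nonneg p.2) (max ρ ρ')
  calc |u p - v p| ≤ |u p| + |v p| := abs_sub _ _
    _ ≤ C * (1 + (1 + ‖p.2‖ ^ max ρ ρ')) + C' * (1 + (1 + ‖p.2‖ ^ max ρ ρ')) := by
      refine add_le_add (h1.trans ?_) (h2.trans ?_) <;> gcongr
    _ ≤ _ := by nlinarith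

/-- A penalization of high degree dominates functions of polynomial growth. -/
theorem exists_pen_dominates (m : ℕ) (c : ℝ) (x₀ : En n) {ρ : ℝ} (hm : ρ ≤ m)
    {A : ℝ} (hA : 0 < A) :
    ∃ R > 0, ∀ z : ℝ × En n, R ≤ ‖z.2‖ → A * (1 + ‖z.2‖ ^ ρ) < pen m c x₀ z := by
  refine ⟨max (max 1 (8 * c)) (max (2 * ‖x₀‖) (2 * A * 8 ^ (m + 3))), by positivity,
    fun z hz => ?_⟩
  set r := ‖z.2‖ with hr
  have h1 : 1 ≤ r := (le_max_left _ _).trans ((le_max_left _ _).trans hz)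
  have h2 : 8 * c ≤ r := (le_max_right _ _).trans ((le_max_left _ _).trans hz)
  have h3 : 2 * ‖x₀‖ ≤ r := (le_max_left _ _).trans ((le_max_right _ _).trans hz)
  have h4 : 2 * A * 8 ^ (m + 3) ≤ r := (le_max_right _ _).trans ((le_max_right _ _).trans hz)
  have h5 : r / 2 ≤ ‖z.2 - x₀‖ := by linarith [norm_sub_norm_le z.2 x₀]
  have h6 : r ^ 2 / 8 ≤ ‖z.2 - x₀‖ ^ 2 - c := by nlinarith
  have h7 : (r ^ 2 / 8) ^ (m + 3) ≤ max (‖z.2 - x₀‖ ^ 2 - c) 0 ^ (m + 3) := by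
    gcongr
    exact h6.trans (le_max_left _ _)
  have h8 : r ^ ρ ≤ r ^ m := by
    rw [← Real.rpow_natCast]
    exact Real.rpow_le_rpow_of_exponent_le h1 hm
  have h9 : (1 : ℝ) ≤ r ^ m := one_le_pow₀ h1
  have h10 : 2 * A * 8 ^ (m + 3) * r ^ m ≤ (r ^ 2) ^ (m + 3) := by
    calc _ ≤ r * r ^ m := by gcongr
      _ = r ^ (m + 1) := by ring
      _ ≤ r ^ (2 * (m + 3)) := pow_le_pow_right₀ h1 (by omega)
      _ = _ := by rw [pow_mul]
  have h11 : 2 * A * r ^ m ≤ (r ^ 2 / 8) ^ (m + 3) := by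
    rw [div_pow, le_div_iff₀ (by positivity)]
    linarith
  unfold pen
  nlinarith

theorem hasJet_quadPoly_parForm (κ : ℝ) (p z : ℝ × En n) :
    HasJet (quadPoly 0 p 0 (κ • parForm n)) z ((κ • parForm n) (z - p)) (κ • parForm n) := by
  have := hasJet_quadPoly (p := p) (q := 0) (X := κ • parForm n) 0
    (fun h k => by simp [parForm_comm h k]) z
  rwa [zero_add] at this

theorem quadPoly_parForm_apply (κ : ℝ) (p z : ℝ × En n) :
    quadPoly 0 p 0 (κ • parForm n) z = κ * (1 / 2 * parForm n (z - p) (z - p)) := by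
  simp only [quadPoly, _root_.smul_apply, _root_.zero_apply, smul_eq_mul]
  ring

theorem isLocalMaxOn_of_isMaxOn_cap {g : ℝ × En n → ℝ} {p z : ℝ × En n} {r : ℝ}
    (h : IsMaxOn g (Q.dom ∩ Metric.closedBall p r) z) (hz : dist z p < r) :
    IsLocalMaxOn g Q.dom z := by
  have := h.localize
  unfold IsLocalMaxOn at this ⊢
  rwa [nhdsWithin_cap hz] at this

/-- A supersolution dominates its intervention at every point before the horizon. -/
theorem JSuper.M_le {v : ℝ × En n → ℝ} (hv : Q.JSuper v) (gv : Q.Growth v) {p : ℝ × En n}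
    (hp : p ∈ Q.dom) (hpT : p.1 < Q.T) : Q.M v p ≤ v p := by
  by_contra! hlt
  have h1 := lowerSemicontinuousOn_M hv.1 gv p hp (v p) hlt
  rw [eventually_nhdsWithin_iff, Metric.eventually_nhds_iff] at h1
  obtain ⟨ε, hε, h1⟩ := h1
  have h2 : ∀ᶠ z : ℝ × En n in 𝓝 p, z.1 < Q.T :=
    continuous_fst.continuousAt.eventually (eventually_lt_nhds hpT)
  obtain ⟨ε', hε', h2⟩ := Metric.eventually_nhds_iff.1 h2
  obtain ⟨B, hB⟩ := gv.exists_bound (‖p‖ + 1)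
  set r := min 1 (min ε ε') with hr
  have hr0 : 0 < r := by positivity
  set k := (v p + B + 1) / r ^ 2 with hk
  have hBp : |v p| ≤ B := hB p hp ((norm_snd_le p).trans (by linarith))
  have hB0 := abs_le.1 hBp
  have hk0 : 0 < k := by rw [hk]; apply div_pos <;> [linarith; positivity]
  set Φ := quadPoly 0 p 0 (k • parForm n) with hΦ
  have hc : UpperSemicontinuousOn (fun z => -v z + -Φ z) (Q.dom ∩ Metric.closedBall p 1) :=
    (hv.1.neg_upper.add
      (continuous_quadPoly 0).neg.continuousOn.upperSemicontinuousOn).mono inter_subset_left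
  have hpK : p ∈ Q.dom ∩ Metric.closedBall p 1 :=
    ⟨hp, Metric.mem_closedBall_self zero_le_one⟩
  obtain ⟨z, hz, hmax⟩ := hc.exists_isMaxOn ⟨p, hpK⟩ (isCompact_cap p 1)
  have h3 := isMaxOn_iff.1 hmax p hpK
  simp only [hΦ, quadPoly_self] at h3
  rw [quadPoly_parForm_apply] at h3
  have h4 := norm_sq_le_half_parForm (z - p)
  have h5 : -B ≤ v z := (abs_le.1 (hB z hz.1 (by
    have := hz.2
    rw [Metric.mem_closedBall, dist_eq_norm] at this
    linarith [norm_snd_le z, norm_le_norm_add_norm_sub' z p]))).1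
  have h6 : k * ‖z - p‖ ^ 2 < k * r ^ 2 := by
    have e : k * r ^ 2 = v p + B + 1 := by rw [hk]; field_simp
    have := mul_le_mul_of_nonneg_left h4 hk0.le
    linarith
  have h7 : dist z p < r := by
    rw [dist_eq_norm]
    exact lt_of_pow_lt_pow_left₀ 2 hr0.le (lt_of_mul_lt_mul_left h6 hk0.le)
  have h8 : v z ≤ v p := by
    have : 0 ≤ k * (1 / 2 * parForm n (z - p) (z - p)) :=
      mul_nonneg hk0.le ((sq_nonneg _).trans h4)
    linarith
  have hmax' : IsLocalMaxOn (fun z => -v z - Φ z) Q.dom z := by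
    have := isLocalMaxOn_of_isMaxOn_cap (Q := Q) hmax (h7.trans_le (min_le_left _ _))
    simpa only [← sub_eq_add_neg] using this
  have hj := SupJet.of_isLocalMaxOn_sub (hasJet_quadPoly_parForm k p z) hmax'
  have h9 := (hv.2.2 z hz.1 (h2 (h7.trans_le ((min_le_right _ _).trans (min_le_right _ _))))
    (-((k • parForm n) (z - p))) (-(k • parForm n)) (by
      rw [neg_neg, neg_neg (G := ℝ × En n →L[ℝ] ℝ × En n →L[ℝ] ℝ) (k • parForm n)]
      exact hj)).1
  have h10 := h1 (h7.trans_le ((min_le_right _ _).trans (min_le_left _ _))) hz.1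
  linarith

theorem lin_add_smul (p : ℝ × En n) (q : ℝ × En n →L[ℝ] ℝ)
    (X Y : ℝ × En n →L[ℝ] ℝ × En n →L[ℝ] ℝ) (c : ℝ) :
    Q.lin p q (X + c • Y) = Q.lin p q X
      - c * (1 / 2 * ∑ k, Y (0, Q.col p k) (0, Q.col p k)) := by
  simp only [lin, _root_.add_apply, _root_.smul_apply, smul_eq_mul, Finset.sum_add_distrib,
    ← Finset.mul_sum]
  ring

theorem pen_jump_le (m : ℕ) {p : ℝ × En n} (hp : p ∈ Q.dom) (b : U) :
    pen m (Q.KΓ ^ 2) 0 (p.1, Q.Γ p.1 p.2 b) ≤ pen m (Q.KΓ ^ 2) 0 p := by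
  unfold pen
  simp only [sub_zero]
  have h := Q.hΓb p.1 (mem_dom.1 hp) p.2 b
  refine add_le_add_right (pow_le_pow_left₀ (le_max_right _ _) ?_ _) 1
  rcases le_max_iff.1 h with h | h
  · have : ‖Q.Γ p.1 p.2 b‖ ^ 2 ≤ Q.KΓ ^ 2 := by gcongr
    exact max_le ((sub_nonpos.2 this).trans (le_max_right _ _)) (le_max_right _ _)
  · gcongr

/-- Comparison of sub- and supersolutions of polynomial growth. -/
theorem comparison {u v : ℝ × En n → ℝ} (hu : Q.JSub u) (hv : Q.JSuper v) (gu : Q.Growth u)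
    (gv : Q.Growth v) {p₀ : ℝ × En n} (hp₀ : p₀ ∈ Q.dom) : u p₀ ≤ v p₀ := by
  by_contra! hlt
  obtain ⟨C₀, hC₀, ρ, -, hg⟩ := gu.sub gv
  set m := ⌈ρ⌉₊ with hm
  obtain ⟨H', H'', C, hH⟩ := Q.exists_penalty m (sq_nonneg Q.KΓ) 0
  set H := pen (n := n) m (Q.KΓ ^ 2) 0 with hHd
  set lam := 2 * C + Q.kf + Q.kf * C + 1 with hlam
  have hkf := Q.hkf
  have hC := hH.nonneg
  have hlam0 : 0 < lam := by positivity
  set E : ℝ × En n → ℝ := fun z => Real.exp (lam * z.1) with hE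
  have hE0 : ∀ z, 0 < E z := fun z => Real.exp_pos _
  have hHp : ∀ z, 0 < H z := fun z => by linarith [hH.one_le z]
  set θ := (u p₀ - v p₀) / (2 * H p₀) with hθd
  have hθ : 0 < θ := div_pos (by linarith) (by linarith [hHp p₀])
  set W : ℝ × En n → ℝ := fun z => E z * (u z + -v z) + -(θ * H z) with hW
  have hHc : Continuous H := continuous_iff_continuousAt.2 fun z => (hH.jet z).continuousAt
  have hWu : UpperSemicontinuousOn W Q.dom := by
    have h1 : UpperSemicontinuousOn (fun z => E z * (u z + -v z)) Q.dom :=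
      (hu.1.add hv.1.neg_upper).const_mul_of_pos
        (by rw [hE]; fun_prop) (fun z _ => hE0 z)
    exact h1.add (continuous_const.mul hHc).neg.continuousOn.upperSemicontinuousOn
  have hA : 0 < Real.exp (lam * Q.T) * C₀ / θ := by positivity
  obtain ⟨R, hR, hdom⟩ := exists_pen_dominates m (Q.KΓ ^ 2) (0 : En n) (Nat.le_ceil ρ) hA
  set r := max R (max Q.T ‖p₀‖) with hr
  have hout : ∀ z ∈ Q.dom, z ∉ Metric.closedBall (0 : ℝ × En n) r → W z < 0 := by
    intro z hz hzr
    rw [mem_closedBall_zero_iff, not_le, Prod.norm_def, lt_max_iff] at hzr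
    have hz1 := mem_dom.1 hz
    have hzR : R ≤ ‖z.2‖ := by
      rcases hzr with h | h
      · rw [Real.norm_eq_abs, abs_of_nonneg hz1.1] at h
        exact absurd (hz1.2.trans ((le_max_left _ _).trans (le_max_right _ _))) (not_le.2 h)
      · exact (le_max_left _ _).trans h.le
    have h1 := hdom z hzR
    rw [← hHd, div_mul_eq_mul_div, div_lt_iff₀ hθ] at h1
    have h2 := (le_abs_self _).trans (hg z hz)
    have h3 : E z ≤ Real.exp (lam * Q.T) := Real.exp_le_exp.2 (by gcongr; exact hz1.2)
    have h4 : E z * (u z - v z) ≤ Real.exp (lam * Q.T) * (C₀ * (1 + ‖z.2‖ ^ ρ)) := by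
      refine (mul_le_mul_of_nonneg_left h2 (hE0 z).le).trans ?_
      gcongr
    simp only [hW, ← sub_eq_add_neg]
    linarith
  set K := Q.dom ∩ Metric.closedBall (0 : ℝ × En n) r with hKd
  have hK : IsCompact K := isCompact_cap 0 r
  have hp₀K : p₀ ∈ K :=
    ⟨hp₀, mem_closedBall_zero_iff.2 ((le_max_right _ _).trans (le_max_right _ _))⟩
  obtain ⟨p₁, hp₁, hmax₁⟩ := (hWu.mono inter_subset_left).exists_isMaxOn ⟨p₀, hp₀K⟩ hK
  set μ := W p₁ with hμ
  have hμ0 : 0 < μ := by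
    have h1 := hmax₁ hp₀K
    simp only [mem_ofPred_eq] at h1
    refine lt_of_lt_of_le ?_ h1
    have h2 : θ * H p₀ = (u p₀ - v p₀) / 2 := by
      rw [hθd]; field_simp [(hHp p₀).ne']
    have h3 : 1 ≤ E p₀ := Real.one_le_exp (mul_nonneg hlam0.le (mem_dom.1 hp₀).1)
    simp only [hW, ← sub_eq_add_neg]
    nlinarith
  have hWle : ∀ z ∈ Q.dom, W z ≤ μ := by
    intro z hz
    by_cases h : z ∈ Metric.closedBall (0 : ℝ × En n) r
    · exact hmax₁ ⟨hz, h⟩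
    · exact ((hout z hz h).trans hμ0).le
  have hS : IsCompact (K ∩ W ⁻¹' Ici μ) :=
    (hWu.mono inter_subset_left).isCompact_inter_preimage_Ici hK μ
  have hp₁S : p₁ ∈ K ∩ W ⁻¹' Ici μ := ⟨hp₁, le_refl μ⟩
  obtain ⟨p, ⟨hpK, hpW⟩, hpmax⟩ := (hu.1.mono (inter_subset_left.trans inter_subset_left)
    |>.exists_isMaxOn ⟨p₁, hp₁S⟩ hS)
  have hp : p ∈ Q.dom := hpK.1
  have hpμ : W p = μ := le_antisymm (hWle p hp) hpW
  have hpT : p.1 < Q.T := by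
    refine lt_of_le_of_ne (mem_dom.1 hp).2 fun h => ?_
    have h1 : u p ≤ v p := by
      obtain ⟨t, x⟩ := p
      simp only at h
      subst h
      exact (hu.2.1 x).trans (hv.2.1 x)
    have h2 : E p * (u p - v p) ≤ 0 := mul_nonpos_of_nonneg_of_nonpos (hE0 p).le (by linarith)
    have h3 := mul_pos hθ (hHp p)
    simp only [hW, ← sub_eq_add_neg] at hpμ
    linarith
  have hM : Q.M u p < u p := by
    by_contra! hle
    obtain ⟨b, hb, -⟩ := exists_M_eq hu.1 hp
    set p' : ℝ × En n := (p.1, Q.Γ p.1 p.2 b) with hp'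
    have h1 := gv.le_M hp b
    have h2 := hv.M_le gv hp hpT
    have h3 : H p' ≤ H p := pen_jump_le m hp b
    have h4 : E p * (u p - v p) ≤ E p' * (u p' - v p') :=
      mul_le_mul_of_nonneg_left (by linarith) (hE0 p).le
    have h5 : μ ≤ W p' := by
      have := mul_le_mul_of_nonneg_left h3 hθ.le
      rw [← hpμ]
      simp only [hW, ← sub_eq_add_neg]
      linarith
    have hd' : p' ∈ Q.dom := mem_dom_Γ hp b
    have h6 : p' ∈ Metric.closedBall (0 : ℝ × En n) r := by
      by_contra h
      linarith [hout p' hd' h]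
    have h7 := hpmax ⟨⟨hd', h6⟩, h5⟩
    simp only [mem_ofPred_eq] at h7
    have := Q.hℓlb p.1 (mem_dom.1 hp) p.2 b
    have := Q.hδ
    linarith
  obtain ⟨B', B'', hB, hBc', hBc'', hlin, hsg⟩ := hH.exists_barrier 0 (-lam) μ θ
  have hEinv : ∀ z : ℝ × En n, Real.exp (-lam * z.1) * E z = 1 := fun z => by
    rw [hE, ← Real.exp_add]; simp
  have hkey : ∀ κ > (0 : ℝ), 0 ≤ -Q.lin p (B' p) (B'' p)
      + κ * (1 / 2 * ∑ k, parForm n (0, Q.col p k) (0, Q.col p k))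
      + Q.kf * (|u p - v p| + ‖Q.sg p (B' p)‖) := by
    intro κ hκ
    have hj := fun z => (hB z).add (hasJet_quadPoly_parForm κ p z)
    have hdl := doubling_limit hu hv hp hpT hM hj
      (hBc'.add (by fun_prop)) (continuous_add_form hBc'' continuous_const) one_pos ?_ ?_
    · simp only [sub_self, map_zero, add_zero] at hdl
      rw [lin_add_smul] at hdl
      linarith
    · intro z hz _ hzp
      have h1 := hWle z hz
      rw [quadPoly_parForm_apply]
      have h2 := norm_sq_le_half_parForm (z - p)
      have h3 : 0 < ‖z - p‖ ^ 2 := by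
        have := norm_pos_iff.2 (sub_ne_zero.2 hzp)
        positivity
      have h4 : 0 < κ * (1 / 2 * parForm n (z - p) (z - p)) := mul_pos hκ (by linarith)
      have h5 : u z - v z ≤ barrier 0 (-lam) μ θ H z := by
        have h6 : E z * (u z - v z) ≤ μ + θ * H z := by
          simp only [hW, ← sub_eq_add_neg] at h1; linarith
        have := mul_le_mul_of_nonneg_left h6 (Real.exp_pos (-lam * z.1)).le
        rw [← mul_assoc, hEinv, one_mul] at this
        unfold barrier
        linarith
      linarith
    · rw [quadPoly_self, add_zero]
      have h6 : E p * (u p - v p) = μ + θ * H p := by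
        simp only [hW, ← sub_eq_add_neg] at hpμ; linarith
      unfold barrier
      rw [← h6, ← mul_assoc, hEinv]
      ring
  have hfin := le_zero_of_forall_sub_mul (A := Q.lin p (B' p) (B'' p)
    - Q.kf * (|u p - v p| + ‖Q.sg p (B' p)‖))
    (B := 1 / 2 * ∑ k, parForm n (0, Q.col p k) (0, Q.col p k))
    (fun κ hκ => by linarith [hkey κ hκ])
  set e := Real.exp (-lam * p.1) with he
  have he0 : 0 < e := Real.exp_pos _
  have h6 : u p - v p = e * (μ + θ * H p) := by
    have : E p * (u p - v p) = μ + θ * H p := by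
      simp only [hW, ← sub_eq_add_neg] at hpμ; linarith
    rw [← this, ← mul_assoc, hEinv, one_mul]
  have hHθ := mul_pos hθ (hHp p)
  have h7 : |u p - v p| = e * (μ + θ * H p) := by
    rw [h6, abs_of_nonneg (by positivity)]
  have h8 := (abs_le.1 (hlin p hp)).1
  have h9 := mul_le_mul_of_nonneg_left (hsg p hp) hkf.le
  rw [abs_of_pos hθ] at h8 h9
  rw [h7] at hfin
  have h10 : 0 < e * (lam * μ - Q.kf * μ + θ * H p) := by
    have : Q.kf * μ < lam * μ := by
      apply mul_lt_mul_of_pos_right _ hμ0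
      rw [hlam]
      nlinarith [mul_nonneg hkf.le hC]
    apply mul_pos he0
    linarith
  have h11 : e * (lam * μ - Q.kf * μ + θ * H p) = e * (lam * (μ + θ * H p))
      - e * (θ * (2 * C * H p)) - Q.kf * (e * (μ + θ * H p)) - Q.kf * (e * (θ * (C * H p))) := by
    rw [hlam]; ring
  linarith

end QVI

section Envelope

variable {α : Type*} [TopologicalSpace α] {S : Set α} {g h : α → ℝ} {p : α} {c : ℝ}

/-- The upper semicontinuous envelope of `g` relative to `S`. -/
def usEnv (S : Set α) (g : α → ℝ) (p : α) : ℝ := sInf {c | ∀ᶠ z in 𝓝[S] p, g z ≤ c}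

theorem usEnv_bddBelow (hp : p ∈ S) : BddBelow {c | ∀ᶠ z in 𝓝[S] p, g z ≤ c} :=
  ⟨g p, fun _ hc => hc.self_of_nhdsWithin hp⟩

theorem usEnv_le (hp : p ∈ S) (hc : ∀ᶠ z in 𝓝[S] p, g z ≤ c) : usEnv S g p ≤ c :=
  csInf_le (usEnv_bddBelow hp) hc

theorem le_usEnv (hp : p ∈ S) (hb : ∃ B, ∀ᶠ z in 𝓝[S] p, g z ≤ B) : g p ≤ usEnv S g p :=
  le_csInf hb fun _ hc => hc.self_of_nhdsWithin hp

theorem frequently_of_lt_usEnv (hp : p ∈ S) (hc : c < usEnv S g p) :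
    ∃ᶠ z in 𝓝[S] p, c < g z := by
  intro hn
  exact absurd (usEnv_le hp (hn.mono fun z hz => not_lt.1 hz)) (not_le.2 hc)

theorem upperSemicontinuousOn_usEnv (hb : ∀ p ∈ S, ∃ B, ∀ᶠ z in 𝓝[S] p, g z ≤ B) :
    UpperSemicontinuousOn (usEnv S g) S := by
  intro p hp c hc
  obtain ⟨c', hc', hlt⟩ := exists_lt_of_csInf_lt (hb p hp) hc
  filter_upwards [eventually_eventually_nhdsWithin.2 hc', self_mem_nhdsWithin] with z hz hzS
  exact (usEnv_le hzS hz).trans_lt hlt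

theorem usEnv_le_of_continuousWithinAt (hp : p ∈ S) (hh : ContinuousWithinAt h S p)
    (hgh : ∀ᶠ z in 𝓝[S] p, g z ≤ h z) : usEnv S g p ≤ h p := by
  refine le_of_forall_gt_imp_ge_of_dense fun c hc => usEnv_le hp ?_
  filter_upwards [hgh, hh.eventually (eventually_lt_nhds hc)] with z h1 h2
  exact h1.trans h2.le

end Envelope

section JetOrder

variable {n d : ℕ}

theorem nonneg_of_eventually_sq {A B : ℝ}
    (h : ∀ ν > (0 : ℝ), ∃ D, ∀ᶠ s in 𝓝[>] (0 : ℝ), 0 ≤ s * A + s ^ 2 * B + ν * s ^ 2 * D) :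
    0 ≤ A := by
  obtain ⟨D, hD⟩ := h 1 one_pos
  have h1 : Tendsto (fun s : ℝ => A + s * B + s * D) (𝓝[>] 0) (𝓝 A) := by
    have : Tendsto (fun s : ℝ => A + s * B + s * D) (𝓝 0) (𝓝 (A + 0 * B + 0 * D)) := by
      apply Continuous.tendsto; fun_prop
    rw [zero_mul, zero_mul, add_zero, add_zero] at this
    exact this.mono_left nhdsWithin_le_nhds
  refine ge_of_tendsto h1 ?_
  filter_upwards [hD, self_mem_nhdsWithin] with s h2 h3
  have h3 : 0 < s := h3
  by_contra! h4
  have := mul_neg_of_pos_of_neg h3 h4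
  nlinarith

/-- Sign conditions on a superjet of a constant at a point before the horizon. -/
theorem SupJet.const_sign {T c : ℝ} {p : ℝ × En n} {q : ℝ × En n →L[ℝ] ℝ}
    {X : ℝ × En n →L[ℝ] ℝ × En n →L[ℝ] ℝ} (h : SupJet (Strip n T) (fun _ => c) p q X)
    (hp : p ∈ Strip n T) (hpT : p.1 < T) :
    0 ≤ q (1, 0) ∧ (∀ w, q (0, w) = 0) ∧ ∀ w, 0 ≤ X (0, w) (0, w) := by
  have hdir : ∀ k : ℝ × En n, 0 ≤ k.1 → ∀ ν > (0 : ℝ), ∀ᶠ s in 𝓝[>] (0 : ℝ),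
      0 ≤ s * q k + s ^ 2 * (1 / 2 * X k k) + ν * s ^ 2 * ‖k‖ ^ 2 := by
    intro k hk ν hν
    have ht : Tendsto (fun s : ℝ => p + s • k) (𝓝[>] 0) (𝓝[Strip n T] p) := by
      have h0 : Tendsto (fun s : ℝ => p + s • k) (𝓝 0) (𝓝 p) := by
        have : Tendsto (fun s : ℝ => p + s • k) (𝓝 0) (𝓝 (p + (0 : ℝ) • k)) := by
          apply Continuous.tendsto; fun_prop
        rwa [zero_smul, add_zero] at this
      have h0' := h0.mono_left (nhdsWithin_le_nhds (s := Ioi (0 : ℝ)))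
      refine tendsto_nhdsWithin_iff.2 ⟨h0', ?_⟩
      have h1 := (continuous_fst.tendsto p).comp h0'
      filter_upwards [h1.eventually (eventually_lt_nhds hpT), self_mem_nhdsWithin] with s h2 h3
      simp only [Strip, mem_prod, mem_Icc, mem_univ, and_true] at hp ⊢
      refine ⟨?_, h2.le⟩
      have : 0 ≤ s * k.1 := mul_nonneg (le_of_lt h3) hk
      simp only [Prod.fst_add, Prod.smul_fst, smul_eq_mul]
      linarith
    filter_upwards [ht.eventually (h ν hν)] with s hs
    simp only [add_sub_cancel_left, map_smul, _root_.smul_apply, smul_eq_mul, norm_smul,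
      mul_pow, Real.norm_eq_abs, sq_abs] at hs
    linarith
  have h1 : ∀ k : ℝ × En n, 0 ≤ k.1 → 0 ≤ q k := fun k hk =>
    nonneg_of_eventually_sq fun ν hν => ⟨_, hdir k hk ν hν⟩
  have h2 : ∀ w : En n, q (0, w) = 0 := by
    intro w
    refine le_antisymm ?_ (h1 _ le_rfl)
    have := h1 (0, -w) le_rfl
    have e : ((0 : ℝ), -w) = -(0, w) := by simp
    rw [e, map_neg] at this
    linarith
  refine ⟨h1 _ zero_le_one, h2, fun w => ?_⟩
  have h3 : ∀ ν > (0 : ℝ), -(1 / 2 * X (0, w) (0, w)) - ν * ‖((0 : ℝ), w)‖ ^ 2 ≤ 0 := by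
    intro ν hν
    have h4 := hdir (0, w) le_rfl ν hν
    obtain ⟨s, hs, hs0⟩ := (h4.and self_mem_nhdsWithin).exists
    rw [h2 w] at hs
    have hs0 : 0 < s := hs0
    have : 0 < s ^ 2 := by positivity
    by_contra! h5
    nlinarith
  have := QVI.le_zero_of_forall_sub_mul h3
  linarith

end JetOrder

namespace QVI

variable {n d : ℕ} {U : Type} [MetricSpace U] [CompactSpace U] [Nonempty U] {Q : QVI n d U}

theorem op_le_of_supJet {Φ : ℝ × En n → ℝ} {p : ℝ × En n} {q q' : ℝ × En n →L[ℝ] ℝ}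
    {X X' : ℝ × En n →L[ℝ] ℝ × En n →L[ℝ] ℝ} (hp : p ∈ Q.dom) (hpT : p.1 < Q.T)
    (h : SupJet Q.dom Φ p q X) (hΦ : HasJet Φ p q' X') (y : ℝ) :
    Q.op p y q X ≤ Q.op p y q' X' := by
  have h1 := h.add_hasJet hΦ.neg
  simp only [add_neg_cancel] at h1
  obtain ⟨h2, h3, h4⟩ := h1.const_sign hp hpT
  simp only [_root_.add_apply, _root_.neg_apply] at h2 h3 h4
  have h5 : ∀ w, q (0, w) = q' (0, w) := fun w => by linarith [h3 w]
  have h6 : Q.sg p q = Q.sg p q' := by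
    ext k; simp [sg, h5]
  unfold op lin
  rw [h6, h5]
  have h7 : ∑ k, X' (0, Q.col p k) (0, Q.col p k) ≤ ∑ k, X (0, Q.col p k) (0, Q.col p k) :=
    Finset.sum_le_sum fun k _ => by linarith [h4 (Q.col p k)]
  linarith

theorem le_op_of_supJet {Φ : ℝ × En n → ℝ} {p : ℝ × En n} {q q' : ℝ × En n →L[ℝ] ℝ}
    {X X' : ℝ × En n →L[ℝ] ℝ × En n →L[ℝ] ℝ} (hp : p ∈ Q.dom) (hpT : p.1 < Q.T)
    (h : SupJet Q.dom (fun z => -Φ z) p (-q) (-X)) (hΦ : HasJet Φ p q' X') (y : ℝ) :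
    Q.op p y q' X' ≤ Q.op p y q X := by
  have h1 := h.add_hasJet hΦ
  simp only [neg_add_cancel] at h1
  obtain ⟨h2, h3, h4⟩ := h1.const_sign hp hpT
  simp only [_root_.add_apply, _root_.neg_apply] at h2 h3 h4
  have h5 : ∀ w, q (0, w) = q' (0, w) := fun w => by linarith [h3 w]
  have h6 : Q.sg p q = Q.sg p q' := by
    ext k; simp [sg, h5]
  unfold op lin
  rw [h6, h5]
  have h7 : ∑ k, X (0, Q.col p k) (0, Q.col p k) ≤ ∑ k, X' (0, Q.col p k) (0, Q.col p k) :=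
    Finset.sum_le_sum fun k _ => by linarith [h4 (Q.col p k)]
  linarith

/-! ### Explicit barriers -/

theorem abs_f_le {p : ℝ × En n} (hp : p ∈ Q.dom) (y : ℝ) (z : Ed d) :
    |Q.f p.1 p.2 y z| ≤ Q.Cf * (1 + ‖p.2‖ ^ Q.ρ) + Q.kf * (|y| + ‖z‖) := by
  have h1 := Q.hfLip p.1 (mem_dom.1 hp) p.2 0 y 0 z
  have h2 := Q.hfg p.1 (mem_dom.1 hp) p.2
  rw [sub_zero, sub_zero] at h1
  have := abs_add_le (Q.f p.1 p.2 y z - Q.f p.1 p.2 0 0) (Q.f p.1 p.2 0 0)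
  rw [sub_add_cancel] at this
  linarith

variable (Q) in
theorem exists_growth_le_pen (c : ℝ) (x₀ : En n) : ∃ D ≥ (0 : ℝ), ∀ z : ℝ × En n,
    1 + ‖z.2‖ ^ Q.ρ ≤ D * pen ⌈Q.ρ⌉₊ c x₀ z := by
  obtain ⟨R, hR, h⟩ := exists_pen_dominates ⌈Q.ρ⌉₊ c x₀ (Nat.le_ceil Q.ρ) one_pos
  have hρ := Q.hρ
  have h0 : 0 ≤ R ^ Q.ρ := Real.rpow_nonneg hR.le _
  refine ⟨1 + R ^ Q.ρ, by positivity, fun z => ?_⟩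
  have h1 : 1 ≤ pen ⌈Q.ρ⌉₊ c x₀ z := by
    unfold pen
    have : 0 ≤ max (‖z.2 - x₀‖ ^ 2 - c) 0 ^ (⌈Q.ρ⌉₊ + 3) := pow_nonneg (le_max_right _ _) _
    linarith
  rcases le_total R ‖z.2‖ with h2 | h2
  · have := h z h2
    nlinarith
  · have : ‖z.2‖ ^ Q.ρ ≤ R ^ Q.ρ := Real.rpow_le_rpow (norm_nonneg _) h2 hρ.le
    nlinarith

/-- The operator applied to a barrier is dominated by its time derivative. -/
theorem Penalty.exists_strong_barrier {H : ℝ × En n → ℝ}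
    {H' : ℝ × En n → ℝ × En n →L[ℝ] ℝ} {H'' : ℝ × En n → ℝ × En n →L[ℝ] ℝ × En n →L[ℝ] ℝ}
    {C : ℝ} (hH : Q.Penalty H H' H'' C) {D : ℝ} (hD : 0 ≤ D)
    (hDH : ∀ z : ℝ × En n, 1 + ‖z.2‖ ^ Q.ρ ≤ D * H z) :
    ∃ lam > 0, ∀ (A C₁ s : ℝ), 1 ≤ C₁ → |A| ≤ 2 * C₁ → |s| = 1 →
      ∀ z ∈ Q.dom, ∃ q X,
        HasJet (barrier A (-lam) 0 (s * (C₁ * Real.exp (lam * Q.T))) H) z q X ∧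
        0 ≤ s * Q.op z (barrier A (-lam) 0 (s * (C₁ * Real.exp (lam * Q.T))) H z) q X := by
  have hkf := Q.hkf
  have hCf := Q.hCf
  have hC := hH.nonneg
  refine ⟨2 * C + Q.kf * (1 + C) + 2 * Q.kf + Q.Cf * D, by positivity,
    fun A C₁ s hC₁ hA hs z hz => ?_⟩
  set lam := 2 * C + Q.kf * (1 + C) + 2 * Q.kf + Q.Cf * D with hlam
  have hlam0 : 0 ≤ lam := by positivity
  set β := C₁ * Real.exp (lam * Q.T) with hβ
  obtain ⟨B', B'', hB, -, -, hlin, hsg⟩ := hH.exists_barrier A (-lam) 0 (s * β)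
  refine ⟨B' z, B'' z, hB z, ?_⟩
  have hβ0 : 0 < β := by rw [hβ]; positivity
  have hsβ : |s * β| = β := by rw [abs_mul, hs, one_mul, abs_of_pos hβ0]
  have h1 := hlin z hz
  have h2 := hsg z hz
  have h3 := abs_f_le hz (barrier A (-lam) 0 (s * β) H z) (Q.sg z (B' z))
  rw [hsβ] at h1 h2
  set e := Real.exp (-lam * z.1) with he
  have he0 : 0 < e := Real.exp_pos _
  have hH1 := hH.one_le z
  have heβ : C₁ ≤ e * β := by
    rw [he, hβ, mul_left_comm, ← Real.exp_add]
    have : 0 ≤ -lam * z.1 + lam * Q.T := by nlinarith [(mem_dom.1 hz).2]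
    have := Real.one_le_exp this
    nlinarith
  have heβ0 : 0 < e * β := mul_pos he0 hβ0
  have hbar : |barrier A (-lam) 0 (s * β) H z| ≤ 2 * (e * β * H z) + e * β * H z := by
    unfold barrier
    rw [zero_add]
    refine (abs_add_le _ _).trans (add_le_add (hA.trans ?_) ?_)
    · nlinarith
    · rw [abs_mul, abs_mul, hsβ, ← he, abs_of_pos he0, abs_of_pos (by linarith : 0 < H z),
        ← mul_assoc]
  have h4 : 1 + ‖z.2‖ ^ Q.ρ ≤ D * (e * β * H z) := by
    refine (hDH z).trans ?_
    gcongr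
    nlinarith
  have h5 : |Q.f z.1 z.2 (barrier A (-lam) 0 (s * β) H z) (Q.sg z (B' z))|
      ≤ Q.Cf * (D * (e * β * H z)) + Q.kf * (2 * (e * β * H z) + e * β * H z
        + e * (β * (C * H z))) := by
    refine h3.trans ?_
    gcongr
  rw [zero_add] at h1
  have hs2 : s * s = 1 := by rw [← abs_mul_abs_self, hs, one_mul]
  have h6 : |s * (Q.lin z (B' z) (B'' z) + e * (-lam * (s * β * H z)))
      - s * Q.f z.1 z.2 (barrier A (-lam) 0 (s * β) H z) (Q.sg z (B' z))|
      ≤ lam * (e * β * H z) := by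
    refine (abs_sub _ _).trans ?_
    rw [abs_mul, abs_mul, hs, one_mul, one_mul]
    refine (add_le_add h1 h5).trans (le_of_eq ?_)
    rw [hlam]; ring
  have h7 := (abs_le.1 h6).1
  have h8 : s * (Q.lin z (B' z) (B'' z) + e * (-lam * (s * β * H z)))
      = s * Q.lin z (B' z) (B'' z) - (s * s) * (lam * (e * β * H z)) := by ring
  rw [h8, hs2] at h7
  unfold op
  linarith

theorem pen_le (m : ℕ) {c : ℝ} (hc : 0 ≤ c) (x₀ : En n) (z : ℝ × En n) :
    pen m c x₀ z ≤ (1 + (1 + ‖x₀‖) ^ (2 * (m + 3))) * (1 + ‖z.2‖ ^ (2 * (m + 3))) := by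
  unfold pen
  have h1 : max (‖z.2 - x₀‖ ^ 2 - c) 0 ≤ ‖z.2 - x₀‖ ^ 2 :=
    max_le (by linarith) (sq_nonneg _)
  have h2 : max (‖z.2 - x₀‖ ^ 2 - c) 0 ^ (m + 3) ≤ ‖z.2 - x₀‖ ^ (2 * (m + 3)) := by
    rw [pow_mul]
    exact pow_le_pow_left₀ (le_max_right _ _) h1 _
  have h3 : ‖z.2 - x₀‖ ≤ (1 + ‖x₀‖) * max 1 ‖z.2‖ := by
    have a1 := norm_sub_le z.2 x₀
    have a2 := le_max_left 1 ‖z.2‖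
    have a3 := le_max_right 1 ‖z.2‖
    nlinarith [norm_nonneg x₀]
  have h4 : ‖z.2 - x₀‖ ^ (2 * (m + 3))
      ≤ (1 + ‖x₀‖) ^ (2 * (m + 3)) * (1 + ‖z.2‖ ^ (2 * (m + 3))) := by
    refine (pow_le_pow_left₀ (norm_nonneg _) h3 _).trans ?_
    rw [mul_pow]
    gcongr
    rcases le_total 1 ‖z.2‖ with h | h
    · rw [max_eq_right h]; linarith
    · rw [max_eq_left h, one_pow]
      have : 0 ≤ ‖z.2‖ ^ (2 * (m + 3)) := by positivity
      linarith
  have h5 : 0 ≤ ‖z.2‖ ^ (2 * (m + 3)) := by positivity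
  linarith

theorem growth_barrier (m : ℕ) {c : ℝ} (hc : 0 ≤ c) (x₀ : En n) (A : ℝ) {lam : ℝ}
    (hlam : 0 ≤ lam) (β : ℝ) : Q.Growth (barrier A (-lam) 0 β (pen m c x₀)) := by
  set P := 1 + (1 + ‖x₀‖) ^ (2 * (m + 3)) with hP
  have hP0 : 0 < P := by positivity
  refine ⟨|A| + |β| * P + 1, by positivity, ((2 * (m + 3) : ℕ) : ℝ),
    by positivity, fun z hz => ?_⟩
  rw [Real.rpow_natCast]
  set N := ‖z.2‖ ^ (2 * (m + 3)) with hN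
  have hN0 : 0 ≤ N := by positivity
  have h1 : |pen m c x₀ z| ≤ P * (1 + N) := by
    rw [abs_of_nonneg]
    · exact pen_le m hc x₀ z
    · unfold pen
      have : 0 ≤ max (‖z.2 - x₀‖ ^ 2 - c) 0 ^ (m + 3) := pow_nonneg (le_max_right _ _) _
      linarith
  have h2 : |Real.exp (-lam * z.1)| ≤ 1 := by
    rw [abs_of_pos (Real.exp_pos _), Real.exp_le_one_iff]
    have := mul_nonneg hlam (mem_dom.1 hz).1
    linarith
  unfold barrier
  rw [zero_add]
  calc |A + Real.exp (-lam * z.1) * (β * pen m c x₀ z)|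
      ≤ |A| + |Real.exp (-lam * z.1)| * (|β| * |pen m c x₀ z|) := by
        rw [← abs_mul, ← abs_mul]; exact abs_add_le _ _
    _ ≤ |A| + 1 * (|β| * (P * (1 + N))) := by gcongr
    _ ≤ (|A| + |β| * P + 1) * (1 + N) := by nlinarith [mul_nonneg (abs_nonneg A) hN0]

theorem barrier_terminal (A lam C₁ s : ℝ) (H : ℝ × En n → ℝ) (x : En n) :
    barrier A (-lam) 0 (s * (C₁ * Real.exp (lam * Q.T))) H (Q.T, x)
      = A + s * C₁ * H (Q.T, x) := by
  unfold barrier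
  have : Real.exp (-lam * Q.T) * Real.exp (lam * Q.T) = 1 := by rw [← Real.exp_add]; simp
  linear_combination s * C₁ * H (Q.T, x) * this

variable (Q) in
/-- Continuous subsolutions almost attaining the terminal datum at a given point. -/
theorem exists_jSub_terminal (x₀ : En n) {ε : ℝ} (hε : 0 < ε) :
    ∃ u, Q.Growth u ∧ Q.JSub u ∧ Continuous u ∧ Q.ψ x₀ - ε ≤ u (Q.T, x₀) := by
  obtain ⟨H', H'', C, hH⟩ := Q.exists_penalty ⌈Q.ρ⌉₊ le_rfl x₀
  obtain ⟨D, hD, hDH⟩ := Q.exists_growth_le_pen 0 x₀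
  obtain ⟨lam, hlam, hbar⟩ := hH.exists_strong_barrier hD hDH
  set H := pen (n := n) ⌈Q.ρ⌉₊ 0 x₀ with hHd
  obtain ⟨r, hr, hψ⟩ := Metric.eventually_nhds_iff.1
    (Q.hψc.continuousAt.eventually (eventually_gt_nhds (sub_lt_self (Q.ψ x₀) hε)))
  set c := Q.ψ x₀ - ε with hc
  set η := (r ^ 2) ^ (⌈Q.ρ⌉₊ + 3) with hη
  have hη0 : 0 < η := by positivity
  have hCψ := Q.hCψ
  set C₁ := 1 + |c| + |c| / η + Q.Cψ * D * (1 / η + 1) with hC₁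
  have h0 : 0 ≤ |c| / η := by positivity
  have h0' : 0 ≤ Q.Cψ * D * (1 / η + 1) := by positivity
  have hC₁1 : 1 ≤ C₁ := by linarith [abs_nonneg c]
  have hA : |c + C₁| ≤ 2 * C₁ := by
    refine (abs_add_le _ _).trans ?_
    rw [abs_of_nonneg (by linarith : 0 ≤ C₁)]
    linarith
  have hj := hbar (c + C₁) C₁ (-1) hC₁1 hA (by simp)
  set u := barrier (c + C₁) (-lam) 0 (-1 * (C₁ * Real.exp (lam * Q.T))) H with hu
  have hHc : Continuous H := continuous_iff_continuousAt.2 fun z => (hH.jet z).continuousAt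
  have huc : Continuous u := by
    rw [hu]; unfold barrier; fun_prop
  have hHeq : ∀ z : ℝ × En n, H z = 1 + (‖z.2 - x₀‖ ^ 2) ^ (⌈Q.ρ⌉₊ + 3) := by
    intro z
    rw [hHd, pen, sub_zero, max_eq_left (sq_nonneg _)]
  refine ⟨u, growth_barrier _ le_rfl x₀ _ hlam.le _,
    ⟨huc.continuousOn.upperSemicontinuousOn, fun x => ?_, fun p hp hpT q X hq => ?_⟩, huc, ?_⟩
  · rw [hu, barrier_terminal]
    rcases lt_or_ge (dist x x₀) r with h | h
    · have h1 := hψ h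
      have h2 : 1 ≤ H (Q.T, x) := hH.one_le _
      nlinarith
    · have h1 : η ≤ H (Q.T, x) - 1 := by
        rw [hHeq, add_sub_cancel_left, hη]
        rw [dist_eq_norm] at h
        gcongr
      set w := H (Q.T, x) - 1 with hw
      have h2 : H (Q.T, x) = 1 + w := by rw [hw]; ring
      have h3 : 1 ≤ w / η := by rwa [le_div_iff₀ hη0, one_mul]
      have h4 := (abs_le.1 (Q.hψg x)).1
      have h5 : Q.Cψ * (1 + ‖x‖ ^ Q.ρ) ≤ Q.Cψ * (D * (1 + w)) := by
        rw [← h2]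
        exact mul_le_mul_of_nonneg_left (hDH (Q.T, x)) hCψ.le
      have h6 : Q.Cψ * (D * (1 + w)) ≤ Q.Cψ * (D * (w / η + w)) := by gcongr
      have h7 : |c| ≤ |c| * (w / η) := le_mul_of_one_le_right (abs_nonneg c) h3
      have hw0 : 0 < w := by linarith
      have h8 : |c| * (w / η) + Q.Cψ * (D * (w / η + w)) ≤ C₁ * w := by
        have : C₁ * w = (1 + |c|) * w + (|c| * (w / η) + Q.Cψ * (D * (w / η + w))) := by
          rw [hC₁]; ring
        have : 0 ≤ (1 + |c|) * w := by positivity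
        linarith
      rw [h2]
      linarith [le_abs_self c]
  · obtain ⟨q', X', hJ, hop⟩ := hj p hp
    right
    have := op_le_of_supJet hp hpT hq hJ (u p)
    linarith
  · rw [hu, barrier_terminal, hHeq]
    simp

variable (Q) in
/-- A supersolution of polynomial growth. -/
theorem exists_jSuper : ∃ v, Q.Growth v ∧ Q.JSuper v := by
  obtain ⟨H', H'', C, hH⟩ := Q.exists_penalty ⌈Q.ρ⌉₊ (sq_nonneg Q.KΓ) 0
  obtain ⟨D, hD, hDH⟩ := Q.exists_growth_le_pen (Q.KΓ ^ 2) 0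
  obtain ⟨lam, hlam, hbar⟩ := hH.exists_strong_barrier hD hDH
  set H := pen (n := n) ⌈Q.ρ⌉₊ (Q.KΓ ^ 2) 0 with hHd
  have hCψ := Q.hCψ
  set C₁ := 1 + Q.Cψ * D with hC₁
  have h0 : 0 ≤ Q.Cψ * D := by positivity
  have hj := hbar 0 C₁ 1 (by linarith) (by rw [abs_zero]; linarith) abs_one
  set v := barrier 0 (-lam) 0 (1 * (C₁ * Real.exp (lam * Q.T))) H with hv
  have hHc : Continuous H := continuous_iff_continuousAt.2 fun z => (hH.jet z).continuousAt
  have hvc : Continuous v := by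
    rw [hv]; unfold barrier; fun_prop
  refine ⟨v, growth_barrier _ (sq_nonneg _) 0 _ hlam.le _,
    hvc.continuousOn.lowerSemicontinuousOn, fun x => ?_, fun p hp hpT q X hq => ⟨?_, ?_⟩⟩
  · rw [hv, barrier_terminal]
    have h1 := (abs_le.1 (Q.hψg x)).2
    have h2 := mul_le_mul_of_nonneg_left (hDH (Q.T, x)) hCψ.le
    have h3 : 1 ≤ H (Q.T, x) := hH.one_le _
    rw [hC₁]
    simp only at h2
    nlinarith
  · refine ciSup_le fun b => ?_
    have h1 : H (p.1, Q.Γ p.1 p.2 b) ≤ H p := pen_jump_le _ hp b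
    have h2 := Q.hℓlb p.1 (mem_dom.1 hp) p.2 b
    have h3 := Q.hδ
    have h4 : v (p.1, Q.Γ p.1 p.2 b) ≤ v p := by
      rw [hv]
      unfold barrier
      simp only [zero_add, one_mul]
      gcongr
    linarith
  · obtain ⟨q', X', hJ, hop⟩ := hj p hp
    have := le_op_of_supJet hp hpT hq hJ (v p)
    linarith

/-- A radius on which an eventual property within the domain holds. -/
theorem exists_cap {P : ℝ × En n → Prop} {p : ℝ × En n} (h : ∀ᶠ z in 𝓝[Q.dom] p, P z) {ε : ℝ}
    (hε : 0 < ε) : ∃ r > 0, r < ε ∧ ∀ z ∈ Q.dom ∩ Metric.closedBall p r, P z := by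
  rw [eventually_nhdsWithin_iff, Metric.eventually_nhds_iff] at h
  obtain ⟨ε', hε', h⟩ := h
  refine ⟨min ε ε' / 2, by positivity, ?_, fun z hz => h ?_ hz.1⟩
  · have := min_le_left ε ε'
    linarith
  · have h1 := min_le_right ε ε'
    have h2 := Metric.mem_closedBall.1 hz.2
    linarith

theorem eventually_lt_horizon {p : ℝ × En n} (hpT : p.1 < Q.T) : ∀ᶠ z in 𝓝[Q.dom] p, z.1 < Q.T :=
  (continuous_fst.continuousAt.eventually (eventually_lt_nhds hpT)).filter_mono
    nhdsWithin_le_nhds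

theorem SupJet.eventually_le_quadPoly {w : ℝ × En n → ℝ} {S : Set (ℝ × En n)} {p : ℝ × En n}
    {q : ℝ × En n →L[ℝ] ℝ} {X : ℝ × En n →L[ℝ] ℝ × En n →L[ℝ] ℝ} (h : SupJet S w p q X)
    {ν : ℝ} (hν : 0 < ν) : ∀ᶠ z in 𝓝[S] p,
      w z + ν * ‖z - p‖ ^ 2 ≤ quadPoly (w p) p q (symmForm X + (2 * ν) • parForm n) z := by
  filter_upwards [h ν hν] with z hz
  have := quadPoly_ge (w p) p q X (by positivity : 0 ≤ 2 * ν) z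
  linarith

/-- Stability of the subsolution inequality under upper limits. -/
theorem op_nonpos_of_approx {w : ℝ × En n → ℝ} (hw : UpperSemicontinuousOn w Q.dom)
    (gw : Q.Growth w) {p : ℝ × En n} (hp : p ∈ Q.dom) (hpT : p.1 < Q.T)
    (hS : ∀ c < w p, ∃ᶠ z in 𝓝[Q.dom] p, ∃ u : ℝ × En n → ℝ, Q.JSub u ∧
      (∀ z ∈ Q.dom, u z ≤ w z) ∧ c < u z)
    {q : ℝ × En n →L[ℝ] ℝ} {X : ℝ × En n →L[ℝ] ℝ × En n →L[ℝ] ℝ}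
    (hj : SupJet Q.dom w p q X) (hM : Q.M w p < w p) : Q.op p (w p) q X ≤ 0 := by
  refine le_zero_of_forall_sub_mul
    (B := 2 * (1 / 2 * ∑ k, parForm n (0, Q.col p k) (0, Q.col p k))) fun ν hν => ?_
  set Y := symmForm X + (2 * ν) • parForm n with hY
  have hYs : ∀ h k, Y h k = Y k h := parForm_add_symmForm_comm X (2 * ν)
  have key : ∀ ε > (0 : ℝ), ∃ z ∈ Q.dom, ∃ y : ℝ, dist z p < ε ∧ |y - w p| < ε ∧
      Q.op z y (q + Y (z - p)) Y ≤ 0 := by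
    intro ε hε
    set ε₁ := (w p - Q.M w p) / 2 with hε₁
    have hε₁0 : 0 < ε₁ := by rw [hε₁]; linarith
    have hΦc : Continuous (quadPoly (w p) p q Y) := continuous_quadPoly _
    have hm0 : 0 < min ε ε₁ / 2 := by positivity
    have hΦp : quadPoly (w p) p q Y p = w p := quadPoly_self ..
    have hΦev : ∀ η > 0, ∀ᶠ z in 𝓝[Q.dom] p, |quadPoly (w p) p q Y z - w p| < η := by
      intro η hη
      have h1 : Tendsto (quadPoly (w p) p q Y) (𝓝[Q.dom] p) (𝓝 (w p)) := by
        have := hΦc.tendsto p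
        rw [hΦp] at this
        exact this.mono_left nhdsWithin_le_nhds
      filter_upwards [h1.eventually (Metric.ball_mem_nhds _ hη)] with z hz
      rwa [← Real.dist_eq]
    have hMev := upperSemicontinuousOn_M hw p hp (w p - ε₁) (by linarith)
    have hwev := hw p hp (w p + ε) (by linarith)
    obtain ⟨r, hr, hrε, hcap⟩ := exists_cap (((SupJet.eventually_le_quadPoly hj hν).and
      (eventually_lt_horizon hpT)).and ((hΦev _ hm0).and (hMev.and hwev))) hε
    set κ := min (min ε ε₁ / 2) (ν * r ^ 2) with hκ
    have hκ0 : 0 < κ := by positivity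
    have hball : ∀ᶠ z in 𝓝[Q.dom] p, z ∈ Q.dom ∩ Metric.closedBall p r :=
      inter_mem self_mem_nhdsWithin (nhdsWithin_le_nhds (Metric.closedBall_mem_nhds p hr))
    obtain ⟨z₀, ⟨u, hu, huw, hz₀u⟩, hz₀Φ, hz₀⟩ :=
      ((hS (w p - κ / 2) (by linarith)).and_eventually ((hΦev (κ / 2) (by positivity)).and
        hball)).exists
    have husc : UpperSemicontinuousOn (fun z => u z + -quadPoly (w p) p q Y z)
        (Q.dom ∩ Metric.closedBall p r) :=
      (hu.1.mono inter_subset_left).add (hΦc.neg.upperSemicontinuous.upperSemicontinuousOn _)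
    obtain ⟨z, hz, hmax⟩ := husc.exists_isMaxOn ⟨z₀, hz₀⟩ (isCompact_cap p r)
    have hmz := isMaxOn_iff.1 hmax z₀ hz₀
    obtain ⟨⟨h1, h2⟩, h3, h4, h5⟩ := hcap z hz
    rw [abs_lt] at hz₀Φ h3
    have h6 := huw z hz.1
    have hκ1 : κ ≤ min ε ε₁ / 2 := min_le_left _ _
    have hκ2 : κ ≤ ν * r ^ 2 := min_le_right _ _
    have hme := min_le_left ε ε₁
    have hme₁ := min_le_right ε ε₁
    have hzr : dist z p < r := by
      rw [dist_eq_norm]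
      refine lt_of_pow_lt_pow_left₀ 2 hr.le (lt_of_mul_lt_mul_left ?_ hν.le)
      linarith
    have hmax' : IsLocalMaxOn (fun z => u z - quadPoly (w p) p q Y z) Q.dom z := by
      simpa only [← sub_eq_add_neg] using isLocalMaxOn_of_isMaxOn_cap (Q := Q) hmax hzr
    have hjz := SupJet.of_isLocalMaxOn_sub (hasJet_quadPoly (w p) hYs z) hmax'
    refine ⟨z, hz.1, u z, hzr.trans hrε, ?_, ?_⟩
    · rw [abs_lt]; constructor <;> linarith
    · refine (hu.2.2 z hz.1 h2 _ _ hjz).resolve_left ?_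
      have := M_mono gw huw hz.1
      intro h; linarith
  have key' : ∀ k : ℕ, ∃ z ∈ Q.dom, ∃ y : ℝ, dist z p < 1 / ((k : ℝ) + 1) ∧
      |y - w p| < 1 / ((k : ℝ) + 1) ∧ Q.op z y (q + Y (z - p)) Y ≤ 0 :=
    fun k => key _ (by positivity)
  choose z hz y hzp hy hop using key'
  have hzt : Tendsto z atTop (𝓝 p) := tendsto_iff_dist_tendsto_zero.2
    (squeeze_zero (fun _ => dist_nonneg) (fun k => (hzp k).le) tendsto_one_div_add_atTop_nhds_zero_nat)
  have hyt : Tendsto y atTop (𝓝 (w p)) := tendsto_iff_dist_tendsto_zero.2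
    (squeeze_zero (fun _ => dist_nonneg) (fun k => by rw [Real.dist_eq]; exact (hy k).le)
      tendsto_one_div_add_atTop_nhds_zero_nat)
  have hqt : Tendsto (fun k => q + Y (z k - p)) atTop (𝓝 q) := by
    have h0 : Tendsto (fun k => z k - p) atTop (𝓝 0) := by
      simpa using hzt.sub_const p
    have := ((Y.continuous.tendsto 0).comp h0).const_add q
    simpa using this
  have hlim := tendsto_op hp (Eventually.of_forall hz) hzt hyt hqt (tendsto_const_nhds (x := Y))
  have hle : Q.op p (w p) q Y ≤ 0 := le_of_tendsto hlim (Eventually.of_forall hop)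
  rw [hY, op_add_form, op_symmForm] at hle
  linarith

/-- The terminal condition is stable under suprema of subsolutions. -/
theorem terminal_le_of_approx {w : ℝ × En n → ℝ} (hw : UpperSemicontinuousOn w Q.dom)
    (gw : Q.Growth w)
    (hS : ∀ p ∈ Q.dom, ∀ c < w p, ∃ᶠ z in 𝓝[Q.dom] p, ∃ u : ℝ × En n → ℝ, Q.JSub u ∧
      (∀ z ∈ Q.dom, u z ≤ w z) ∧ c < u z) (x₁ : En n) : w (Q.T, x₁) ≤ Q.ψ x₁ := by
  by_contra! hlt
  have hmemT : ∀ x : En n, (Q.T, x) ∈ Q.dom := fun x => mem_dom.2 ⟨Q.hT.le, le_rfl⟩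
  set R := max Q.KΓ ‖x₁‖ with hR
  have husc : UpperSemicontinuousOn (fun x => w (Q.T, x) + -Q.ψ x) (Metric.closedBall (0 : En n) R) := by
    refine UpperSemicontinuousOn.add ?_ (Q.hψc.neg.upperSemicontinuous.upperSemicontinuousOn _)
    intro x hx c hc
    have hcont : Tendsto (fun x : En n => (Q.T, x)) (𝓝 x) (𝓝[Q.dom] (Q.T, x)) :=
      tendsto_nhdsWithin_iff.2 ⟨by apply Continuous.tendsto; fun_prop, Eventually.of_forall hmemT⟩
    exact (hcont.eventually (hw _ (hmemT x) c hc)).filter_mono nhdsWithin_le_nhds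
  have hx₁ : x₁ ∈ Metric.closedBall (0 : En n) R := by
    simp [hR]
  obtain ⟨x, hx, hmax⟩ := husc.exists_isMaxOn ⟨x₁, hx₁⟩ (isCompact_closedBall _ _)
  rw [isMaxOn_iff] at hmax
  have h0 := hmax x₁ hx₁
  set A := w (Q.T, x) with hA
  have hψA : Q.ψ x < A := by linarith
  have hxR : ‖x‖ ≤ R := by simpa using hx
  set p : ℝ × En n := (Q.T, x) with hp
  have hpd : p ∈ Q.dom := hmemT x
  have hMA : Q.M w p < A := by
    obtain ⟨b, hb, -⟩ := exists_M_eq hw hpd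
    rw [hb]
    have h1 : ‖Q.Γ Q.T x b‖ ≤ R :=
      (Q.hΓb Q.T ⟨Q.hT.le, le_rfl⟩ x b).trans (max_le (le_max_left _ _) hxR)
    have h2 := hmax (Q.Γ Q.T x b) (by simpa using h1)
    have h3 := Q.hψΓ x b
    simp only [hp]
    linarith
  set η := (A - max (Q.M w p) (Q.ψ x)) / 4 with hη
  have hmx : max (Q.M w p) (Q.ψ x) < A := max_lt hMA hψA
  have hη0 : 0 < η := by rw [hη]; linarith
  have hψev : ∀ᶠ z in 𝓝[Q.dom] p, Q.ψ z.2 < A - 3 * η := by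
    have h1 : Tendsto (fun z : ℝ × En n => Q.ψ z.2) (𝓝 p) (𝓝 (Q.ψ p.2)) :=
      (Q.hψc.comp continuous_snd).tendsto p
    refine (h1.eventually (eventually_lt_nhds ?_)).filter_mono nhdsWithin_le_nhds
    have := le_max_right (Q.M w p) (Q.ψ x)
    simp only [hp]; linarith
  have hMev : ∀ᶠ z in 𝓝[Q.dom] p, Q.M w z < A - 3 * η := by
    refine upperSemicontinuousOn_M hw p hpd _ ?_
    have := le_max_left (Q.M w p) (Q.ψ x)
    linarith
  obtain ⟨r, hr, -, hcap⟩ := exists_cap (hψev.and hMev) one_pos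
  set K := Q.dom ∩ Metric.closedBall p r with hK
  have hKc : IsCompact K := isCompact_cap p r
  obtain ⟨B, hB⟩ : ∃ B, ∀ z ∈ K, |w z| ≤ B := by
    obtain ⟨B, hB⟩ := gw.exists_bound (‖x‖ + r)
    refine ⟨B, fun z hz => hB z hz.1 ?_⟩
    have h1 : dist z p ≤ r := hz.2
    have h2 : dist z.2 p.2 ≤ dist z p := le_max_right _ _
    rw [dist_eq_norm] at h2
    have h3 := norm_le_norm_add_norm_sub' z.2 p.2
    simp only [hp] at h2 h3 h1
    linarith
  have hAB : |A| ≤ B := hB p ⟨hpd, Metric.mem_closedBall_self hr.le⟩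
  have hB0 : 0 ≤ B := (abs_nonneg _).trans hAB
  set C₁ := (2 * B + 3 * η) / r ^ 2 with hC₁
  have hC₁0 : 0 ≤ C₁ := by positivity
  have hC₁r : C₁ * r ^ 2 = 2 * B + 3 * η := by rw [hC₁]; field_simp
  set Y := C₁ • parForm n with hY
  have hYs : ∀ h k, Y h k = Y k h := fun h k => by
    rw [hY]; simp only [_root_.smul_apply]; rw [parForm_comm]
  obtain ⟨L, hL⟩ : ∃ L : ℝ, ∀ z ∈ K, ∀ y ∈ Icc (-(B + 2 * η)) B, L ≤ Q.op z y (Y (z - p)) Y := by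
    have hcont : ContinuousOn (fun g : (ℝ × En n) × ℝ => Q.op g.1 g.2 (Y (g.1 - p)) Y)
        (K ×ˢ Icc (-(B + 2 * η)) B) := by
      intro g hg
      refine tendsto_op (P := fun g : (ℝ × En n) × ℝ => g.1) hg.1.1 ?_ ?_ ?_ ?_ tendsto_const_nhds
      · filter_upwards [self_mem_nhdsWithin] with g' hg'
        exact hg'.1.1
      · exact continuous_fst.continuousAt.continuousWithinAt
      · exact continuous_snd.continuousAt.continuousWithinAt
      · have : Continuous fun g : (ℝ × En n) × ℝ => Y (g.1 - p) := by fun_prop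
        exact this.continuousAt.continuousWithinAt
    obtain ⟨L, hL⟩ := (hKc.prod isCompact_Icc).bddBelow_image hcont
    exact ⟨L, fun z hz y hy => hL ⟨(z, y), ⟨hz, hy⟩, rfl⟩⟩
  set C₂ := |L| + 1 with hC₂
  set q : ℝ × En n →L[ℝ] ℝ := -(C₂ • ContinuousLinearMap.fst ℝ ℝ (En n)) with hq
  have hopq : ∀ z ∈ K, ∀ y ∈ Icc (-(B + 2 * η)) B, 0 < Q.op z y (q + Y (z - p)) Y := by
    intro z hz y hy
    have h1 := hL z hz y hy
    have h2 : Q.sg z (q + Y (z - p)) = Q.sg z (Y (z - p)) := by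
      ext k; simp [sg, hq]
    have h3 : Q.op z y (q + Y (z - p)) Y = Q.op z y (Y (z - p)) Y + C₂ := by
      unfold op lin
      rw [h2]
      simp [hq]
      ring
    rw [h3, hC₂]
    have := neg_abs_le L
    linarith
  set φ := quadPoly (A - 2 * η) p q Y with hφ
  have hφc : Continuous φ := continuous_quadPoly _
  have hφge : ∀ z ∈ Q.dom, A - 2 * η + C₁ * ‖z - p‖ ^ 2 ≤ φ z := by
    intro z hz
    have h1 := norm_sq_le_half_parForm (z - p)
    have h2 : z.1 ≤ Q.T := (mem_dom.1 hz).2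
    have h3 : φ z = A - 2 * η + C₂ * (Q.T - z.1) + C₁ * (1 / 2 * parForm n (z - p) (z - p)) := by
      rw [hφ, quadPoly, hq, hY]
      simp [hp]
      ring
    have h4 : 0 ≤ C₂ * (Q.T - z.1) := mul_nonneg (by positivity) (by linarith)
    rw [h3]
    nlinarith
  have hle : ∀ u, Q.JSub u → (∀ z ∈ Q.dom, u z ≤ w z) → ∀ z ∈ K, u z ≤ φ z := by
    intro u hu huw z₀ hz₀
    by_contra! hlt'
    have husc' : UpperSemicontinuousOn (fun z => u z + -φ z) K :=
      (hu.1.mono inter_subset_left).add (hφc.neg.upperSemicontinuous.upperSemicontinuousOn _)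
    obtain ⟨z, hz, hmx'⟩ := husc'.exists_isMaxOn ⟨z₀, hz₀⟩ hKc
    have hmz := isMaxOn_iff.1 hmx' z₀ hz₀
    obtain ⟨h1, h2⟩ := hcap z hz
    have h3 := hφge z hz.1
    have h4 := huw z hz.1
    have h5 := abs_le.1 (hB z hz)
    have h6 := abs_le.1 hAB
    have h7 : 0 ≤ C₁ * ‖z - p‖ ^ 2 := by positivity
    have hzr : dist z p < r := by
      rw [dist_eq_norm]
      by_contra! h8
      have : C₁ * r ^ 2 ≤ C₁ * ‖z - p‖ ^ 2 := by gcongr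
      linarith
    have hzT : z.1 < Q.T := by
      refine lt_of_le_of_ne (mem_dom.1 hz.1).2 fun h8 => ?_
      have h9 := hu.2.1 z.2
      rw [← h8] at h9
      have h9 : u z ≤ Q.ψ z.2 := h9
      linarith
    have hmax' : IsLocalMaxOn (fun z => u z - φ z) Q.dom z := by
      simpa only [← sub_eq_add_neg] using isLocalMaxOn_of_isMaxOn_cap (Q := Q) hmx' hzr
    have hjz := SupJet.of_isLocalMaxOn_sub (hasJet_quadPoly (A - 2 * η) hYs z) hmax'
    rcases hu.2.2 z hz.1 hzT _ _ hjz with h8 | h8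
    · have := M_mono gw huw hz.1
      linarith
    · have := hopq z hz (u z) ⟨by linarith, by linarith⟩
      linarith
  have hball : ∀ᶠ z in 𝓝[Q.dom] p, z ∈ K ∧ φ z < A - η := by
    refine Filter.Eventually.and (inter_mem self_mem_nhdsWithin
      (nhdsWithin_le_nhds (Metric.closedBall_mem_nhds p hr))) ?_
    have h1 := hφc.tendsto p
    rw [hφ, quadPoly_self] at h1
    exact (h1.eventually (eventually_lt_nhds (by linarith))).filter_mono nhdsWithin_le_nhds
  obtain ⟨z, ⟨u, hu, huw, hz⟩, hzK, hzφ⟩ :=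
    ((hS p hpd (A - η) (by linarith)).and_eventually hball).exists
  have := hle u hu huw z hzK
  linarith

theorem Growth.exists_majorant {u : ℝ × En n → ℝ} (hu : Q.Growth u) :
    ∃ h : ℝ × En n → ℝ, Continuous h ∧ Q.Growth h ∧ ∀ p ∈ Q.dom, |u p| ≤ h p := by
  obtain ⟨C, hC, ρ, hρ, hb⟩ := hu
  refine ⟨fun p => C * (1 + ‖p.2‖ ^ ρ), ?_, ⟨C, hC, ρ, hρ, fun p _ => ?_⟩, hb⟩
  · have : Continuous fun p : ℝ × En n => ‖p.2‖ ^ ρ :=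
      continuous_snd.norm.rpow_const fun _ => Or.inr hρ.le
    fun_prop
  · rw [abs_of_nonneg]; positivity

theorem Growth.of_abs_le {u g : ℝ × En n → ℝ} (hg : Q.Growth g)
    (h : ∀ p ∈ Q.dom, |u p| ≤ |g p|) : Q.Growth u := by
  obtain ⟨C, hC, ρ, hρ, hb⟩ := hg
  exact ⟨C, hC, ρ, hρ, fun p hp => (h p hp).trans (hb p hp)⟩

theorem Growth.neg {u : ℝ × En n → ℝ} (hu : Q.Growth u) : Q.Growth (fun p => -u p) :=
  hu.of_abs_le fun _ _ => (abs_neg _).le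

theorem Growth.add {u v : ℝ × En n → ℝ} (hu : Q.Growth u) (hv : Q.Growth v) :
    Q.Growth (fun p => u p + v p) :=
  (hu.sub hv.neg).of_abs_le fun p _ => by rw [sub_neg_eq_add]

theorem growth_const (c : ℝ) : Q.Growth (fun _ => c) := by
  refine ⟨|c| + 1, by positivity, 1, one_pos, fun p _ => ?_⟩
  have : 0 ≤ ‖p.2‖ ^ (1 : ℝ) := by positivity
  nlinarith [abs_nonneg c]

theorem Growth.eventually_le {u : ℝ × En n → ℝ} (hu : Q.Growth u) :
    ∀ p ∈ Q.dom, ∃ B, ∀ᶠ z in 𝓝[Q.dom] p, u z ≤ B := by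
  intro p hp
  obtain ⟨h, hc, -, hb⟩ := hu.exists_majorant
  refine ⟨h p + 1, ?_⟩
  have h1 : ∀ᶠ z in 𝓝[Q.dom] p, h z < h p + 1 :=
    (hc.continuousAt.eventually (eventually_lt_nhds (by linarith))).filter_mono
      nhdsWithin_le_nhds
  filter_upwards [h1, self_mem_nhdsWithin] with z h2 h3
  exact (le_abs_self _).trans ((hb z h3).trans h2.le)

theorem Growth.le_usEnv {u : ℝ × En n → ℝ} (hu : Q.Growth u) {p : ℝ × En n} (hp : p ∈ Q.dom) :
    u p ≤ usEnv Q.dom u p :=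
  _root_.le_usEnv hp (hu.eventually_le p hp)

theorem Growth.usEnv {u : ℝ × En n → ℝ} (hu : Q.Growth u) : Q.Growth (usEnv Q.dom u) := by
  obtain ⟨h, hc, hg, hb⟩ := hu.exists_majorant
  refine hg.of_abs_le fun p hp => (abs_le.2 ⟨?_, ?_⟩).trans (le_abs_self _)
  · exact (abs_le.1 (hb p hp)).1.trans (hu.le_usEnv hp)
  · refine usEnv_le_of_continuousWithinAt hp hc.continuousWithinAt ?_
    filter_upwards [self_mem_nhdsWithin] with z hz
    exact (abs_le.1 (hb z hz)).2

variable (Q) in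
/-- There is a largest subsolution of polynomial growth. -/
theorem exists_greatest_jSub : ∃ w, Q.Growth w ∧ Q.JSub w ∧
    ∀ u, Q.Growth u → Q.JSub u → ∀ p ∈ Q.dom, u p ≤ w p := by
  obtain ⟨V, gV, hV⟩ := Q.exists_jSuper
  obtain ⟨u₀, gu₀, hu₀, -, -⟩ := Q.exists_jSub_terminal 0 one_pos
  set 𝒮 : Set (ℝ × En n → ℝ) := {u | Q.Growth u ∧ Q.JSub u} with h𝒮
  set g : ℝ × En n → ℝ := fun p => sSup ((fun u : ℝ × En n → ℝ => u p) '' 𝒮) with hg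
  have hne : ∀ p, ((fun u : ℝ × En n → ℝ => u p) '' 𝒮).Nonempty := fun p =>
    ⟨u₀ p, mem_image_of_mem _ (show u₀ ∈ 𝒮 from ⟨gu₀, hu₀⟩)⟩
  have hub : ∀ p ∈ Q.dom, V p ∈ upperBounds ((fun u : ℝ × En n → ℝ => u p) '' 𝒮) := by
    rintro p hp _ ⟨u, hu, rfl⟩
    exact comparison hu.2 hV hu.1 gV hp
  have hle : ∀ u ∈ 𝒮, ∀ p ∈ Q.dom, u p ≤ g p := fun u hu p hp =>
    le_csSup ⟨V p, hub p hp⟩ (mem_image_of_mem _ hu)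
  have gg : Q.Growth g := by
    obtain ⟨h₀, -, gh₀, hb₀⟩ := gu₀.exists_majorant
    obtain ⟨h₁, -, gh₁, hb₁⟩ := gV.exists_majorant
    refine (gh₀.add gh₁).of_abs_le fun p hp => (abs_le.2 ⟨?_, ?_⟩).trans (le_abs_self _)
    · have h1 := hle u₀ ⟨gu₀, hu₀⟩ p hp
      have h2 := abs_le.1 (hb₀ p hp)
      have h3 := (abs_nonneg _).trans (hb₁ p hp)
      linarith
    · have h1 : g p ≤ V p := csSup_le (hne p) (hub p hp)
      have h2 := abs_le.1 (hb₁ p hp)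
      have h3 := (abs_nonneg _).trans (hb₀ p hp)
      linarith
  have gw := gg.usEnv
  have hw : UpperSemicontinuousOn (usEnv Q.dom g) Q.dom :=
    upperSemicontinuousOn_usEnv gg.eventually_le
  have hS : ∀ p ∈ Q.dom, ∀ c < usEnv Q.dom g p, ∃ᶠ z in 𝓝[Q.dom] p,
      ∃ u : ℝ × En n → ℝ, Q.JSub u ∧ (∀ z ∈ Q.dom, u z ≤ usEnv Q.dom g z) ∧ c < u z := by
    intro p hp c hc
    refine (frequently_of_lt_usEnv hp hc).mono fun z hz => ?_
    obtain ⟨_, ⟨u, hu, rfl⟩, hlt⟩ := exists_lt_of_lt_csSup (hne z) hz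
    exact ⟨u, hu.2, fun y hy => (hle u hu y hy).trans (gg.le_usEnv hy), hlt⟩
  refine ⟨_, gw, ⟨hw, terminal_le_of_approx hw gw hS, fun p hp hpT q X hj => ?_⟩,
    fun u gu hu p hp => (hle u ⟨gu, hu⟩ p hp).trans (gg.le_usEnv hp)⟩
  refine or_iff_not_imp_left.2 fun h => ?_
  exact op_nonpos_of_approx hw gw hp hpT (hS p hp) hj (not_le.1 h)

/-- The lower semicontinuous envelope of the greatest subsolution is a supersolution. -/
theorem jSuper_lsEnv {w : ℝ × En n → ℝ} (gw : Q.Growth w) (hw : Q.JSub w)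
    (hmax : ∀ u, Q.Growth u → Q.JSub u → ∀ p ∈ Q.dom, u p ≤ w p) :
    Q.JSuper (fun z => -usEnv Q.dom (fun z => -w z) z) := by
  set v : ℝ × En n → ℝ := fun z => -usEnv Q.dom (fun z => -w z) z with hv
  have gv : Q.Growth v := gw.neg.usEnv.neg
  have hvw : ∀ z ∈ Q.dom, v z ≤ w z := fun z hz => by
    have := gw.neg.le_usEnv hz
    simp only [hv]; linarith
  have hlsc : LowerSemicontinuousOn v Q.dom := by
    intro p hp c hc
    have := upperSemicontinuousOn_usEnv gw.neg.eventually_le p hp (-c) (by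
      simp only [hv] at hc; linarith)
    filter_upwards [this] with z hz
    simp only [hv]; linarith
  refine ⟨hlsc, fun x => ?_, fun p hp hpT q X hj => ?_⟩
  · refine le_of_forall_pos_sub_le fun ε hε => ?_
    obtain ⟨u, gu, hu, huc, hux⟩ := Q.exists_jSub_terminal x hε
    have hTd : (Q.T, x) ∈ Q.dom := mem_dom.2 ⟨Q.hT.le, le_rfl⟩
    have := usEnv_le_of_continuousWithinAt (g := fun z => -w z) hTd
      huc.neg.continuousWithinAt (by
        filter_upwards [self_mem_nhdsWithin] with z hz
        exact neg_le_neg (hmax u gu hu z hz))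
    simp only [hv, Pi.neg_apply] at this ⊢
    linarith
  by_contra hcon
  have hcon' : v p < Q.M v p ∨ Q.op p (v p) q X < 0 := by
    by_contra! h
    exact hcon h
  clear hcon
  set D := 1 / 2 * ∑ k, parForm n (0, Q.col p k) (0, Q.col p k) with hD
  obtain ⟨ν, hν, hcon⟩ : ∃ ν > (0 : ℝ), v p < Q.M v p ∨
      Q.op p (v p) q (symmForm X + (-(2 * ν)) • parForm n) < 0 := by
    rcases hcon' with h | h
    · exact ⟨1, one_pos, Or.inl h⟩
    · refine ⟨-Q.op p (v p) q X / (4 * (|D| + 1)), by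
        have : 0 < -Q.op p (v p) q X := by linarith
        positivity, Or.inr ?_⟩
      rw [op_add_form, op_symmForm, ← hD]
      have h1 : 2 * (-Q.op p (v p) q X / (4 * (|D| + 1))) * (|D| + 1) = -Q.op p (v p) q X / 2 := by
        field_simp; ring
      have h2 : 0 ≤ 2 * (-Q.op p (v p) q X / (4 * (|D| + 1))) := by
        have : 0 < -Q.op p (v p) q X := by linarith
        positivity
      nlinarith [le_abs_self D]
  set Y := symmForm X + (-(2 * ν)) • parForm n with hY
  have hYs : ∀ h k, Y h k = Y k h := parForm_add_symmForm_comm X _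
  have hYneg : symmForm (-X) + (2 * ν) • parForm n = -Y := by
    refine ContinuousLinearMap.ext fun h => ContinuousLinearMap.ext fun k => ?_
    simp only [hY, symmForm, _root_.add_apply, _root_.neg_apply, _root_.smul_apply,
      ContinuousLinearMap.flip_apply, smul_eq_mul]
    ring
  have hquad : ∀ᶠ z in 𝓝[Q.dom] p, quadPoly (v p) p q Y z + ν * ‖z - p‖ ^ 2 ≤ v z := by
    filter_upwards [SupJet.eventually_le_quadPoly hj hν] with z hz
    rw [hYneg] at hz
    simp only [quadPoly, _root_.neg_apply] at hz ⊢
    linarith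
  obtain ⟨ε, hε, hnear⟩ : ∃ ε > 0, ∀ᶠ z in 𝓝[Q.dom] p, ∀ y, |y - v p| < ε →
      y < Q.M v z ∨ Q.op z y (q + Y (z - p)) Y < 0 := by
    have h1 : ∀ᶠ g : (ℝ × En n) × ℝ in 𝓝[Q.dom] p ×ˢ 𝓝 (v p),
        g.2 < Q.M v g.1 ∨ Q.op g.1 g.2 (q + Y (g.1 - p)) Y < 0 := by
      have ht1 : Tendsto (fun g : (ℝ × En n) × ℝ => g.1) (𝓝[Q.dom] p ×ˢ 𝓝 (v p)) (𝓝 p) :=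
        tendsto_fst.mono_right nhdsWithin_le_nhds
      rcases hcon with h | h
      · obtain ⟨c, hc1, hc2⟩ := exists_between h
        filter_upwards [tendsto_fst.eventually (lowerSemicontinuousOn_M hlsc gv p hp c hc2),
          tendsto_snd.eventually (eventually_lt_nhds hc1)] with g h2 h3
        exact Or.inl (h3.trans h2)
      · have hqt : Tendsto (fun g : (ℝ × En n) × ℝ => q + Y (g.1 - p)) (𝓝[Q.dom] p ×ˢ 𝓝 (v p))
            (𝓝 q) := by
          have h2 : Continuous fun z : ℝ × En n => q + Y (z - p) := by fun_prop
          have h3 := (h2.tendsto p).comp ht1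
          simpa [Function.comp_def] using h3
        have h4 := tendsto_op hp (tendsto_fst.eventually self_mem_nhdsWithin) ht1 tendsto_snd hqt
          (tendsto_const_nhds (x := Y))
        filter_upwards [h4.eventually (eventually_lt_nhds h)] with g h5
        exact Or.inr h5
    obtain ⟨P₁, hP₁, P₂, hP₂, hP⟩ := Filter.eventually_prod_iff.1 h1
    obtain ⟨ε, hε, hP₂⟩ := Metric.eventually_nhds_iff.1 hP₂
    refine ⟨ε, hε, hP₁.mono fun z hz y hy => hP hz (hP₂ ?_)⟩
    rwa [Real.dist_eq]
  have hφev : ∀ᶠ z in 𝓝[Q.dom] p, |quadPoly (v p) p q Y z - v p| < ε / 2 := by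
    have h1 := (continuous_quadPoly (p := p) (q := q) (X := Y) (v p)).tendsto p
    rw [quadPoly_self] at h1
    filter_upwards [(h1.mono_left nhdsWithin_le_nhds).eventually
      (Metric.ball_mem_nhds _ (half_pos hε))] with z hz
    rwa [← Real.dist_eq]
  obtain ⟨r, hr, -, hcap⟩ := exists_cap ((hquad.and (eventually_lt_horizon hpT)).and
    (hnear.and hφev)) one_pos
  set κ := min (ε / 2) (ν * (r / 2) ^ 2) with hκ
  have hκ0 : 0 < κ := by positivity
  have hκε : κ ≤ ε / 2 := min_le_left _ _
  have hκν : κ ≤ ν * (r / 2) ^ 2 := min_le_right _ _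
  set φ := quadPoly (v p + κ) p q Y with hφ
  have hφc : Continuous φ := continuous_quadPoly _
  have hφeq : ∀ z, φ z = quadPoly (v p) p q Y z + κ := fun z => by
    simp only [hφ, quadPoly]; ring
  have hball : ∀ z, dist z p < r → z ∈ Metric.closedBall p r := fun z hz =>
    Metric.mem_closedBall.2 hz.le
  have hφv : ∀ z ∈ Q.dom, dist z p < r → |φ z - v p| < ε := by
    intro z hz hzr
    have h1 := abs_lt.1 (hcap z ⟨hz, hball z hzr⟩).2.2
    rw [hφeq, abs_lt]
    constructor <;> linarith
  set u : ℝ × En n → ℝ := fun z => if dist z p < r then max (w z) (φ z) else w z with hu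
  have hu_in : ∀ z, dist z p < r → u z = max (w z) (φ z) := fun z hz => if_pos hz
  have hu_out : ∀ z ∈ Q.dom, r / 2 ≤ dist z p → u z = w z := by
    intro z hz hzr
    by_cases h : dist z p < r
    · rw [hu_in z h, max_eq_left]
      have h1 := (hcap z ⟨hz, hball z h⟩).1.1
      have h2 : ν * (r / 2) ^ 2 ≤ ν * ‖z - p‖ ^ 2 := by
        rw [← dist_eq_norm]; gcongr
      rw [hφeq]
      linarith [hvw z hz]
    · exact if_neg h
  have hwu : ∀ z, w z ≤ u z := fun z => by
    simp only [hu]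
    split_ifs
    · exact le_max_left _ _
    · exact le_rfl
  have gu : Q.Growth u := by
    obtain ⟨h, -, gh, hb⟩ := gw.exists_majorant
    refine (gh.add (growth_const (|v p| + ε))).of_abs_le fun z hz =>
      le_trans ?_ (le_abs_self _)
    have h1 := hb z hz
    have h2 := abs_nonneg (v p)
    by_cases hzr : dist z p < r
    · rw [hu_in z hzr]
      refine abs_max_le_max_abs_abs.trans (max_le (by linarith) ?_)
      have h3 := hφv z hz hzr
      have h4 := abs_add_le (φ z - v p) (v p)
      rw [sub_add_cancel] at h4
      linarith [(abs_nonneg _).trans h1]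
    · rw [hu_out z hz (by linarith)]
      linarith
  have hopen : ∀ z, dist z p < r → ∀ᶠ y in 𝓝[Q.dom] z, dist y p < r := fun z hz =>
    ((continuous_id.dist continuous_const).continuousAt.eventually
      (eventually_lt_nhds hz)).filter_mono nhdsWithin_le_nhds
  have husub : Q.JSub u := by
    refine ⟨fun z hz c hc => ?_, fun x => ?_, fun z hz hzT q' X' hj' => ?_⟩
    · change u z < c at hc
      change ∀ᶠ y in 𝓝[Q.dom] z, u y < c
      by_cases hzr : dist z p < r
      · rw [hu_in z hzr] at hc
        filter_upwards [hopen z hzr, hw.1 z hz c (lt_of_le_of_lt (le_max_left _ _) hc),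
          (hφc.continuousAt.eventually (eventually_lt_nhds
            (lt_of_le_of_lt (le_max_right _ _) hc))).filter_mono nhdsWithin_le_nhds]
          with y h1 h2 h3
        rw [hu_in y h1]
        exact max_lt h2 h3
      · have hzr' : r / 2 < dist z p := by linarith
        rw [hu_out z hz hzr'.le] at hc
        filter_upwards [((continuous_id.dist continuous_const).continuousAt.eventually
          (eventually_gt_nhds hzr')).filter_mono nhdsWithin_le_nhds, hw.1 z hz c hc,
          self_mem_nhdsWithin] with y h1 h2 h3
        rwa [hu_out y h3 (le_of_lt h1)]
    · have hTd : (Q.T, x) ∈ Q.dom := mem_dom.2 ⟨Q.hT.le, le_rfl⟩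
      have : ¬ dist (Q.T, x) p < r := fun h =>
        lt_irrefl _ (hcap _ ⟨hTd, hball _ h⟩).1.2
      rw [hu_out _ hTd (by linarith)]
      exact hw.2.1 x
    · have hMwu := M_mono gu (fun z _ => hwu z) hz
      have hMvw := M_mono gw hvw hz
      by_cases huw : u z = w z
      · rw [huw]
        have h1 := hw.2.2 z hz hzT q' X'
          (hj'.mono_fun (Eventually.of_forall fun y => hwu y) huw.symm)
        exact h1.imp_left fun h => h.trans hMwu
      · have hzr : dist z p < r := by
          by_contra h
          exact huw (hu_out z hz (by linarith))
        have huφ : u z = φ z := by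
          rw [hu_in z hzr] at huw ⊢
          exact max_eq_right (le_of_not_ge fun h => huw (max_eq_left h))
        have hjφ : SupJet Q.dom φ z q' X' := by
          refine hj'.mono_fun ?_ huφ.symm
          filter_upwards [hopen z hzr] with y hy
          rw [hu_in y hy]
          exact le_max_right _ _
        have h1 := op_le_of_supJet hz hzT hjφ (hasJet_quadPoly (v p + κ) hYs z) (u z)
        have h2 := (hcap z ⟨hz, hball z hzr⟩).2.1 (u z) (by
          rw [huφ]; exact hφv z hz hzr)
        rcases h2 with h2 | h2
        · left; linarith
        · right; linarith
  have huw := hmax u gu husub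
  have hfin : usEnv Q.dom (fun z => -w z) p ≤ -φ p := by
    refine usEnv_le_of_continuousWithinAt (h := fun z => -φ z) hp
      hφc.neg.continuousWithinAt ?_
    filter_upwards [hopen p (by rwa [dist_self]), self_mem_nhdsWithin] with z h1 h2
    have h3 := huw z h2
    rw [hu_in z h1] at h3
    exact neg_le_neg ((le_max_right _ _).trans h3)
  have h1 : φ p = v p + κ := quadPoly_self ..
  have h2 : v p = -usEnv Q.dom (fun z => -w z) p := rfl
  linarith

theorem JSuper.congr {u v : ℝ × En n → ℝ} (hv : Q.JSuper v) (h : ∀ z ∈ Q.dom, u z = v z) :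
    Q.JSuper u := by
  have hM : ∀ p ∈ Q.dom, Q.M u p = Q.M v p := fun p hp => by
    unfold M
    exact iSup_congr fun b => by rw [h _ (mem_dom_Γ hp b)]
  refine ⟨fun p hp c hc => ?_, fun x => ?_, fun p hp hpT q X hj => ?_⟩
  · change c < u p at hc
    rw [h p hp] at hc
    filter_upwards [hv.1 p hp c hc, self_mem_nhdsWithin] with z h1 h2
    change c < u z
    rwa [h z h2]
  · rw [h _ (mem_dom.2 ⟨Q.hT.le, le_rfl⟩)]
    exact hv.2.1 x
  · rw [h p hp, hM p hp]
    refine hv.2.2 p hp hpT q X (hj.mono_fun ?_ (by rw [h p hp]))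
    filter_upwards [self_mem_nhdsWithin] with z hz
    rw [h z hz]

variable (Q) in
/-- Existence of a continuous viscosity solution of polynomial growth. -/
theorem exists_solution : ∃ v, Q.Growth v ∧ ContinuousOn v Q.dom ∧ Q.JSub v ∧ Q.JSuper v := by
  obtain ⟨w, gw, hw, hmax⟩ := Q.exists_greatest_jSub
  have hv := jSuper_lsEnv gw hw hmax
  have gv := gw.neg.usEnv.neg
  have heq : ∀ z ∈ Q.dom, w z = -usEnv Q.dom (fun z => -w z) z := fun z hz =>
    le_antisymm (comparison hw hv gw gv hz) (by linarith [gw.neg.le_usEnv hz])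
  have hw' := hv.congr heq
  exact ⟨w, gw, continuousOn_iff_lower_upperSemicontinuousOn.2 ⟨hw'.1, hw.1⟩, hw, hw'⟩

end QVI

/-- With a local driver `f(t,x,y,z)`, the quasi-variational inequality
`min{ v - Mv, -v_t - Lv - f(t,x,v,σᵀ∇v) } = 0` on `[0,T) × ℝ^n`, `v(T,·) = ψ`,
admits a viscosity solution `v ∈ Π^g_c`, unique among viscosity solutions in `Π^g`. -/
theorem local_qvi_viscosity_existence_uniqueness
    (n d : ℕ) (hn : 0 < n) (hd : 0 < d) (T : ℝ) (hT : 0 < T)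
    (U : Type) [MetricSpace U] [CompactSpace U] [Nonempty U]
    (Γ : ℝ → En n → U → En n) (ℓ : ℝ → En n → U → ℝ)
    (a : ℝ → En n → En n) (σm : ℝ → En n → Matrix (Fin n) (Fin d) ℝ)
    (f : ℝ → En n → ℝ → Ed d → ℝ) (ψ : En n → ℝ)
    (KΓ δ Cf kf Cψ Cℓ qℓ Caσ kaσ ρ : ℝ)
    (hKΓ : 0 < KΓ) (hδ : 0 < δ) (hρ : 0 < ρ)
    (hCf : 0 < Cf) (hkf : 0 < kf) (hCψ : 0 < Cψ) (hCℓ : 0 < Cℓ) (hqℓ : 0 < qℓ)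
    (hCaσ : 0 < Caσ) (hkaσ : 0 < kaσ)
    -- assumptions on Γ
    (hΓc : ContinuousOn (fun p : ℝ × En n × U => Γ p.1 p.2.1 p.2.2)
      (Icc 0 T ×ˢ (univ : Set (En n × U))))
    (hΓb : ∀ t ∈ Icc (0:ℝ) T, ∀ (x : En n) (b : U), ‖Γ t x b‖ ≤ max KΓ ‖x‖)
    -- assumptions on ℓ
    (hℓc : ContinuousOn (fun p : ℝ × En n × U => ℓ p.1 p.2.1 p.2.2)
      (Icc 0 T ×ˢ (univ : Set (En n × U))))
    (hℓlb : ∀ t ∈ Icc (0:ℝ) T, ∀ (x : En n) (b : U), δ ≤ ℓ t x b)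
    (hℓg : ∀ t ∈ Icc (0:ℝ) T, ∀ (x : En n) (b : U), |ℓ t x b| ≤ Cℓ * (1 + ‖x‖ ^ qℓ))
    -- assumptions on ψ
    (hψc : Continuous ψ)
    (hψg : ∀ x : En n, |ψ x| ≤ Cψ * (1 + ‖x‖ ^ ρ))
    (hψΓ : ∀ (x : En n) (b : U), ψ (Γ T x b) - ℓ T x b < ψ x)
    -- assumptions on a and σ
    (hac : ContinuousOn (fun p : ℝ × En n => a p.1 p.2) (Strip n T))
    (hσc : ContinuousOn (fun p : ℝ × En n => σm p.1 p.2) (Strip n T))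
    (haσg : ∀ t ∈ Icc (0:ℝ) T, ∀ x : En n, ‖a t x‖ + frob (σm t x) ≤ Caσ * (1 + ‖x‖))
    (haσLip : ∀ t ∈ Icc (0:ℝ) T, ∀ x x' : En n,
      ‖a t x - a t x'‖ + frob (σm t x - σm t x') ≤ kaσ * ‖x - x'‖)
    -- assumptions on the local driver f:
    -- jointly continuous in (t,x) uniformly in (y,z)
    (hfc : ∀ ε > (0:ℝ), ∀ p ∈ Strip n T, ∃ δ' > (0:ℝ),
      ∀ q ∈ Strip n T, dist q p ≤ δ' → ∀ (y : ℝ) (z : Ed d),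
        |f q.1 q.2 y z - f p.1 p.2 y z| ≤ ε)
    -- Lipschitz in (y,z) uniformly in (t,x)
    (hfLip : ∀ t ∈ Icc (0:ℝ) T, ∀ (x : En n) (y y' : ℝ) (z z' : Ed d),
      |f t x y' z' - f t x y z| ≤ kf * (|y' - y| + ‖z' - z‖))
    -- (t,x) ↦ f(t,x,0,0) is of polynomial growth
    (hfg : ∀ t ∈ Icc (0:ℝ) T, ∀ x : En n, |f t x 0 0| ≤ Cf * (1 + ‖x‖ ^ ρ)) :
    ∃ v : ℝ → En n → ℝ, PGc T v ∧
      IsSuper T Γ ℓ a σm f ψ v ∧ IsSub T Γ ℓ a σm f ψ v ∧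
      ∀ w : ℝ → En n → ℝ, PolyGrowth T w →
        IsSuper T Γ ℓ a σm f ψ w → IsSub T Γ ℓ a σm f ψ w →
        ∀ t ∈ Icc (0:ℝ) T, ∀ x : En n, w t x = v t x := by
  let Q : QVI n d U :=
    { T := T, Γ := Γ, ℓ := ℓ, a := a, σm := σm, f := f, ψ := ψ, KΓ := KΓ, δ := δ, Cf := Cf,
      kf := kf, Cψ := Cψ, Caσ := Caσ, kaσ := kaσ, ρ := ρ, hT := hT, hKΓ := hKΓ, hδ := hδ,
      hρ := hρ, hCf := hCf, hkf := hkf, hCψ := hCψ, hCaσ := hCaσ, hkaσ := hkaσ, hΓc := hΓc,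
      hΓb := hΓb, hℓc := hℓc, hℓlb := hℓlb, hψc := hψc, hψg := hψg, hψΓ := hψΓ, hac := hac,
      hσc := hσc, haσg := haσg, haσLip := haσLip, hfc := hfc, hfLip := hfLip, hfg := hfg }
  obtain ⟨v, gv, hvc, hsub, hsuper⟩ := Q.exists_solution
  refine ⟨fun t x => v (t, x), ⟨?_, hvc⟩, QVI.jSuper_iff (Q := Q).1 hsuper, QVI.jSub_iff (Q := Q).1 hsub,
    fun w ⟨C, hC, ρ', hρ', hw⟩ hwsuper hwsub t ht x => ?_⟩
  · obtain ⟨C, hC, ρ', hρ', hb⟩ := gv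
    exact ⟨C, hC, ρ', hρ', fun t ht x => hb (t, x) (QVI.mem_dom.2 ht)⟩
  · have gw : Q.Growth (fun p => w p.1 p.2) :=
      ⟨C, hC, ρ', hρ', fun p hp => hw p.1 (QVI.mem_dom.1 hp) p.2⟩
    have hp : (t, x) ∈ Q.dom := QVI.mem_dom.2 ht
    exact le_antisymm
      (QVI.comparison (QVI.jSub_iff (Q := Q).2 hwsub) hsuper gw gv hp)
      (QVI.comparison hsub (QVI.jSuper_iff (Q := Q).2 hwsuper) gv gw hp)
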